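/- For every finite normal-form game G there exist non-negative integers ℓ ≤ K, depending only on the number of players N and the cardinalities of the pure-strategy sets S_1,…,S_N, such that a mixed-strategy profile σ ∈ Σ is a perfect equilibrium of G if and only if there exists an LPS profile ϱ of order K over S such that: (1) ϱ has full support and ℓ(ϱ) ≤ ℓ; (2) ϱ_n^0 = σ_n for each player n; (3) σ_n is a best reply of order K against ϱ for each player n. -/

import Mathlib

namespace GamePE

variable {N : ℕ}

/-- A (not necessarily mixed) strategy profile. -/
abbrev Profile (S : Fin N → Type) := ∀ n, S n → ℝ

/-- τ is a profile of mixed strategies. -/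
def IsMixed {S : Fin N → Type} [∀ n, Fintype (S n)] (τ : Profile S) : Prop :=
  ∀ n, (∀ s, 0 ≤ τ n s) ∧ (∑ s, τ n s) = 1

/-- τ is completely mixed. -/
def CompletelyMixed {S : Fin N → Type} (τ : Profile S) : Prop := ∀ n s, 0 < τ n s

/-- The pure strategy sn viewed as a mixed strategy. -/
def pureStrat {S : Fin N → Type} [∀ n, DecidableEq (S n)] {n : Fin N} (sn : S n) : S n → ℝ :=
  fun s => if s = sn then 1 else 0

/-- The multilinear extension of player n's payoff. -/
noncomputable def payoff {S : Fin N → Type} [∀ n, Fintype (S n)]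
    (G : Fin N → (∀ m, S m) → ℝ) (n : Fin N) (τ : Profile S) : ℝ :=
  ∑ s : ∀ m, S m, (∏ m, τ m (s m)) * G n s

/-- σ is a perfect equilibrium of the game G. -/
noncomputable def IsPerfect {S : Fin N → Type} [∀ n, Fintype (S n)] [∀ n, DecidableEq (S n)]
    (G : Fin N → (∀ m, S m) → ℝ) (σ : Profile S) : Prop :=
  ∃ σk : ℕ → Profile S,
    (∀ k, IsMixed (σk k) ∧ CompletelyMixed (σk k)) ∧
    Filter.Tendsto σk Filter.atTop (nhds σ) ∧
    (∀ (k : ℕ) (n : Fin N) (sn : S n),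
      payoff G n (Function.update (σk k) n (σ n)) ≥
        payoff G n (Function.update (σk k) n (pureStrat sn)))

/-- ϱ is an LPS profile of order K : each level of each player is a probability distribution. -/
def IsLPSProfile {S : Fin N → Type} [∀ n, Fintype (S n)] {K : ℕ}
    (ϱ : ∀ n, Fin (K+1) → S n → ℝ) : Prop :=
  ∀ n k, (∀ s, 0 ≤ ϱ n k s) ∧ (∑ s, ϱ n k s) = 1

/-- Full support for an LPS profile. -/
def FullSupport {S : Fin N → Type} {K : ℕ} (ϱ : ∀ n, Fin (K+1) → S n → ℝ) : Prop :=
  ∀ n, ∀ s : S n, ∃ k, ϱ n k s ≠ 0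

/-- ℓ(ϱ) : the max over the players of the first level at which the union of supports is everything. -/
noncomputable def lpsLevel {S : Fin N → Type} [∀ n, Fintype (S n)] {K : ℕ}
    (ϱ : ∀ n, Fin (K+1) → S n → ℝ) : ℕ :=
  Finset.univ.sup fun n =>
    sInf {k : ℕ | ∀ s : S n, ∃ i : Fin (K+1), (i : ℕ) ≤ k ∧ ϱ n i s ≠ 0}

/-- Combine a pure strategy of player n with a pure strategy profile of the others. -/
def combine {S : Fin N → Type} (n : Fin N) (sn : S n)
    (so : ∀ m : {m : Fin N // m ≠ n}, S m.val) : ∀ m, S m :=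
  fun m => if h : m = n then cast (congrArg S h.symm) sn else so ⟨m, h⟩

/-- Unnormalized induced beliefs of player n at level k. -/
noncomputable def ubelief {S : Fin N → Type} [∀ n, Fintype (S n)] {K : ℕ}
    (ϱ : ∀ n, Fin (K+1) → S n → ℝ) (n : Fin N) (k : ℕ)
    (so : ∀ m : {m : Fin N // m ≠ n}, S m.val) : ℝ :=
  ∑ kv ∈ Finset.univ.filter
      (fun kv : {m : Fin N // m ≠ n} → Fin (K+1) => (∑ m, ((kv m : ℕ))) = k),
    ∏ m : {m : Fin N // m ≠ n}, ϱ m.val (kv m) (so m)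

/-- Induced beliefs μ_n^k of player n at level k (normalized). -/
noncomputable def belief {S : Fin N → Type} [∀ n, Fintype (S n)] {K : ℕ}
    (ϱ : ∀ n, Fin (K+1) → S n → ℝ) (n : Fin N) (k : ℕ)
    (so : ∀ m : {m : Fin N // m ≠ n}, S m.val) : ℝ :=
  (∑ so' : ∀ m : {m : Fin N // m ≠ n}, S m.val, ubelief ϱ n k so')⁻¹ * ubelief ϱ n k so

/-- Expected payoff of player n playing τn against a belief μ over the opponents' profiles. -/
noncomputable def beliefPayoff {S : Fin N → Type} [∀ n, Fintype (S n)]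
    (G : Fin N → (∀ m, S m) → ℝ) (n : Fin N) (τn : S n → ℝ)
    (μ : (∀ m : {m : Fin N // m ≠ n}, S m.val) → ℝ) : ℝ :=
  ∑ so : ∀ m : {m : Fin N // m ≠ n}, S m.val, ∑ sn : S n,
    μ so * τn sn * G n (combine n sn so)

/-- Lexicographic comparison of the first k+1 entries (indices 0,…,k) of two sequences. -/
def lexGe (k : ℕ) (a b : ℕ → ℝ) : Prop :=
  (∀ i ≤ k, a i = b i) ∨ ∃ i ≤ k, (∀ j < i, a j = b j) ∧ b i < a i

/-- τn is a best reply of order k against the LPS profile ϱ. -/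
noncomputable def lpsBestReply {S : Fin N → Type} [∀ n, Fintype (S n)] [∀ n, DecidableEq (S n)]
    (G : Fin N → (∀ m, S m) → ℝ) {K : ℕ} (ϱ : ∀ n, Fin (K+1) → S n → ℝ)
    (n : Fin N) (τn : S n → ℝ) (k : ℕ) : Prop :=
  ∀ sn : S n,
    lexGe k (fun i => beliefPayoff G n τn (belief ϱ n i))
            (fun i => beliefPayoff G n (pureStrat sn) (belief ϱ n i))

/-- A polynomial strategy profile. -/
abbrev PolyProfile (S : Fin N → Type) := ∀ n, S n → Polynomial ℝ

/-- f > 0 for a univariate real polynomial: the trailing (lowest-order) coefficient is positive. -/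
def polyPos (f : Polynomial ℝ) : Prop := 0 < f.trailingCoeff

/-- f ≥ 0 : f is identically zero or its trailing coefficient is positive. -/
def polyNonneg (f : Polynomial ℝ) : Prop := f = 0 ∨ 0 < f.trailingCoeff

/-- The order o(η) of a polynomial strategy profile (∞ if some coordinate is zero). -/
noncomputable def polyOrder {S : Fin N → Type} [∀ n, Fintype (S n)]
    (η : PolyProfile S) : ℕ∞ :=
  Finset.univ.sup fun p : Σ n, S n => (η p.1 p.2).trailingDegree

/-- The polynomial t ↦ G_n(τn, η_{-n}(t)). -/
noncomputable def payoffPoly {S : Fin N → Type} [∀ n, Fintype (S n)]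
    (G : Fin N → (∀ m, S m) → ℝ) (η : PolyProfile S) (n : Fin N) (τn : S n → ℝ) :
    Polynomial ℝ :=
  ∑ s : ∀ m, S m,
    (Polynomial.C (τn (s n)) * ∏ m ∈ Finset.univ.erase n, η m (s m)) * Polynomial.C (G n s)

/-- τn is a best reply of order r against the polynomial strategy profile η. -/
noncomputable def polyBestReply {S : Fin N → Type} [∀ n, Fintype (S n)] [∀ n, DecidableEq (S n)]
    (G : Fin N → (∀ m, S m) → ℝ) (η : PolyProfile S) (n : Fin N) (τn : S n → ℝ) (r : ℕ) : Prop :=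
  ∀ sn : S n,
    polyNonneg (payoffPoly G η n τn - payoffPoly G η n (pureStrat sn)) ∨
    ((r + 1 : ℕ) : ℕ∞) ≤ (payoffPoly G η n τn - payoffPoly G η n (pureStrat sn)).trailingDegree

end GamePE

namespace GamePE

open Polynomial

section PolynomialIVT

/-- The intermediate value property for polynomials over an ordered field. -/
def PolyIVT (R : Type*) [Field R] [LinearOrder R] : Prop :=
  ∀ (p : R[X]) (a b : R), a < b → p.eval a < 0 → 0 < p.eval b →
    ∃ c, a < c ∧ c < b ∧ p.eval c = 0

variable {R : Type*} [Field R] [LinearOrder R] [IsStrictOrderedRing R]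

theorem PolyIVT.exists_root (hR : PolyIVT R) (p : R[X]) {a b : R} (hab : a < b)
    (h : p.eval a * p.eval b < 0) : ∃ c, a < c ∧ c < b ∧ p.eval c = 0 := by
  rcases mul_neg_iff.1 h with ⟨ha, hb⟩ | ⟨ha, hb⟩
  · obtain ⟨c, h1, h2, h3⟩ := hR (-p) a b hab (by simpa using ha) (by simpa using hb)
    exact ⟨c, h1, h2, by simpa using h3⟩
  · exact hR p a b hab ha hb

theorem PolyIVT.rolle (hR : PolyIVT R) (p : R[X]) (hp : p ≠ 0) {a b : R} (hab : a < b)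
    (ha : p.eval a = 0) (hb : p.eval b = 0) :
    ∃ c, a < c ∧ c < b ∧ p.derivative.eval c = 0 := by
  classical
  -- replace `b` by the next root
  let T := p.roots.toFinset.filter (fun x => a < x)
  have hT : T.Nonempty := ⟨b, by simp [T, hp, hb, hab]⟩
  obtain ⟨b', hb'T, hmin⟩ := T.exists_min_image id hT
  have hb' : p.eval b' = 0 ∧ a < b' := by simpa [T, hp] using hb'T
  have hle : b' ≤ b := hmin b (by simp [T, hp, hb, hab])
  have hno : ∀ x, a < x → x < b' → p.eval x ≠ 0 := fun x h1 h2 h3 =>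
    absurd (hmin x (by simp [T, hp, h3, h1])) (not_le.2 h2)
  obtain ⟨q, hq, hqa⟩ := exists_eq_pow_rootMultiplicity_mul_and_not_dvd p hp a
  have hq0 : q ≠ 0 := by rintro rfl; simp at hqa
  obtain ⟨r, hr, hrb⟩ := exists_eq_pow_rootMultiplicity_mul_and_not_dvd q hq0 b'
  have hm : 0 < p.rootMultiplicity a := (rootMultiplicity_pos hp).2 ha
  have hqb : q.eval b' = 0 := by
    have := hb'.1
    rw [hq] at this
    simpa [sub_eq_zero, hb'.2.ne', hm.ne'] using this
  have hn : 0 < q.rootMultiplicity b' := (rootMultiplicity_pos hq0).2 hqb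
  obtain ⟨m, hm'⟩ := Nat.exists_eq_succ_of_ne_zero hm.ne'
  obtain ⟨n, hn'⟩ := Nat.exists_eq_succ_of_ne_zero hn.ne'
  have hra : r.eval a ≠ 0 := by
    intro h
    exact hqa (by rw [hr]; exact dvd_mul_of_dvd_right (dvd_iff_isRoot.2 h) _)
  have hrb' : r.eval b' ≠ 0 := fun h => hrb (dvd_iff_isRoot.2 h)
  have hrr : 0 < r.eval a * r.eval b' := by
    by_contra hcon
    have hlt : r.eval a * r.eval b' < 0 :=
      lt_of_le_of_ne (not_lt.1 hcon) (mul_ne_zero hra hrb')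
    obtain ⟨c, h1, h2, h3⟩ := hR.exists_root r hb'.2 hlt
    exact hno c h1 h2 (by rw [hq, hr]; simp [h3])
  have hpe : p = (X - C a) ^ (m + 1) * ((X - C b') ^ (n + 1) * r) := by
    conv_lhs => rw [hq, hr]
    rw [hm', hn']
  let H : R[X] := (C ((m : R) + 1) * (X - C b') + C ((n : R) + 1) * (X - C a)) * r
    + (X - C a) * (X - C b') * derivative r
  have hder : derivative p = (X - C a) ^ m * (X - C b') ^ n * H := by
    rw [hpe]
    simp only [derivative_mul, derivative_X_sub_C_pow, H, Nat.add_sub_cancel]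
    push_cast
    ring
  have hHa : H.eval a = (m + 1) * (a - b') * r.eval a := by simp [H]
  have hHb : H.eval b' = (n + 1) * (b' - a) * r.eval b' := by simp [H]
  have hH : H.eval a * H.eval b' < 0 := by
    rw [hHa, hHb]
    have h1 : 0 < b' - a := sub_pos.2 hb'.2
    have h2 : (0 : R) < m + 1 := by positivity
    have h3 : (0 : R) < n + 1 := by positivity
    have : 0 < ((m : R) + 1) * (n + 1) * (b' - a) * (b' - a) * (r.eval a * r.eval b') := by
      positivity
    linarith
  obtain ⟨c, h1, h2, h3⟩ := hR.exists_root H hb'.2 hH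
  exact ⟨c, h1, h2.trans_le hle, by rw [hder]; simp [h3]⟩

theorem PolyIVT.sign_sub (hR : PolyIVT R) (p : R[X]) {a b : R} (hab : a < b) {σ : SignType}
    (h : ∀ x, a < x → x < b → SignType.sign (p.derivative.eval x) = σ) :
    SignType.sign (p.eval b - p.eval a) = σ := by
  have hba : 0 < b - a := sub_pos.2 hab
  set s := (p.eval b - p.eval a) / (b - a) with hs
  have hs' : p.eval b - p.eval a = s * (b - a) := by rw [hs]; field_simp
  let q : R[X] := p - C (p.eval a) - C s * (X - C a)
  have hder : derivative q = derivative p - C s := by simp [q]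
  have key : ∃ c, a < c ∧ c < b ∧ q.derivative.eval c = 0 := by
    by_cases hq : q = 0
    · obtain ⟨c, h1, h2⟩ := exists_between hab
      exact ⟨c, h1, h2, by simp [hq]⟩
    · refine hR.rolle q hq hab (by simp [q]) ?_
      simp only [q, eval_sub, eval_C, eval_mul, eval_X]
      linarith
  obtain ⟨c, h1, h2, h3⟩ := key
  have : p.derivative.eval c = s := by
    rw [hder] at h3; simpa [sub_eq_zero] using h3
  rw [hs', sign_mul, sign_pos hba, mul_one, ← this, h c h1 h2]

/-- The sign of a polynomial is eventually that of its leading coefficient. -/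
theorem exists_sign_eval_eq_leadingCoeff (p : R[X]) :
    ∃ M : R, 0 < M ∧ ∀ x, M ≤ x → SignType.sign (p.eval x) = SignType.sign p.leadingCoeff := by
  by_cases hp : p = 0
  · exact ⟨1, one_pos, by simp [hp]⟩
  set n := p.natDegree
  set B : R := ∑ i ∈ Finset.range n, |p.coeff i|
  have hB : 0 ≤ B := Finset.sum_nonneg fun _ _ => abs_nonneg _
  have hl : 0 < |p.leadingCoeff| := abs_pos.2 (leadingCoeff_ne_zero.2 hp)
  refine ⟨B / |p.leadingCoeff| + 1, by positivity, fun x hx => ?_⟩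
  have hx1 : 1 ≤ x := by
    have : 0 ≤ B / |p.leadingCoeff| := by positivity
    linarith
  have hx0 : 0 < x := by linarith
  have hBx : B < |p.leadingCoeff| * x := by
    have : B / |p.leadingCoeff| < x := by linarith
    rw [div_lt_iff₀ hl] at this
    linarith
  have hlow : |∑ i ∈ Finset.range n, p.coeff i * x ^ i| * x ≤ B * x ^ n := by
    have h1 : |∑ i ∈ Finset.range n, p.coeff i * x ^ i| ≤
        ∑ i ∈ Finset.range n, |p.coeff i| * x ^ i := by
      refine (Finset.abs_sum_le_sum_abs _ _).trans (le_of_eq ?_)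
      refine Finset.sum_congr rfl fun i _ => ?_
      rw [abs_mul, abs_of_pos (pow_pos hx0 i)]
    calc _ ≤ (∑ i ∈ Finset.range n, |p.coeff i| * x ^ i) * x := by gcongr
      _ = ∑ i ∈ Finset.range n, |p.coeff i| * x ^ (i + 1) := by
        rw [Finset.sum_mul]; exact Finset.sum_congr rfl fun i _ => by ring
      _ ≤ ∑ i ∈ Finset.range n, |p.coeff i| * x ^ n := by
        refine Finset.sum_le_sum fun i hi => ?_
        have := Finset.mem_range.1 hi
        gcongr
        omega
      _ = _ := by rw [← Finset.sum_mul]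
  have hev : p.eval x = ∑ i ∈ Finset.range n, p.coeff i * x ^ i + p.leadingCoeff * x ^ n := by
    rw [eval_eq_sum_range, Finset.sum_range_succ]; rfl
  have hlt : |∑ i ∈ Finset.range n, p.coeff i * x ^ i| < |p.leadingCoeff| * x ^ n := by
    have hxn : 0 < x ^ n := pow_pos hx0 n
    by_contra hcon
    push Not at hcon
    nlinarith
  rw [hev]
  rcases lt_or_gt_of_ne (leadingCoeff_ne_zero.2 hp) with h | h
  · rw [sign_neg h, sign_neg]
    rw [abs_of_neg h] at hlt
    have := (abs_lt.1 hlt).2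
    linarith
  · rw [sign_pos h, sign_pos]
    rw [abs_of_pos h] at hlt
    have := (abs_lt.1 hlt).1
    linarith

/-- The sign of a polynomial near `-∞`. -/
theorem exists_sign_eval_neg_eq (p : R[X]) :
    ∃ M : R, 0 < M ∧ ∀ x, x ≤ -M →
      SignType.sign (p.eval x) = (-1) ^ p.natDegree * SignType.sign p.leadingCoeff := by
  obtain ⟨M, hM, h⟩ := exists_sign_eval_eq_leadingCoeff (p.comp (-X))
  refine ⟨M, hM, fun x hx => ?_⟩
  have := h (-x) (by linarith)
  rw [eval_comp] at this
  simp only [eval_neg, eval_X, neg_neg] at this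
  rw [this, comp_neg_X_leadingCoeff_eq, sign_mul, sign_pow, Left.sign_neg, sign_one]

end PolynomialIVT
section Aligned

variable {R R' : Type} [LinearOrder R] [LinearOrder R']

/-- `x` and `x'` sit at the same place relative to the matched points `z ↦ e z`. -/
def Aligned (Z : Finset R) (e : R → R') (x : R) (x' : R') : Prop :=
  ∀ z ∈ Z, (z < x ↔ e z < x') ∧ (x < z ↔ x' < e z)

theorem Aligned.eq {Z : Finset R} {e : R → R'} {x : R} {x' : R'} (h : Aligned Z e x x')
    (hx : x ∈ Z) : x' = e x :=
  le_antisymm (not_lt.1 fun h1 => lt_irrefl _ ((h x hx).1.2 h1))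
    (not_lt.1 fun h1 => lt_irrefl _ ((h x hx).2.2 h1))

theorem aligned_self {Z : Finset R} {e : R → R'} (he : StrictMonoOn e Z) {x : R} (hx : x ∈ Z) :
    Aligned Z e x (e x) :=
  fun _ hz => ⟨(he.lt_iff_lt hz hx).symm, (he.lt_iff_lt hx hz).symm⟩

end Aligned

section Cells

variable {R R' : Type} [Field R] [LinearOrder R] [IsStrictOrderedRing R]
  [Field R'] [LinearOrder R'] [IsStrictOrderedRing R']

theorem sign_deriv_ne_zero {p : R[X]} (hp : p ≠ 0) {a b w : R} (hab : a < b)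
    (hw : p.eval w = 0) {σ : SignType}
    (h : ∀ x, a < x → x < b → SignType.sign (p.derivative.eval x) = σ) : σ ≠ 0 := by
  rintro rfl
  have h0 : p.derivative = 0 := by
    refine eq_zero_of_infinite_isRoot _ ((Set.Ioo_infinite hab).mono fun x hx => ?_)
    exact sign_eq_zero_iff.1 (h x hx.1 hx.2)
  have h1 := eq_C_of_derivative_eq_zero h0
  rw [h1, eval_C] at hw
  exact hp (by rw [h1, hw, C_0])

theorem PolyIVT.root_unique (hR : PolyIVT R) {p : R[X]} (hp : p ≠ 0) {a b w v : R} {σ : SignType}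
    (h : ∀ x, a < x → x < b → SignType.sign (p.derivative.eval x) = σ)
    (hw : p.eval w = 0) (hv : p.eval v = 0) (haw : a < w) (hwb : w < b) (hav : a < v)
    (hvb : v < b) : w = v := by
  have key : ∀ w v, p.eval w = 0 → p.eval v = 0 → a < w → v < b → ¬ w < v := by
    intro w v hw hv haw hvb hwv
    have h' : ∀ x, w < x → x < v → SignType.sign (p.derivative.eval x) = σ :=
      fun x h1 h2 => h x (haw.trans h1) (h2.trans hvb)
    have := hR.sign_sub p hwv h'
    rw [hw, hv, sub_zero, sign_zero] at this
    exact sign_deriv_ne_zero hp hwv hw h' this.symm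
  exact le_antisymm (not_lt.1 (key v w hv hw hav hwb)) (not_lt.1 (key w v hw hv haw hvb))

theorem PolyIVT.exists_root_transfer (hR : PolyIVT R) (hR' : PolyIVT R') {p : R[X]} {p' : R'[X]}
    (hp : p ≠ 0) {a b w : R} {a' b' : R'} {σ : SignType}
    (h : ∀ x, a < x → x < b → SignType.sign (p.derivative.eval x) = σ)
    (hw : p.eval w = 0) (haw : a < w) (hwb : w < b) (hab' : a' < b')
    (ha : SignType.sign (p.eval a) = SignType.sign (p'.eval a'))
    (hb : SignType.sign (p.eval b) = SignType.sign (p'.eval b')) :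
    ∃ w', a' < w' ∧ w' < b' ∧ p'.eval w' = 0 := by
  have hσ := sign_deriv_ne_zero hp (haw.trans hwb) hw h
  have h1 := hR.sign_sub p haw fun x h1 h2 => h x h1 (h2.trans hwb)
  have h2 := hR.sign_sub p hwb fun x h1 h2 => h x (haw.trans h1) h2
  rw [hw, zero_sub, Left.sign_neg, ha] at h1
  rw [hw, sub_zero, hb] at h2
  refine hR'.exists_root p' hab' ?_
  rw [← sign_eq_neg_one_iff, sign_mul, h2, ← h1]
  rw [← h1] at hσ
  revert hσ
  generalize SignType.sign (p'.eval a') = s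
  revert s; decide

theorem PolyIVT.sign_eq_of_no_root (hR : PolyIVT R) (hR' : PolyIVT R') {p : R[X]} {p' : R'[X]}
    {a x : R} {a' x' : R'} {σ : SignType}
    (h : ∀ y, a < y → y < x → SignType.sign (p.derivative.eval y) = σ)
    (h' : ∀ y, a' < y → y < x' → SignType.sign (p'.derivative.eval y) = σ)
    (hax : a < x) (hax' : a' < x')
    (ha : SignType.sign (p.eval a) = SignType.sign (p'.eval a'))
    (hr : ∀ w, a < w → w ≤ x → p.eval w ≠ 0) (hr' : ∀ w, a' < w → w ≤ x' → p'.eval w ≠ 0) :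
    SignType.sign (p.eval x) = SignType.sign (p'.eval x') := by
  by_cases h0 : p.eval a = 0
  · have h0' : p'.eval a' = 0 := by rwa [h0, sign_zero, eq_comm, sign_eq_zero_iff] at ha
    have h1 := hR.sign_sub p hax h
    have h1' := hR'.sign_sub p' hax' h'
    rw [h0, sub_zero] at h1
    rw [h0', sub_zero] at h1'
    rw [h1, h1']
  · have h0' : p'.eval a' ≠ 0 := by
      rwa [← sign_ne_zero, ← ha, sign_ne_zero]
    have key : ∀ {F : Type} [Field F] [LinearOrder F] [IsStrictOrderedRing F] (_ : PolyIVT F)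
        {p : F[X]} {a x : F} (_ : a < x) (_ : ∀ w, a < w → w ≤ x → p.eval w ≠ 0)
        (_ : p.eval a ≠ 0), SignType.sign (p.eval x) = SignType.sign (p.eval a) := by
      intro F _ _ _ hF p a x hax hr h0
      have hx := hr x hax le_rfl
      by_contra hne
      have : p.eval a * p.eval x < 0 := by
        rw [← sign_eq_neg_one_iff, sign_mul]
        rw [← sign_ne_zero] at hx h0
        revert hne hx h0
        generalize SignType.sign (p.eval a) = s
        generalize SignType.sign (p.eval x) = t
        revert s t; decide
      obtain ⟨c, h1, h2, h3⟩ := hF.exists_root p hax this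
      exact hr c h1 h2.le h3
    rw [key hR hax hr h0, key hR' hax' hr' h0', ha]

/-- A matching of finitely many points of `[-M, M]` with points of `[-M', M']`. -/
structure Matching (M : R) (M' : R') (Z : Finset R) (e : R → R') : Prop where
  mono : StrictMonoOn e Z
  left_mem : -M ∈ Z
  right_mem : M ∈ Z
  map_left : e (-M) = -M'
  map_right : e M = M'
  bounded : ∀ z ∈ Z, -M ≤ z ∧ z ≤ M

variable {M : R} {M' : R'} {Z : Finset R} {e : R → R'}

theorem Matching.exists_cell (h : Matching M M' Z e) {x : R} (h1 : -M ≤ x) (h2 : x ≤ M)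
    (hx : x ∉ Z) :
    ∃ a ∈ Z, ∃ b ∈ Z, a < x ∧ x < b ∧
      ∀ y y', a < y → y < b → e a < y' → y' < e b → Aligned Z e y y' := by
  have hA : (Z.filter (· < x)).Nonempty :=
    ⟨-M, by simp [h.left_mem, lt_of_le_of_ne h1 fun h' => hx (h' ▸ h.left_mem)]⟩
  have hB : (Z.filter (x < ·)).Nonempty :=
    ⟨M, by simp [h.right_mem, lt_of_le_of_ne h2 fun h' => hx (h' ▸ h.right_mem)]⟩
  obtain ⟨a, ha, hamax⟩ := (Z.filter (· < x)).exists_max_image id hA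
  obtain ⟨b, hb, hbmin⟩ := (Z.filter (x < ·)).exists_min_image id hB
  simp only [Finset.mem_filter, id] at ha hb hamax hbmin
  refine ⟨a, ha.1, b, hb.1, ha.2, hb.2, fun y y' hay hyb hay' hyb' z hz => ?_⟩
  rcases lt_trichotomy z x with hzx | hzx | hzx
  · have hza := hamax z ⟨hz, hzx⟩
    have hza' := (h.mono.le_iff_le hz ha.1).2 hza
    have i1 : z < y := hza.trans_lt hay
    have i2 : e z < y' := hza'.trans_lt hay'
    exact ⟨iff_of_true i1 i2, iff_of_false i1.not_gt i2.not_gt⟩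
  · exact absurd (hzx ▸ hz) hx
  · have hza := hbmin z ⟨hz, hzx⟩
    have hza' := (h.mono.le_iff_le hb.1 hz).2 hza
    have i1 : y < z := hyb.trans_le hza
    have i2 : y' < e z := hyb'.trans_le hza'
    exact ⟨iff_of_false i1.not_gt i2.not_gt, iff_of_true i1 i2⟩

theorem Matching.exists_aligned (h : Matching M M' Z e) {x : R} (h1 : -M ≤ x) (h2 : x ≤ M) :
    ∃ x', -M' ≤ x' ∧ x' ≤ M' ∧ Aligned Z e x x' := by
  have hle : ∀ z ∈ Z, -M' ≤ e z ∧ e z ≤ M' := fun z hz => by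
    rw [← h.map_left, ← h.map_right, h.mono.le_iff_le h.left_mem hz,
      h.mono.le_iff_le hz h.right_mem]
    exact h.bounded z hz
  by_cases hx : x ∈ Z
  · exact ⟨e x, (hle x hx).1, (hle x hx).2, aligned_self h.mono hx⟩
  · obtain ⟨a, ha, b, hb, hax, hxb, hal⟩ := h.exists_cell h1 h2 hx
    obtain ⟨x', i1, i2⟩ := exists_between (h.mono ha hb (hax.trans hxb))
    exact ⟨x', (hle a ha).1.trans i1.le, i2.le.trans (hle b hb).2, hal x x' hax hxb i1 i2⟩

theorem Matching.extend (hR : PolyIVT R) (hR' : PolyIVT R') (h : Matching M M' Z e)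
    (p : R[X]) (p' : R'[X]) (hp : p ≠ 0) (hp' : p' ≠ 0)
    (hd : ∀ x x', -M ≤ x → x ≤ M → Aligned Z e x x' →
      SignType.sign (p.derivative.eval x) = SignType.sign (p'.derivative.eval x'))
    (hz : ∀ z ∈ Z, SignType.sign (p.eval z) = SignType.sign (p'.eval (e z))) :
    ∃ (Z₁ : Finset R) (e₁ : R → R'), Matching M M' Z₁ e₁ ∧ Z ⊆ Z₁ ∧ (∀ z ∈ Z, e₁ z = e z) ∧
      (∀ z ∈ Z₁, z ∈ Z ∨ p.eval z = 0) ∧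
      ∀ x x', -M ≤ x → x ≤ M → Aligned Z₁ e₁ x x' →
        SignType.sign (p.eval x) = SignType.sign (p'.eval x') := by
  classical
  have cell : ∀ x, -M ≤ x → x ≤ M → x ∉ Z → ∃ a ∈ Z, ∃ b ∈ Z, a < x ∧ x < b ∧
      (∀ y y', a < y → y < b → e a < y' → y' < e b → Aligned Z e y y') ∧ ∃ σ : SignType,
      (∀ y, a < y → y < b → SignType.sign (p.derivative.eval y) = σ) ∧
      (∀ y', e a < y' → y' < e b → SignType.sign (p'.derivative.eval y') = σ) := by
    intro x h1 h2 hx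
    obtain ⟨a, ha, b, hb, hax, hxb, hal⟩ := h.exists_cell h1 h2 hx
    obtain ⟨x', i1, i2⟩ := exists_between (h.mono ha hb (hax.trans hxb))
    have j1 := (h.bounded a ha).1
    have j2 := (h.bounded b hb).2
    refine ⟨a, ha, b, hb, hax, hxb, hal, SignType.sign (p'.derivative.eval x'),
      fun y k1 k2 => hd y x' (j1.trans k1.le) (k2.le.trans j2) (hal y x' k1 k2 i1 i2),
      fun y' k1 k2 => ?_⟩
    rw [← hd x y' h1 h2 (hal x y' hax hxb k1 k2), hd x x' h1 h2 (hal x x' hax hxb i1 i2)]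
  have hroot : ∀ w, ∃ w', -M ≤ w → w ≤ M → w ∉ Z → p.eval w = 0 →
      Aligned Z e w w' ∧ p'.eval w' = 0 := by
    intro w
    by_cases hw : -M ≤ w ∧ w ≤ M ∧ w ∉ Z ∧ p.eval w = 0
    · obtain ⟨h1, h2, h3, h4⟩ := hw
      obtain ⟨a, ha, b, hb, haw, hwb, hal, σ, hσ, hσ'⟩ := cell w h1 h2 h3
      obtain ⟨w', i1, i2, i3⟩ := hR.exists_root_transfer hR' hp hσ h4 haw hwb
        (h.mono ha hb (haw.trans hwb)) (hz a ha) (hz b hb)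
      exact ⟨w', fun _ _ _ _ => ⟨hal w w' haw hwb i1 i2, i3⟩⟩
    · exact ⟨0, fun h1 h2 h3 h4 => absurd ⟨h1, h2, h3, h4⟩ hw⟩
  choose g hg using hroot
  let W := p.roots.toFinset.filter fun w => -M ≤ w ∧ w ≤ M
  have hW : ∀ w, w ∈ W ↔ p.eval w = 0 ∧ -M ≤ w ∧ w ≤ M := fun w => by simp [W, hp]
  let e₁ : R → R' := fun x => if x ∈ Z then e x else g x
  have he₁ : ∀ z ∈ Z, e₁ z = e z := fun z hz => if_pos hz
  have hnew : ∀ w, w ∈ W → w ∉ Z → Aligned Z e w (e₁ w) ∧ p'.eval (e₁ w) = 0 := by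
    intro w hw hwZ
    rw [hW] at hw
    simp only [e₁, if_neg hwZ]
    exact hg w hw.2.1 hw.2.2 hwZ hw.1
  have hmono : StrictMonoOn e₁ (Z ∪ W : Finset R) := by
    intro x hx y hy hxy
    simp only [Finset.coe_union, Set.mem_union, Finset.mem_coe] at hx hy
    by_cases hxZ : x ∈ Z
    · by_cases hyZ : y ∈ Z
      · rw [he₁ x hxZ, he₁ y hyZ]; exact h.mono hxZ hyZ hxy
      · rw [he₁ x hxZ]
        exact ((hnew y (hy.resolve_left hyZ) hyZ).1 x hxZ).1.1 hxy
    · have hxn := hnew x (hx.resolve_left hxZ) hxZ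
      by_cases hyZ : y ∈ Z
      · rw [he₁ y hyZ]
        exact (hxn.1 y hyZ).2.1 hxy
      · have hyn := hnew y (hy.resolve_left hyZ) hyZ
        have hxW := (hW x).1 (hx.resolve_left hxZ)
        have hyW := (hW y).1 (hy.resolve_left hyZ)
        obtain ⟨a, ha, b, hb, hax, hxb, hal, σ, hσ, hσ'⟩ := cell x hxW.2.1 hxW.2.2 hxZ
        by_cases hyb : y < b
        · exact absurd (hR.root_unique hp hσ hxW.1 hyW.1 hax hxb (hax.trans hxy) hyb) hxy.ne
        · have hby : b < y := lt_of_le_of_ne (not_lt.1 hyb) fun h' => hyZ (h' ▸ hb)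
          exact ((hxn.1 b hb).2.1 hxb).trans ((hyn.1 b hb).1.1 hby)
  have hmatch : Matching M M' (Z ∪ W) e₁ :=
    { mono := hmono
      left_mem := Finset.mem_union_left _ h.left_mem
      right_mem := Finset.mem_union_left _ h.right_mem
      map_left := by rw [he₁ _ h.left_mem, h.map_left]
      map_right := by rw [he₁ _ h.right_mem, h.map_right]
      bounded := fun z hz => by
        rcases Finset.mem_union.1 hz with hz | hz
        · exact h.bounded z hz
        · exact ((hW z).1 hz).2 }
  refine ⟨Z ∪ W, e₁, hmatch, Finset.subset_union_left, he₁, fun z hz => ?_,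
    fun x x' h1 h2 hal₁ => ?_⟩
  · rcases Finset.mem_union.1 hz with hz | hz
    · exact Or.inl hz
    · exact Or.inr ((hW z).1 hz).1
  have hal₀ : Aligned Z e x x' := fun z hz => by
    have := hal₁ z (Finset.mem_union_left _ hz)
    rwa [he₁ z hz] at this
  by_cases hxZ : x ∈ Z
  · rw [hal₀.eq hxZ]; exact hz x hxZ
  by_cases hxW : x ∈ W
  · rw [hal₁.eq (Finset.mem_union_right _ hxW), (hnew x hxW hxZ).2, ((hW x).1 hxW).1,
      sign_zero, sign_zero]
  obtain ⟨a, ha, b, hb, hax, hxb, hal, σ, hσ, hσ'⟩ := cell x h1 h2 hxZ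
  have hax' : e a < x' := (hal₀ a ha).1.1 hax
  have hxb' : x' < e b := (hal₀ b hb).2.1 hxb
  have hbd : ∀ w, a < w → w < b → p.eval w = 0 → w ∈ W := fun w i1 i2 i3 =>
    (hW w).2 ⟨i3, (h.bounded a ha).1.trans i1.le, i2.le.trans (h.bounded b hb).2⟩
  have hnZ : ∀ w, a < w → w < b → w ∉ Z := fun w i1 i2 hw => by
    have hh := hal w x' i1 i2 hax' hxb'
    have hh2 := hal₀ w hw
    have hh3 := hal x x' hax hxb hax' hxb'
    have e1 := hh.eq hw
    rcases lt_trichotomy w x with h' | h' | h'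
    · exact absurd ((hh2.1.1 h').trans_eq e1) (lt_irrefl _)
    · exact hxZ (h' ▸ hw)
    · exact absurd (e1.symm.trans_lt (hh2.2.1 h')) (lt_irrefl _)
  by_cases hex : ∃ w, a < w ∧ w < b ∧ p.eval w = 0
  · obtain ⟨w, i1, i2, i3⟩ := hex
    have hwW := hbd w i1 i2 i3
    have hwZ := hnZ w i1 i2
    obtain ⟨j1, j2⟩ := hnew w hwW hwZ
    have k1 : e a < e₁ w := (j1 a ha).1.1 i1
    have k2 : e₁ w < e b := (j1 b hb).2.1 i2
    have hc := hal₁ w (Finset.mem_union_right _ hwW)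
    rcases lt_trichotomy w x with h' | h' | h'
    · have s1 := hR.sign_sub p h' fun y l1 l2 => hσ y (i1.trans l1) (l2.trans hxb)
      have s2 := hR'.sign_sub p' (hc.1.1 h') fun y l1 l2 => hσ' y (k1.trans l1) (l2.trans hxb')
      rw [i3, sub_zero] at s1
      rw [j2, sub_zero] at s2
      rw [s1, s2]
    · exact absurd (h' ▸ hwW) hxW
    · have s1 := hR.sign_sub p h' fun y l1 l2 => hσ y (hax.trans l1) (l2.trans i2)
      have s2 := hR'.sign_sub p' (hc.2.1 h') fun y l1 l2 => hσ' y (hax'.trans l1) (l2.trans k2)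
      rw [i3, zero_sub, Left.sign_neg] at s1
      rw [j2, zero_sub, Left.sign_neg] at s2
      exact neg_injective (s1.trans s2.symm)
  · push Not at hex
    refine hR.sign_eq_of_no_root hR' (fun y l1 l2 => hσ y l1 (l2.trans hxb))
      (fun y l1 l2 => hσ' y l1 (l2.trans hxb')) hax hax' (hz a ha)
      (fun w l1 l2 => hex w l1 (l2.trans_lt hxb)) (fun w l1 l2 l3 => ?_)
    obtain ⟨v, m1, m2, m3⟩ := hR'.exists_root_transfer hR hp' hσ' l3 l1 (l2.trans_lt hxb')
      (hax.trans hxb) (hz a ha).symm (hz b hb).symm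
    exact hex v m1 m2 m3

end Cells
/-- A finite set is contained in a finite set closed under operations that strictly lower the rank
(up to producing the bottom element `z`). -/
theorem exists_closed_finset {α : Type*} [DecidableEq α] (μ : α → ℕ) (ops : α → α → Finset α)
    (z : α) (h : ∀ p q, ∀ r ∈ ops p q, r = z ∨ (μ r < μ p ∧ μ r < μ q)) (s : Finset α) :
    ∃ t, s ⊆ t ∧ z ∈ t ∧ ∀ p ∈ t, ∀ q ∈ t, ops p q ⊆ t := by
  have key : ∀ (n : ℕ) (t : Finset α), z ∈ t →
      (∀ p ∈ t, ∀ q ∈ t, ∀ r ∈ ops p q, r ∉ t → μ r < n) →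
      ∃ t', t ⊆ t' ∧ ∀ p ∈ t', ∀ q ∈ t', ops p q ⊆ t' := by
    intro n
    induction n with
    | zero =>
      intro t _ ht
      exact ⟨t, subset_rfl, fun p hp q hq r hr => by
        by_contra hrt
        exact absurd (ht p hp q hq r hr hrt) (Nat.not_lt_zero _)⟩
    | succ n ih =>
      intro t hz ht
      let u := t ∪ t.biUnion fun p => t.biUnion fun q => ops p q
      have hu : ∀ p ∈ t, ∀ q ∈ t, ops p q ⊆ u := fun p hp q hq r hr => by
        simp only [u, Finset.mem_union, Finset.mem_biUnion]
        exact Or.inr ⟨p, hp, q, hq, hr⟩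
      have hlow : ∀ p ∈ u, p ∉ t → μ p ≤ n := fun p hp hpt => by
        simp only [u, Finset.mem_union, Finset.mem_biUnion] at hp
        obtain ⟨a, ha, b, hb, hr⟩ := hp.resolve_left hpt
        exact Nat.lt_succ_iff.1 (ht a ha b hb p hr hpt)
      obtain ⟨t', h1, h2⟩ := ih u (Finset.mem_union_left _ hz) (fun p hp q hq r hr hru => by
        have hzu : r ≠ z := fun h' => hru (h' ▸ Finset.mem_union_left _ hz)
        have hr' := (h p q r hr).resolve_left hzu
        by_cases hpt : p ∈ t
        · by_cases hqt : q ∈ t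
          · exact absurd (hu p hpt q hqt hr) hru
          · exact hr'.2.trans_le (hlow q hq hqt)
        · exact hr'.1.trans_le (hlow p hp hpt))
      exact ⟨t', Finset.subset_union_left.trans h1, h2⟩
  have hb : ∀ p ∈ insert z s, ∀ q ∈ insert z s, ∀ r ∈ ops p q, r ∉ insert z s →
      μ r < (insert z s).sup μ + 1 := fun p hp q hq r hr hrt => by
    have hr' := (h p q r hr).resolve_left fun h' => hrt (h' ▸ Finset.mem_insert_self _ _)
    exact (hr'.1.trans_le (Finset.le_sup hp)).trans (Nat.lt_succ_self _)
  obtain ⟨t, h1, h2⟩ := key _ _ (Finset.mem_insert_self _ _) hb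
  exact ⟨t, (Finset.subset_insert _ _).trans h1, h1 (Finset.mem_insert_self _ _), h2⟩

section PseudoRem

variable {A : Type} [CommRing A]

theorem exists_pseudoRem (P Q : A[X]) (hQ : 0 < Q.natDegree) :
    ∃ (e : ℕ) (S r : A[X]), C Q.leadingCoeff ^ e * P = S * Q + r ∧ r.natDegree < Q.natDegree := by
  induction hn : P.natDegree using Nat.strong_induction_on generalizing P with
  | _ n ih =>
    by_cases hlt : P.natDegree < Q.natDegree
    · exact ⟨0, 0, P, by simp, hlt⟩
    push Not at hlt
    let P' := C Q.leadingCoeff * P - C P.leadingCoeff * X ^ (P.natDegree - Q.natDegree) * Q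
    have hdeg : P'.natDegree < n := by
      subst hn
      have h1 : P'.natDegree ≤ P.natDegree := by
        refine (natDegree_sub_le _ _).trans (max_le (natDegree_C_mul_le _ _) ?_)
        refine natDegree_mul_le.trans ?_
        have := natDegree_C_mul_X_pow_le P.leadingCoeff (P.natDegree - Q.natDegree)
        omega
      refine lt_of_le_of_ne h1 fun h2 => ?_
      have h3 : P'.coeff P.natDegree = 0 := by
        simp only [P', coeff_sub, coeff_C_mul]
        have : (C P.leadingCoeff * X ^ (P.natDegree - Q.natDegree) * Q).coeff P.natDegree =
            P.leadingCoeff * Q.leadingCoeff := by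
          conv_lhs => rw [mul_assoc, coeff_C_mul, mul_comm (X ^ _)]
          have : P.natDegree = Q.natDegree + (P.natDegree - Q.natDegree) := by omega
          conv_lhs => rw [this]
          simp [coeff_mul_X_pow]
        rw [this, coeff_natDegree]; ring
      rw [← h2, coeff_natDegree, leadingCoeff_eq_zero] at h3
      rw [h3, natDegree_zero] at h2
      omega
    obtain ⟨e, S, r, h1, h2⟩ := ih _ hdeg P' rfl
    refine ⟨e + 1, S + C Q.leadingCoeff ^ e * C P.leadingCoeff *
      X ^ (P.natDegree - Q.natDegree), r, ?_, h2⟩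
    have : C Q.leadingCoeff * P = P' + C P.leadingCoeff * X ^ (P.natDegree - Q.natDegree) * Q := by
      simp [P']
    rw [pow_succ, mul_assoc, this, mul_add, h1]; ring

open Classical in
/-- A pseudo-remainder of `P` by `Q`, zero when `Q` is constant. -/
noncomputable def pseudoRem (P Q : A[X]) : A[X] :=
  if h : 0 < Q.natDegree then (exists_pseudoRem P Q h).choose_spec.choose_spec.choose else 0

theorem pseudoRem_spec (P Q : A[X]) (hQ : 0 < Q.natDegree) :
    (∃ (e : ℕ) (S : A[X]), C Q.leadingCoeff ^ e * P = S * Q + pseudoRem P Q) ∧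
      (pseudoRem P Q).natDegree < Q.natDegree := by
  rw [pseudoRem, dif_pos hQ]
  have h := (exists_pseudoRem P Q hQ).choose_spec.choose_spec.choose_spec
  exact ⟨⟨_, _, h.1⟩, h.2⟩

/-- The families of polynomials for which sign diagrams can be computed recursively. -/
structure HClosed (𝒞 : Finset A[X]) : Prop where
  eraseLead_mem : ∀ P ∈ 𝒞, P.eraseLead ∈ 𝒞
  derivative_mem : ∀ P ∈ 𝒞, derivative P ∈ 𝒞
  pseudoRem_mem : ∀ P ∈ 𝒞, ∀ Q ∈ 𝒞, P ≠ Q → Q.natDegree ≤ P.natDegree → pseudoRem P Q ∈ 𝒞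

theorem exists_hClosed (𝒮 : Finset A[X]) : ∃ 𝒞, 𝒮 ⊆ 𝒞 ∧ HClosed 𝒞 := by
  classical
  let μ : A[X] → ℕ := fun P => if P = 0 then 0 else P.natDegree + 1
  let ops : A[X] → A[X] → Finset A[X] := fun P Q =>
    if P = Q then {P.eraseLead, derivative P}
    else if Q.natDegree ≤ P.natDegree then {pseudoRem P Q} else ∅
  have hμ : ∀ P Q : A[X], P ≠ 0 → P.natDegree < Q.natDegree → μ P < μ Q := fun P Q h1 h2 => by
    have : Q ≠ 0 := by rintro rfl; simp at h2
    simp [μ, h1, this, h2]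
  obtain ⟨𝒞, h1, -, h3⟩ := exists_closed_finset μ ops 0 (by
    intro P Q r hr
    by_cases hr0 : r = 0
    · exact Or.inl hr0
    right
    simp only [ops] at hr
    split_ifs at hr with h1 h2
    · subst h1
      rw [and_self]
      simp only [Finset.mem_insert, Finset.mem_singleton] at hr
      rcases hr with rfl | rfl
      · have hP : P ≠ 0 := by rintro rfl; simp at hr0
        have := eraseLead_natDegree_lt_or_eraseLead_eq_zero P
        have hl := this.resolve_right hr0
        exact hμ _ _ hr0 hl
      · refine hμ _ _ hr0 (natDegree_derivative_lt fun h => hr0 ?_)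
        rw [eq_C_of_natDegree_eq_zero h, derivative_C]
    · rw [Finset.mem_singleton] at hr
      by_cases hQ : 0 < Q.natDegree
      · have := (pseudoRem_spec P Q hQ).2
        rw [← hr] at this
        exact ⟨hμ _ _ hr0 (this.trans_le h2), hμ _ _ hr0 this⟩
      · exact absurd (by rw [hr, pseudoRem, dif_neg hQ]) hr0
    · simp at hr) 𝒮
  refine ⟨𝒞, h1, ⟨fun P hP => ?_, fun P hP => ?_, fun P hP Q hQ hPQ hle => ?_⟩⟩
  · exact h3 P hP P hP (by simp [ops])
  · exact h3 P hP P hP (by simp [ops])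
  · exact h3 P hP Q hQ (by simp [ops, hPQ, hle])

variable {R R' : Type} [Field R] [LinearOrder R] [IsStrictOrderedRing R]
  [Field R'] [LinearOrder R'] [IsStrictOrderedRing R']

theorem HClosed.reduce {𝒞 : Finset A[X]} (h𝒞 : HClosed 𝒞) (φ : A →+* R) (φ' : A →+* R')
    (hφ : ∀ P ∈ 𝒞, SignType.sign (φ P.leadingCoeff) = SignType.sign (φ' P.leadingCoeff))
    (P : A[X]) (hP : P ∈ 𝒞) :
    (P.map φ = 0 ∧ P.map φ' = 0) ∨ ∃ Q ∈ 𝒞, φ Q.leadingCoeff ≠ 0 ∧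
      Q.natDegree ≤ P.natDegree ∧ P.map φ = Q.map φ ∧ P.map φ' = Q.map φ' := by
  induction hn : P.natDegree using Nat.strong_induction_on generalizing P with
  | _ n ih =>
    subst hn
    by_cases h0 : φ P.leadingCoeff = 0
    · have h0' : φ' P.leadingCoeff = 0 := by
        have := hφ P hP
        rwa [h0, sign_zero, eq_comm, sign_eq_zero_iff] at this
      have e1 : P.map φ = P.eraseLead.map φ := by
        conv_lhs => rw [← eraseLead_add_C_mul_X_pow P, Polynomial.map_add, Polynomial.map_mul, map_C, h0]
        simp
      have e2 : P.map φ' = P.eraseLead.map φ' := by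
        conv_lhs => rw [← eraseLead_add_C_mul_X_pow P, Polynomial.map_add, Polynomial.map_mul, map_C, h0']
        simp
      rcases eraseLead_natDegree_lt_or_eraseLead_eq_zero P with hl | hl
      · rcases ih _ hl P.eraseLead (h𝒞.eraseLead_mem P hP) rfl with ⟨a, b⟩ | ⟨Q, a, b, c, d, e⟩
        · exact Or.inl ⟨e1.trans a, e2.trans b⟩
        · exact Or.inr ⟨Q, a, b, c.trans hl.le, e1.trans d, e2.trans e⟩
      · left; rw [e1, e2, hl]; simp
    · exact Or.inr ⟨P, hP, h0, le_rfl, rfl, rfl⟩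

theorem exists_uniform_bound (𝒞 : Finset A[X]) (φ : A →+* R) :
    ∃ M : R, 0 < M ∧ ∀ P ∈ 𝒞,
      (∀ x, M ≤ x → SignType.sign ((P.map φ).eval x) = SignType.sign (P.map φ).leadingCoeff) ∧
      (∀ x, x ≤ -M → SignType.sign ((P.map φ).eval x) =
        (-1) ^ (P.map φ).natDegree * SignType.sign (P.map φ).leadingCoeff) := by
  choose f hf hf' using fun P : A[X] => exists_sign_eval_eq_leadingCoeff (P.map φ)
  choose g hg hg' using fun P : A[X] => exists_sign_eval_neg_eq (P.map φ)
  have hle : ∀ P ∈ 𝒞, f P + g P ≤ 1 + ∑ P ∈ 𝒞, (f P + g P) := fun P hP => by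
    have := Finset.single_le_sum (f := fun P => f P + g P)
      (fun P _ => (add_pos (hf P) (hg P)).le) hP
    linarith
  refine ⟨1 + ∑ P ∈ 𝒞, (f P + g P), ?_, fun P hP => ⟨fun x hx => hf' P x ?_, fun x hx => hg' P x ?_⟩⟩
  · have : 0 ≤ ∑ P ∈ 𝒞, (f P + g P) :=
      Finset.sum_nonneg fun P _ => (add_pos (hf P) (hg P)).le
    linarith
  · have := hle P hP; have := hg P; linarith
  · have := hle P hP; have := hf P; linarith

theorem HClosed.transfer {𝒞 : Finset A[X]} (h𝒞 : HClosed 𝒞) (hR : PolyIVT R) (hR' : PolyIVT R')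
    (φ : A →+* R) (φ' : A →+* R')
    (hφ : ∀ P ∈ 𝒞, SignType.sign (φ P.leadingCoeff) = SignType.sign (φ' P.leadingCoeff)) (y : R) :
    ∃ y' : R', ∀ P ∈ 𝒞,
      SignType.sign ((P.map φ).eval y) = SignType.sign ((P.map φ').eval y') := by
  classical
  obtain ⟨M, hM, hMs⟩ := exists_uniform_bound 𝒞 φ
  obtain ⟨M', hM', hMs'⟩ := exists_uniform_bound 𝒞 φ'
  let 𝒟 := 𝒞.filter fun P => φ P.leadingCoeff ≠ 0
  have h𝒟 : ∀ P ∈ 𝒟, P ∈ 𝒞 ∧ φ P.leadingCoeff ≠ 0 ∧ φ' P.leadingCoeff ≠ 0 := fun P hP => by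
    have hP' := Finset.mem_filter.1 hP
    refine ⟨hP'.1, hP'.2, ?_⟩
    rw [← sign_ne_zero, ← hφ P hP'.1, sign_ne_zero]
    exact hP'.2
  have hinf : ∀ P ∈ 𝒟, (∀ x x', M ≤ x → M' ≤ x' →
        SignType.sign ((P.map φ).eval x) = SignType.sign ((P.map φ').eval x')) ∧
      (∀ x x', x ≤ -M → x' ≤ -M' →
        SignType.sign ((P.map φ).eval x) = SignType.sign ((P.map φ').eval x')) := fun P hP => by
    obtain ⟨h1, h2, h3⟩ := h𝒟 P hP
    have e1 := leadingCoeff_map_of_leadingCoeff_ne_zero φ h2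
    have e2 := leadingCoeff_map_of_leadingCoeff_ne_zero φ' h3
    have e3 := natDegree_map_of_leadingCoeff_ne_zero φ h2
    have e4 := natDegree_map_of_leadingCoeff_ne_zero φ' h3
    refine ⟨fun x x' hx hx' => ?_, fun x x' hx hx' => ?_⟩
    · rw [(hMs P h1).1 x hx, (hMs' P h1).1 x' hx', e1, e2, hφ P h1]
    · rw [(hMs P h1).2 x hx, (hMs' P h1).2 x' hx', e1, e2, e3, e4, hφ P h1]
  suffices H : ∃ y' : R', ∀ P ∈ 𝒟,
      SignType.sign ((P.map φ).eval y) = SignType.sign ((P.map φ').eval y') by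
    obtain ⟨y', hy'⟩ := H
    refine ⟨y', fun P hP => ?_⟩
    rcases h𝒞.reduce φ φ' hφ P hP with ⟨a, b⟩ | ⟨Q, a, b, c, d, e⟩
    · rw [a, b]; simp
    · rw [d, e]; exact hy' Q (Finset.mem_filter.2 ⟨a, b⟩)
  have main : ∀ D : Finset A[X], (D ⊆ 𝒟 ∧ ∀ P ∈ D, ∀ Q ∈ 𝒟, Q.natDegree < P.natDegree → Q ∈ D) →
      ∃ (Z : Finset R) (e : R → R'), Matching M M' Z e ∧
        (∀ z ∈ Z, z = M ∨ z = -M ∨ ∃ Q ∈ D, (Q.map φ).eval z = 0) ∧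
        ∀ x x', -M ≤ x → x ≤ M → Aligned Z e x x' → ∀ P ∈ D,
          SignType.sign ((P.map φ).eval x) = SignType.sign ((P.map φ').eval x') := by
    intro D
    induction D using Finset.induction_on_max_value (fun P : A[X] => P.natDegree) with
    | empty =>
      intro _
      have hMne : -M ≠ M := by linarith
      refine ⟨{-M, M}, fun x => if x = M then M' else -M', ⟨?_, by simp, by simp, by simp [hMne],
        by simp, ?_⟩, ?_, fun _ _ _ _ _ P hP => absurd hP (Finset.notMem_empty _)⟩
      · intro x hx z hz hxz
        simp only [Finset.coe_insert, Finset.coe_singleton, Set.mem_insert_iff,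
          Set.mem_singleton_iff] at hx hz
        rcases hx with rfl | rfl <;> rcases hz with rfl | rfl
        · exact absurd hxz (lt_irrefl _)
        · simp only [if_neg hMne, if_true]; linarith
        · linarith
        · exact absurd hxz (lt_irrefl _)
      · intro z hz
        simp only [Finset.mem_insert, Finset.mem_singleton] at hz
        rcases hz with rfl | rfl <;> constructor <;> linarith
      · intro z hz
        simp only [Finset.mem_insert, Finset.mem_singleton] at hz
        tauto
    | insert P D hPD hmax ih =>
      rintro ⟨hsub, hdown⟩
      have hP𝒟 := hsub (Finset.mem_insert_self P D)
      obtain ⟨hPC, hl, hl'⟩ := h𝒟 P hP𝒟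
      obtain ⟨Z, e, hm, hroots, hsign⟩ := ih ⟨(Finset.subset_insert _ _).trans hsub,
        fun Q hQ T hT hlt => by
          rcases Finset.mem_insert.1 (hdown Q (Finset.mem_insert_of_mem hQ) T hT hlt) with rfl | h
          · exact absurd (hmax Q hQ) (not_le.2 hlt)
          · exact h⟩
      have hlow : ∀ T ∈ 𝒞, T.natDegree < P.natDegree → ∀ x x', -M ≤ x → x ≤ M →
          Aligned Z e x x' →
          SignType.sign ((T.map φ).eval x) = SignType.sign ((T.map φ').eval x') := by
        intro T hT hTP x x' h1 h2 hal
        rcases h𝒞.reduce φ φ' hφ T hT with ⟨a, b⟩ | ⟨Q, a, b, c, d, f⟩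
        · rw [a, b]; simp
        · rw [d, f]
          have hQ𝒟 : Q ∈ 𝒟 := Finset.mem_filter.2 ⟨a, b⟩
          have hQP := c.trans_lt hTP
          rcases Finset.mem_insert.1 (hdown P (Finset.mem_insert_self _ _) Q hQ𝒟 hQP) with rfl | h
          · exact absurd hQP (lt_irrefl _)
          · exact hsign x x' h1 h2 hal Q h
      have hp : P.map φ ≠ 0 := fun h => hl (by
        rw [← leadingCoeff_map_of_leadingCoeff_ne_zero φ hl, h, leadingCoeff_zero])
      have hp' : P.map φ' ≠ 0 := fun h => hl' (by
        rw [← leadingCoeff_map_of_leadingCoeff_ne_zero φ' hl', h, leadingCoeff_zero])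
      obtain ⟨Z₁, e₁, k1, k2, k3, k4, k5⟩ := hm.extend hR hR' (P.map φ) (P.map φ') hp hp'
        (fun x x' h1 h2 hal => by
          rw [derivative_map, derivative_map]
          by_cases hd : P.natDegree = 0
          · rw [eq_C_of_natDegree_eq_zero hd]; simp
          · exact hlow _ (h𝒞.derivative_mem P hPC) (natDegree_derivative_lt hd) x x' h1 h2 hal)
        (fun z hz => by
          rcases hroots z hz with rfl | rfl | ⟨Q, hQD, hQz⟩
          · rw [hm.map_right]; exact (hinf P hP𝒟).1 _ _ le_rfl le_rfl
          · rw [hm.map_left]; exact (hinf P hP𝒟).2 _ _ le_rfl le_rfl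
          · have hQ𝒟 := hsub (Finset.mem_insert_of_mem hQD)
            obtain ⟨hQC, hq, hq'⟩ := h𝒟 Q hQ𝒟
            have hal := aligned_self hm.mono hz
            have hb := hm.bounded z hz
            have hQz' : (Q.map φ').eval (e z) = 0 := by
              have := hsign z (e z) hb.1 hb.2 hal Q hQD
              rwa [hQz, sign_zero, eq_comm, sign_eq_zero_iff] at this
            have hQ0 : 0 < Q.natDegree := by
              by_contra hcon
              have h0 : Q.natDegree = 0 := by omega
              rw [eq_C_of_natDegree_eq_zero h0] at hQz hq
              simp only [map_C, eval_C, leadingCoeff_C] at hQz hq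
              exact hq hQz
            have hle := hmax Q hQD
            have hPQ : P ≠ Q := fun h => hPD (h ▸ hQD)
            obtain ⟨⟨k, S, hS⟩, hdeg⟩ := pseudoRem_spec P Q hQ0
            have hrem := hlow _ (h𝒞.pseudoRem_mem P hPC Q hQC hPQ hle) (hdeg.trans_le hle)
              z (e z) hb.1 hb.2 hal
            have f1 : φ Q.leadingCoeff ^ k * (P.map φ).eval z =
                ((pseudoRem P Q).map φ).eval z := by
              have := congrArg (fun T => (T.map φ).eval z) hS
              simpa [hQz] using this
            have f2 : φ' Q.leadingCoeff ^ k * (P.map φ').eval (e z) =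
                ((pseudoRem P Q).map φ').eval (e z) := by
              have := congrArg (fun T => (T.map φ').eval (e z)) hS
              simpa [hQz'] using this
            rw [← f1, ← f2, sign_mul, sign_mul, sign_pow, sign_pow, hφ Q hQC] at hrem
            refine mul_left_cancel₀ (pow_ne_zero k ?_) hrem
            rwa [sign_ne_zero])
      refine ⟨Z₁, e₁, k1, fun z hz => ?_, fun x x' h1 h2 hal T hT => ?_⟩
      · rcases k4 z hz with h | h
        · rcases hroots z h with h | h | ⟨Q, a, b⟩
          · exact Or.inl h
          · exact Or.inr (Or.inl h)
          · exact Or.inr (Or.inr ⟨Q, Finset.mem_insert_of_mem a, b⟩)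
        · exact Or.inr (Or.inr ⟨P, Finset.mem_insert_self _ _, h⟩)
      · rcases Finset.mem_insert.1 hT with rfl | hT
        · exact k5 x x' h1 h2 hal
        · refine hsign x x' h1 h2 (fun z hz => ?_) T hT
          have := hal z (k2 hz)
          rwa [k3 z hz] at this
  by_cases hy1 : M ≤ y
  · exact ⟨M', fun P hP => (hinf P hP).1 _ _ hy1 le_rfl⟩
  by_cases hy2 : y ≤ -M
  · exact ⟨-M', fun P hP => (hinf P hP).2 _ _ hy2 le_rfl⟩
  push Not at hy1 hy2
  obtain ⟨Z, e, hm, -, hsign⟩ := main 𝒟 ⟨subset_rfl, fun _ _ Q hQ _ => hQ⟩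
  obtain ⟨y', -, -, hal⟩ := hm.exists_aligned hy2.le hy1.le
  exact ⟨y', hsign y y' hy2.le hy1.le hal⟩

theorem exists_transfer_one (𝒮 : Finset A[X]) :
    ∃ 𝒬 : Finset A, ∀ {R R' : Type} [Field R] [LinearOrder R] [IsStrictOrderedRing R]
      [Field R'] [LinearOrder R'] [IsStrictOrderedRing R'] (_ : PolyIVT R) (_ : PolyIVT R')
      (φ : A →+* R) (φ' : A →+* R') (_ : ∀ q ∈ 𝒬, SignType.sign (φ q) = SignType.sign (φ' q))
      (y : R), ∃ y' : R', ∀ P ∈ 𝒮,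
        SignType.sign ((P.map φ).eval y) = SignType.sign ((P.map φ').eval y') := by
  classical
  obtain ⟨𝒞, h1, h2⟩ := exists_hClosed 𝒮
  refine ⟨𝒞.image leadingCoeff, fun hR hR' φ φ' h y => ?_⟩
  obtain ⟨y', hy'⟩ := h2.transfer hR hR' φ φ'
    (fun P hP => h _ (Finset.mem_image_of_mem _ hP)) y
  exact ⟨y', fun P hP => hy' P (h1 hP)⟩

/-- Transfer of sign conditions between ordered fields with the intermediate value property: for a
finite set of polynomials with coefficients in `A`, finitely many elements of `A` control which
sign patterns are attained. -/
theorem exists_transfer (m : ℕ) {A : Type} [CommRing A] (𝒮 : Finset (MvPolynomial (Fin m) A)) :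
    ∃ 𝒬 : Finset A, ∀ {R R' : Type} [Field R] [LinearOrder R] [IsStrictOrderedRing R]
      [Field R'] [LinearOrder R'] [IsStrictOrderedRing R'] (_ : PolyIVT R) (_ : PolyIVT R')
      (φ : A →+* R) (φ' : A →+* R') (_ : ∀ q ∈ 𝒬, SignType.sign (φ q) = SignType.sign (φ' q))
      (y : Fin m → R), ∃ y' : Fin m → R', ∀ P ∈ 𝒮,
        SignType.sign (P.eval₂ φ y) = SignType.sign (P.eval₂ φ' y') := by
  classical
  induction m with
  | zero =>
    refine ⟨𝒮.image (MvPolynomial.coeff 0), fun {R R'} _ _ _ _ _ _ _ _ φ φ' h y =>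
      ⟨fun i => i.elim0, fun P hP => ?_⟩⟩
    have hh := h _ (Finset.mem_image_of_mem _ hP)
    rw [MvPolynomial.eq_C_of_isEmpty P]
    simpa using hh
  | succ m ih =>
    obtain ⟨𝒬₁, h1⟩ := exists_transfer_one
      (𝒮.image (MvPolynomial.finSuccEquiv A m))
    obtain ⟨𝒬, h2⟩ := ih 𝒬₁
    refine ⟨𝒬, fun {R R'} _ _ _ _ _ _ hR hR' φ φ' h y => ?_⟩
    obtain ⟨z', hz'⟩ := h2 hR hR' φ φ' h (Fin.tail y)
    obtain ⟨y₀, hy₀⟩ := h1 hR hR' (MvPolynomial.eval₂Hom φ (Fin.tail y))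
      (MvPolynomial.eval₂Hom φ' z') hz' (y 0)
    refine ⟨Fin.cons y₀ z', fun P hP => ?_⟩
    have hh := hy₀ _ (Finset.mem_image_of_mem _ hP)
    have key : ∀ {F : Type} [Field F] (ψ : A →+* F) (w : Fin (m + 1) → F),
        ((MvPolynomial.finSuccEquiv A m P).map
          (MvPolynomial.eval₂Hom ψ (Fin.tail w))).eval (w 0) = P.eval₂ ψ w := by
      intro F _ ψ w
      have : (evalRingHom (w 0)).comp ((mapRingHom (MvPolynomial.eval₂Hom ψ (Fin.tail w))).comp
          (MvPolynomial.finSuccEquiv A m : _ →+* _)) = MvPolynomial.eval₂Hom ψ w := by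
        refine MvPolynomial.ringHom_ext (fun a => ?_) fun i => ?_
        · simp [MvPolynomial.finSuccEquiv_apply]
        · refine Fin.cases ?_ (fun j => ?_) i
          · simp [MvPolynomial.finSuccEquiv_X_zero]
          · simp [MvPolynomial.finSuccEquiv_X_succ, Fin.tail]
      exact DFunLike.congr_fun this P
    rw [key φ y] at hh
    have := key φ' (Fin.cons y₀ z')
    rw [Fin.tail_cons, Fin.cons_zero] at this
    rwa [this] at hh

end PseudoRem
theorem polyIVT_real : PolyIVT ℝ := by
  intro p a b hab ha hb
  obtain ⟨c, hc, h0⟩ := intermediate_value_Ioo hab.le (p.continuous.continuousOn)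
    (show (0 : ℝ) ∈ Set.Ioo (p.eval a) (p.eval b) from ⟨ha, hb⟩)
  exact ⟨c, hc.1, hc.2, h0⟩

section Germ

variable {ι : Type} {𝒰 : Ultrafilter ι} {R : Type} [Field R] [LinearOrder R]
  [IsStrictOrderedRing R]

/-- The ultrapower of a field. -/
abbrev UPow (𝒰 : Ultrafilter ι) (R : Type) := Filter.Germ (𝒰 : Filter ι) R

/-- The canonical homomorphism to the ultrapower. -/
def UPow.ofFun (𝒰 : Ultrafilter ι) (R : Type) [CommRing R] : (ι → R) →+* UPow 𝒰 R :=
  Filter.Germ.coeRingHom (𝒰 : Filter ι)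

theorem UPow.ofFun_surjective : Function.Surjective (UPow.ofFun 𝒰 R) :=
  fun x => Filter.Germ.inductionOn x fun f => ⟨f, rfl⟩

theorem UPow.ofFun_pos {f : ι → R} : 0 < UPow.ofFun 𝒰 R f ↔ ∀ᶠ i in 𝒰, 0 < f i :=
  Filter.Germ.coe_pos

theorem UPow.ofFun_lt {f g : ι → R} :
    UPow.ofFun 𝒰 R f < UPow.ofFun 𝒰 R g ↔ ∀ᶠ i in 𝒰, f i < g i :=
  Filter.Germ.coe_lt

theorem UPow.ofFun_le {f g : ι → R} :
    UPow.ofFun 𝒰 R f ≤ UPow.ofFun 𝒰 R g ↔ ∀ᶠ i in 𝒰, f i ≤ g i :=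
  Filter.Germ.coe_le

theorem UPow.ofFun_eq {f g : ι → R} :
    UPow.ofFun 𝒰 R f = UPow.ofFun 𝒰 R g ↔ ∀ᶠ i in 𝒰, f i = g i :=
  Filter.Germ.coe_eq

theorem PolyIVT.uPow (hR : PolyIVT R) : PolyIVT (UPow 𝒰 R) := by
  intro p a b hab ha hb
  obtain ⟨P, rfl⟩ := Polynomial.map_surjective (UPow.ofFun 𝒰 R) UPow.ofFun_surjective p
  obtain ⟨α, rfl⟩ := UPow.ofFun_surjective a
  obtain ⟨β, rfl⟩ := UPow.ofFun_surjective b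
  have hev : ∀ (x : ι → R) i, (P.eval x) i = (P.map (Pi.evalRingHom (fun _ => R) i)).eval (x i) :=
    fun x i => (Polynomial.eval_map_apply (Pi.evalRingHom (fun _ => R) i) x).symm
  rw [Polynomial.eval_map_apply] at ha hb
  rw [← map_zero (UPow.ofFun 𝒰 R), UPow.ofFun_lt] at ha
  rw [UPow.ofFun_pos] at hb
  rw [UPow.ofFun_lt] at hab
  have : ∀ i, ∃ c, α i < β i → (P.eval α) i < 0 → 0 < (P.eval β) i →
      α i < c ∧ c < β i ∧ (P.map (Pi.evalRingHom (fun _ => R) i)).eval c = 0 := by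
    intro i
    by_cases h : α i < β i ∧ (P.eval α) i < 0 ∧ 0 < (P.eval β) i
    · obtain ⟨c, hc⟩ := hR (P.map (Pi.evalRingHom (fun _ => R) i)) (α i) (β i) h.1
        (by rw [← hev]; exact h.2.1) (by rw [← hev]; exact h.2.2)
      exact ⟨c, fun _ _ _ => hc⟩
    · exact ⟨0, fun h1 h2 h3 => absurd ⟨h1, h2, h3⟩ h⟩
  choose c hc using this
  refine ⟨UPow.ofFun 𝒰 R c, ?_, ?_, ?_⟩
  · rw [UPow.ofFun_lt]
    filter_upwards [hab, ha, hb] with i h1 h2 h3 using (hc i h1 h2 h3).1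
  · rw [UPow.ofFun_lt]
    filter_upwards [hab, ha, hb] with i h1 h2 h3 using (hc i h1 h2 h3).2.1
  · rw [Polynomial.eval_map_apply, ← map_zero (UPow.ofFun 𝒰 R), UPow.ofFun_eq]
    filter_upwards [hab, ha, hb] with i h1 h2 h3
    rw [hev]
    exact (hc i h1 h2 h3).2.2

end Germ

section Subfield

variable {F : Type} [Field F] [LinearOrder F] [IsStrictOrderedRing F]

theorem PolyIVT.subfield (hF : PolyIVT F) (k : Subfield F)
    (hk : ∀ (p : k[X]) (c : F), p ≠ 0 → (p.map k.subtype).eval c = 0 → c ∈ k) : PolyIVT k := by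
  intro p a b hab ha hb
  have hev : ∀ x : k, (p.map k.subtype).eval (x : F) = ((p.eval x : k) : F) := fun x =>
    Polynomial.eval_map_apply k.subtype x
  obtain ⟨c, h1, h2, h3⟩ := hF (p.map k.subtype) a b hab (by rw [hev]; exact ha)
    (by rw [hev]; exact hb)
  have hp : p ≠ 0 := by rintro rfl; simp at ha
  have hc := hk p c hp h3
  refine ⟨⟨c, hc⟩, h1, h2, ?_⟩
  have := hev ⟨c, hc⟩
  rw [h3] at this
  exact Subtype.ext this.symm

end Subfield

section Residue

variable {F : Type} [Field F] [LinearOrder F] [IsStrictOrderedRing F]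

open Classical in
/-- A convex valuation subring has an ordered residue field, which inherits the intermediate value
property. -/
theorem PolyIVT.exists_residue (hF : PolyIVT F) (V : ValuationSubring F)
    (hV : ∀ x y : F, |x| ≤ |y| → y ∈ V → x ∈ V) :
    ∃ (κ : Type) (_ : Field κ) (_ : LinearOrder κ) (_ : IsStrictOrderedRing κ) (π : V →+* κ),
      PolyIVT κ ∧ Function.Surjective π ∧ (∀ x : V, (0 : F) ≤ x → 0 ≤ π x) ∧
      (∀ x : V, (x : F) ≠ 0 → (x : F)⁻¹ ∈ V → π x ≠ 0) ∧
      (∀ x : V, π x ≠ 0 → (x : F) ≠ 0 ∧ (x : F)⁻¹ ∈ V) := by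
  let κ := IsLocalRing.ResidueField V
  let π : V →+* κ := IsLocalRing.residue V
  have hπs : Function.Surjective π := IsLocalRing.residue_surjective
  have hπ : ∀ x : V, π x ≠ 0 ↔ (x : F) ≠ 0 ∧ (x : F)⁻¹ ∈ V := by
    intro x
    rw [IsLocalRing.residue_ne_zero_iff_isUnit]
    constructor
    · rintro ⟨u, rfl⟩
      have h1 : ((u : V) : F) * ((u⁻¹ : Vˣ) : V) = 1 := by
        rw [← MulMemClass.coe_mul, Units.mul_inv]; rfl
      refine ⟨left_ne_zero_of_mul_eq_one h1, ?_⟩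
      rw [inv_eq_of_mul_eq_one_right h1]
      exact SetLike.coe_mem _
    · rintro ⟨h0, h1⟩
      exact IsUnit.of_mul_eq_one ⟨(x : F)⁻¹, h1⟩ (Subtype.ext (mul_inv_cancel₀ h0))
  have hmono : ∀ x y : V, (0 : F) ≤ x → (x : F) ≤ y → π y = 0 → π x = 0 := by
    intro x y h0 hxy hy
    by_contra hx
    obtain ⟨h1, h2⟩ := (hπ x).1 hx
    have hx0 : (0 : F) < x := lt_of_le_of_ne h0 (Ne.symm h1)
    have hy0 : (0 : F) < y := hx0.trans_le hxy
    refine (hπ y).2 ⟨hy0.ne', hV _ _ ?_ h2⟩ hy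
    rw [abs_of_pos (inv_pos.2 hx0), abs_of_pos (inv_pos.2 hy0)]
    exact inv_anti₀ hx0 hxy
  let C : RingCone κ :=
    { carrier := {a | ∃ x : V, (0 : F) ≤ x ∧ π x = a}
      mul_mem' := by
        rintro _ _ ⟨x, hx, rfl⟩ ⟨y, hy, rfl⟩
        exact ⟨x * y, mul_nonneg hx hy, map_mul _ _ _⟩
      one_mem' := ⟨1, zero_le_one, map_one _⟩
      add_mem' := by
        rintro _ _ ⟨x, hx, rfl⟩ ⟨y, hy, rfl⟩
        exact ⟨x + y, add_nonneg hx hy, map_add _ _ _⟩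
      zero_mem' := ⟨0, le_rfl, map_zero _⟩
      eq_zero_of_mem_of_neg_mem' := by
        rintro _ ⟨x, hx, rfl⟩ ⟨y, hy, hxy⟩
        refine hmono x (x + y) hx ?_ ?_
        · exact le_add_of_nonneg_right hy
        · rw [map_add, hxy, add_neg_cancel] }
  have hCmem : ∀ a : κ, a ∈ C ↔ ∃ x : V, (0 : F) ≤ x ∧ π x = a := fun a => Iff.rfl
  have : HasMemOrNegMem C := ⟨fun a => by
    obtain ⟨x, rfl⟩ := hπs a
    rcases le_total (0 : F) x with h | h
    · exact Or.inl ⟨x, h, rfl⟩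
    · exact Or.inr ⟨-x, neg_nonneg.2 h, map_neg _ _⟩⟩
  let lo : LinearOrder κ := LinearOrder.mkOfAddGroupCone C
  have : IsOrderedRing κ := IsOrderedRing.mkOfCone C
  have : IsStrictOrderedRing κ := IsOrderedRing.toIsStrictOrderedRing κ
  have hnn : ∀ x : V, (0 : F) ≤ x → 0 ≤ π x := fun x hx => by
    change π x - 0 ∈ C
    rw [sub_zero]
    exact ⟨x, hx, rfl⟩
  have hle : ∀ x y : V, (x : F) ≤ y → π x ≤ π y := fun x y h => by
    have := hnn (y - x) (sub_nonneg.2 h)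
    rwa [map_sub, sub_nonneg] at this
  have hlt : ∀ x y : V, π x < π y → (x : F) < y := fun x y h => by
    by_contra hcon
    exact absurd (hle y x (not_lt.1 hcon)) (not_le.2 h)
  refine ⟨κ, inferInstance, lo, inferInstance, π, ?_, hπs, hnn,
    fun x h1 h2 => (hπ x).2 ⟨h1, h2⟩, fun x hx => (hπ x).1 hx⟩
  intro p a b hab ha hb
  obtain ⟨P, rfl⟩ := Polynomial.map_surjective π hπs p
  obtain ⟨α, rfl⟩ := hπs a
  obtain ⟨β, rfl⟩ := hπs b
  have hev : ∀ x : V, (P.map V.subtype).eval (x : F) = ((P.eval x : V) : F) := fun x =>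
    Polynomial.eval_map_apply V.subtype x
  rw [Polynomial.eval_map_apply] at ha hb
  rw [← map_zero π] at ha hb
  obtain ⟨c, h1, h2, h3⟩ := hF (P.map V.subtype) α β (hlt _ _ hab)
    (by rw [hev]; exact hlt _ _ ha) (by rw [hev]; exact hlt _ _ hb)
  have habs : ∀ x : F, x ∈ V → |x| ∈ V := fun x hx => hV _ x (by rw [abs_abs]) hx
  have hcV : c ∈ V := by
    refine hV c (|(α : F)| + |(β : F)|) ?_ (add_mem (habs _ α.2) (habs _ β.2))
    rw [abs_of_nonneg (add_nonneg (abs_nonneg (α : F)) (abs_nonneg _)), abs_le]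
    have := neg_abs_le (α : F)
    have := le_abs_self (β : F)
    have := abs_nonneg (α : F)
    have := abs_nonneg (β : F)
    constructor <;> linarith
  have h0 : (P.map π).eval (π ⟨c, hcV⟩) = 0 := by
    rw [Polynomial.eval_map_apply]
    have h4 := hev ⟨c, hcV⟩
    rw [h3] at h4
    rw [Subtype.ext (a2 := (0 : V)) h4.symm, map_zero]
  refine ⟨π ⟨c, hcV⟩, lt_of_le_of_ne (hle _ _ h1.le) fun h => ?_,
    lt_of_le_of_ne (hle _ _ h2.le) fun h => ?_, h0⟩
  · rw [← h, Polynomial.eval_map_apply] at h0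
    rw [h0, map_zero] at ha
    exact lt_irrefl _ ha
  · rw [h, Polynomial.eval_map_apply] at h0
    rw [h0, map_zero] at hb
    exact lt_irrefl _ hb

end Residue
end GamePE

namespace GamePE

section Gain

variable {N : ℕ} {X : Fin N → Type} [∀ n, Fintype (X n)] [∀ n, DecidableEq (X n)]

/-- What player `n` gains by playing `σ n` rather than the pure strategy `s` when the opponents
play `τ`, over an arbitrary commutative ring. -/
def gain {B : Type*} [CommRing B] (G : Fin N → (∀ m, X m) → B) (σ τ : ∀ n, X n → B)
    (n : Fin N) (s : X n) : B :=
  ∑ p : ∀ m, X m, (∏ m ∈ Finset.univ.erase n, τ m (p m)) *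
    (σ n (p n) - if p n = s then 1 else 0) * G n p

theorem map_gain {B B' : Type*} [CommRing B] [CommRing B'] (f : B →+* B')
    (G : Fin N → (∀ m, X m) → B) (σ τ : ∀ n, X n → B) (n : Fin N) (s : X n) :
    f (gain G σ τ n s) =
      gain (fun n p => f (G n p)) (fun n s => f (σ n s)) (fun n s => f (τ n s)) n s := by
  simp only [gain, map_sum, map_mul, map_prod, map_sub, apply_ite f, map_one, map_zero]

theorem gain_mul {B : Type*} [CommRing B] (G : Fin N → (∀ m, X m) → B) (σ τ : ∀ n, X n → B)
    (c : B) (n : Fin N) (s : X n) :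
    gain G σ (fun m s => c * τ m s) n s = c ^ (N - 1) * gain G σ τ n s := by
  simp only [gain, Finset.prod_mul_distrib, Finset.prod_const, Finset.card_erase_of_mem
    (Finset.mem_univ n), Finset.card_univ, Fintype.card_fin, Finset.mul_sum, mul_assoc]

theorem payoff_sub_payoff (G : Fin N → (∀ m, X m) → ℝ) (σ τ : Profile X) (n : Fin N) (s : X n) :
    payoff G n (Function.update τ n (σ n)) - payoff G n (Function.update τ n (pureStrat s)) =
      gain G σ τ n s := by
  have key : ∀ t : X n → ℝ, payoff G n (Function.update τ n t) =
      ∑ p : ∀ m, X m, (∏ m ∈ Finset.univ.erase n, τ m (p m)) * t (p n) * G n p := by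
    intro t
    refine Finset.sum_congr rfl fun p _ => ?_
    rw [← Finset.mul_prod_erase Finset.univ _ (Finset.mem_univ n), Function.update_self, mul_comm
      (t (p n))]
    congr 2
    refine Finset.prod_congr rfl fun m hm => ?_
    rw [Function.update_of_ne (Finset.ne_of_mem_erase hm)]
  rw [key, key, gain, ← Finset.sum_sub_distrib]
  refine Finset.sum_congr rfl fun p _ => ?_
  rw [pureStrat]
  ring

/-- `τ` is a completely mixed profile `δ`-close to `σ` against which `σ` is a best reply. -/
structure Sol {B : Type*} [CommRing B] [LinearOrder B] (G : Fin N → (∀ m, X m) → B)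
    (σ : ∀ n, X n → B) (δ : B) (τ : ∀ n, X n → B) : Prop where
  pos : ∀ n s, 0 < τ n s
  sum_eq : ∀ n, ∑ s, τ n s = 1
  lower : ∀ n s, 0 < τ n s - σ n s + δ
  upper : ∀ n s, 0 < σ n s - τ n s + δ
  gain_nonneg : ∀ n s, 0 ≤ gain G σ τ n s

theorem isPerfect_iff (G : Fin N → (∀ m, X m) → ℝ) (σ : Profile X) :
    IsPerfect G σ ↔ ∀ δ > 0, ∃ τ, Sol G σ δ τ := by
  have hb : ∀ (τ : Profile X) (n : Fin N) (s : X n),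
      payoff G n (Function.update τ n (σ n)) ≥ payoff G n (Function.update τ n (pureStrat s)) ↔
        0 ≤ gain G σ τ n s := fun τ n s => by
    rw [← payoff_sub_payoff, sub_nonneg]
  constructor
  · rintro ⟨σk, h1, h2, h3⟩ δ hδ
    have h4 : ∀ᶠ k in Filter.atTop, ∀ n s, |σk k n s - σ n s| < δ := by
      rw [Filter.eventually_all]; intro n
      rw [Filter.eventually_all]; intro s
      have := (tendsto_pi_nhds.1 ((tendsto_pi_nhds.1 h2) n)) s
      filter_upwards [Metric.tendsto_nhds.1 this δ hδ] with k hk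
      rwa [Real.dist_eq] at hk
    obtain ⟨k, hk⟩ := h4.exists
    refine ⟨σk k, (h1 k).2, fun n => ((h1 k).1 n).2, fun n s => ?_, fun n s => ?_,
      fun n s => (hb _ n s).1 (h3 k n s)⟩
    · have := (abs_lt.1 (hk n s)).1; linarith
    · have := (abs_lt.1 (hk n s)).2; linarith
  · intro h
    choose f hf using fun k : ℕ => h (1 / ((k : ℝ) + 1)) (by positivity)
    refine ⟨f, fun k => ⟨fun n => ⟨fun s => ((hf k).pos n s).le, (hf k).sum_eq n⟩, (hf k).pos⟩,
      ?_, fun k n s => (hb _ n s).2 ((hf k).gain_nonneg n s)⟩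
    rw [tendsto_pi_nhds]; intro n
    rw [tendsto_pi_nhds]; intro s
    rw [tendsto_iff_dist_tendsto_zero]
    refine squeeze_zero (fun _ => dist_nonneg) (fun k => ?_)
      tendsto_one_div_add_atTop_nhds_zero_nat
    rw [Real.dist_eq, abs_le]
    have := (hf k).lower n s
    have := (hf k).upper n s
    constructor <;> linarith

theorem sol_uPow {ι : Type} {𝒰 : Ultrafilter ι} {R : Type} [Field R] [LinearOrder R]
    [IsStrictOrderedRing R] (G : Fin N → (∀ m, X m) → ι → R) (σ τ : ∀ n, X n → ι → R) (δ : ι → R) :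
    Sol (fun n p => UPow.ofFun 𝒰 R (G n p)) (fun n s => UPow.ofFun 𝒰 R (σ n s))
      (UPow.ofFun 𝒰 R δ) (fun n s => UPow.ofFun 𝒰 R (τ n s)) ↔
    ∀ᶠ i in 𝒰, Sol (fun n p => G n p i) (fun n s => σ n s i) (δ i) (fun n s => τ n s i) := by
  have hg : ∀ n s i, (gain G σ τ n s) i =
      gain (fun n p => G n p i) (fun n s => σ n s i) (fun n s => τ n s i) n s := fun n s i =>
    map_gain (Pi.evalRingHom (fun _ => R) i) G σ τ n s
  have e1 : ∀ n s, 0 < UPow.ofFun 𝒰 R (τ n s) ↔ ∀ᶠ i in 𝒰, 0 < τ n s i :=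
    fun n s => UPow.ofFun_pos
  have e2 : ∀ n, ∑ s, UPow.ofFun 𝒰 R (τ n s) = 1 ↔ ∀ᶠ i in 𝒰, ∑ s, τ n s i = 1 := fun n => by
    rw [← map_sum, ← map_one (UPow.ofFun 𝒰 R), UPow.ofFun_eq]
    simp only [Finset.sum_apply, Pi.one_apply]
  have e3 : ∀ n s, 0 < UPow.ofFun 𝒰 R (τ n s) - UPow.ofFun 𝒰 R (σ n s) + UPow.ofFun 𝒰 R δ ↔
      ∀ᶠ i in 𝒰, 0 < τ n s i - σ n s i + δ i := fun n s => by
    rw [← map_sub, ← map_add, UPow.ofFun_pos]; rfl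
  have e4 : ∀ n s, 0 < UPow.ofFun 𝒰 R (σ n s) - UPow.ofFun 𝒰 R (τ n s) + UPow.ofFun 𝒰 R δ ↔
      ∀ᶠ i in 𝒰, 0 < σ n s i - τ n s i + δ i := fun n s => by
    rw [← map_sub, ← map_add, UPow.ofFun_pos]; rfl
  have e5 : ∀ n s, 0 ≤ gain (fun n p => UPow.ofFun 𝒰 R (G n p))
      (fun n s => UPow.ofFun 𝒰 R (σ n s)) (fun n s => UPow.ofFun 𝒰 R (τ n s)) n s ↔
      ∀ᶠ i in 𝒰, 0 ≤ gain (fun n p => G n p i) (fun n s => σ n s i) (fun n s => τ n s i) n s :=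
    fun n s => by
      rw [← map_gain, ← map_zero (UPow.ofFun 𝒰 R), UPow.ofFun_le]
      simp only [hg, Pi.zero_apply]
  constructor
  · rintro ⟨h1, h2, h3, h4, h5⟩
    simp only [e1, e2, e3, e4, e5, ← Filter.eventually_all] at h1 h2 h3 h4 h5
    filter_upwards [h1, h2, h3, h4, h5] with i a b c d e using ⟨a, b, c, d, e⟩
  · intro h
    exact ⟨fun n s => (e1 n s).2 (h.mono fun i hi => hi.pos n s),
      fun n => (e2 n).2 (h.mono fun i hi => hi.sum_eq n),
      fun n s => (e3 n s).2 (h.mono fun i hi => hi.lower n s),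
      fun n s => (e4 n s).2 (h.mono fun i hi => hi.upper n s),
      fun n s => (e5 n s).2 (h.mono fun i hi => hi.gain_nonneg n s)⟩

theorem exists_sol_transfer {A : Type} [CommRing A] (g : Fin N → (∀ m, X m) → A)
    (sg : ∀ n, X n → A) (dl : A) :
    ∃ 𝒬 : Finset A, ∀ {R R' : Type} [Field R] [LinearOrder R] [IsStrictOrderedRing R]
      [Field R'] [LinearOrder R'] [IsStrictOrderedRing R'] (_ : PolyIVT R) (_ : PolyIVT R')
      (φ : A →+* R) (φ' : A →+* R') (_ : ∀ q ∈ 𝒬, SignType.sign (φ q) = SignType.sign (φ' q))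
      (τ : ∀ n, X n → R),
      Sol (fun n p => φ (g n p)) (fun n s => φ (sg n s)) (φ dl) τ →
      ∃ τ', Sol (fun n p => φ' (g n p)) (fun n s => φ' (sg n s)) (φ' dl) τ' := by
  classical
  let ix := Fintype.equivFin (Σ n, X n)
  let v : ∀ n, X n → MvPolynomial (Fin (Fintype.card (Σ n, X n))) A :=
    fun n s => MvPolynomial.X (ix ⟨n, s⟩)
  let c : A →+* MvPolynomial (Fin (Fintype.card (Σ n, X n))) A := MvPolynomial.C
  let p₂ : Fin N → MvPolynomial (Fin (Fintype.card (Σ n, X n))) A := fun n => ∑ s, v n s - 1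
  let p₃ : (Σ n, X n) → MvPolynomial (Fin (Fintype.card (Σ n, X n))) A :=
    fun q => v q.1 q.2 - c (sg q.1 q.2) + c dl
  let p₄ : (Σ n, X n) → MvPolynomial (Fin (Fintype.card (Σ n, X n))) A :=
    fun q => c (sg q.1 q.2) - v q.1 q.2 + c dl
  let p₅ : (Σ n, X n) → MvPolynomial (Fin (Fintype.card (Σ n, X n))) A :=
    fun q => gain (fun n p => c (g n p)) (fun n s => c (sg n s)) v q.1 q.2
  obtain ⟨𝒬, h𝒬⟩ := exists_transfer _ (Finset.univ.image (fun q : Σ n, X n => v q.1 q.2) ∪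
    Finset.univ.image p₂ ∪ Finset.univ.image p₃ ∪ Finset.univ.image p₄ ∪ Finset.univ.image p₅)
  refine ⟨𝒬, fun {R R'} _ _ _ _ _ _ hR hR' φ φ' hs τ hτ => ?_⟩
  obtain ⟨y, hy⟩ : ∃ y : Fin (Fintype.card (Σ n, X n)) → R, ∀ n s, y (ix ⟨n, s⟩) = τ n s :=
    ⟨(fun q : Σ n, X n => τ q.1 q.2) ∘ ix.symm, fun n s => by
      rw [Function.comp_apply, Equiv.symm_apply_apply]⟩
  obtain ⟨y', hy'⟩ := h𝒬 hR hR' φ φ' hs y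
  have ev : ∀ {F : Type} [Field F] (ψ : A →+* F) (y : Fin (Fintype.card (Σ n, X n)) → F),
      (∀ n s, (v n s).eval₂ ψ y = y (ix ⟨n, s⟩)) ∧
      (∀ n, (p₂ n).eval₂ ψ y = ∑ s, y (ix ⟨n, s⟩) - 1) ∧
      (∀ n s, (p₃ ⟨n, s⟩).eval₂ ψ y = y (ix ⟨n, s⟩) - ψ (sg n s) + ψ dl) ∧
      (∀ n s, (p₄ ⟨n, s⟩).eval₂ ψ y = ψ (sg n s) - y (ix ⟨n, s⟩) + ψ dl) ∧
      (∀ n s, (p₅ ⟨n, s⟩).eval₂ ψ y = gain (fun n p => ψ (g n p)) (fun n s => ψ (sg n s))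
        (fun n s => y (ix ⟨n, s⟩)) n s) := by
    intro F _ ψ y
    have hh : ∀ P : MvPolynomial (Fin (Fintype.card (Σ n, X n))) A, P.eval₂ ψ y =
      MvPolynomial.eval₂Hom ψ y P := fun P => rfl
    refine ⟨fun n s => ?_, fun n => ?_, fun n s => ?_, fun n s => ?_, fun n s => ?_⟩
    · simp [v]
    · simp only [p₂, v, MvPolynomial.eval₂_sub, MvPolynomial.eval₂_sum, MvPolynomial.eval₂_X,
        MvPolynomial.eval₂_one]
    · simp only [p₃, v, c, MvPolynomial.eval₂_sub, MvPolynomial.eval₂_add, MvPolynomial.eval₂_X,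
        MvPolynomial.eval₂_C]
    · simp only [p₄, v, c, MvPolynomial.eval₂_sub, MvPolynomial.eval₂_add, MvPolynomial.eval₂_X,
        MvPolynomial.eval₂_C]
    · rw [hh, map_gain]
      simp only [v, c, MvPolynomial.coe_eval₂Hom, MvPolynomial.eval₂_X, MvPolynomial.eval₂_C]
  obtain ⟨a1, a2, a3, a4, a5⟩ := ev φ y
  obtain ⟨b1, b2, b3, b4, b5⟩ := ev φ' y'
  simp only [hy] at a1 a2 a3 a4 a5
  refine ⟨fun n s => y' (ix ⟨n, s⟩), fun n s => ?_, fun n => ?_, fun n s => ?_, fun n s => ?_,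
    fun n s => ?_⟩
  · have := hy' (v n s) (by
      simp only [Finset.mem_union, Finset.mem_image]
      exact Or.inl (Or.inl (Or.inl (Or.inl ⟨⟨n, s⟩, Finset.mem_univ _, rfl⟩))))
    rw [a1, b1, sign_pos (hτ.pos n s)] at this
    exact sign_eq_one_iff.1 this.symm
  · have := hy' (p₂ n) (by
      simp only [Finset.mem_union, Finset.mem_image]
      exact Or.inl (Or.inl (Or.inl (Or.inr ⟨n, Finset.mem_univ _, rfl⟩))))
    rw [a2, b2, hτ.sum_eq, sub_self, sign_zero] at this
    exact sub_eq_zero.1 (sign_eq_zero_iff.1 this.symm)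
  · have := hy' (p₃ ⟨n, s⟩) (by
      simp only [Finset.mem_union, Finset.mem_image]
      exact Or.inl (Or.inl (Or.inr ⟨⟨n, s⟩, Finset.mem_univ _, rfl⟩)))
    rw [a3, b3, sign_pos (hτ.lower n s)] at this
    exact sign_eq_one_iff.1 this.symm
  · have := hy' (p₄ ⟨n, s⟩) (by
      simp only [Finset.mem_union, Finset.mem_image]
      exact Or.inl (Or.inr ⟨⟨n, s⟩, Finset.mem_univ _, rfl⟩))
    rw [a4, b4, sign_pos (hτ.upper n s)] at this
    exact sign_eq_one_iff.1 this.symm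
  · have := hy' (p₅ ⟨n, s⟩) (by
      simp only [Finset.mem_union, Finset.mem_image]
      exact Or.inr ⟨⟨n, s⟩, Finset.mem_univ _, rfl⟩)
    rw [a5, b5] at this
    rw [← sign_nonneg_iff, ← this, sign_nonneg_iff]
    exact hτ.gain_nonneg n s

end Gain
set_option linter.unusedSectionVars false

section LexBestReply

open Polynomial

variable {N : ℕ} {X : Fin N → Type} [∀ n, Fintype (X n)] [∀ n, DecidableEq (X n)]

/-- The first nonzero entry of `f` with index at most `K`, if any, is positive. -/
def LexNonneg (K : ℕ) (f : ℕ → ℝ) : Prop :=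
  ∀ i ≤ K, (∀ j < i, f j = 0) → 0 ≤ f i

theorem lexGe_iff {k : ℕ} {a b g : ℕ → ℝ}
    (h : ∀ i, SignType.sign (a i - b i) = SignType.sign (g i)) :
    lexGe k a b ↔ LexNonneg k g := by
  have h0 : ∀ i, a i = b i ↔ g i = 0 := fun i => by
    rw [← sub_eq_zero, ← sign_eq_zero_iff, h, sign_eq_zero_iff]
  have h1 : ∀ i, b i < a i ↔ 0 < g i := fun i => by
    rw [← sub_pos, ← sign_eq_one_iff, h, sign_eq_one_iff]
  constructor
  · rintro (h2 | ⟨i, hi, h2, h3⟩) j hj h4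
    · exact ((h0 j).1 (h2 j hj)).ge
    · rcases lt_trichotomy j i with h5 | rfl | h5
      · exact ((h0 j).1 (h2 j h5)).ge
      · exact ((h1 j).1 h3).le
      · exact absurd (h4 i h5) ((h1 i).1 h3).ne'
  · intro h2
    by_cases h3 : ∀ i ≤ k, a i = b i
    · exact Or.inl h3
    · classical
      push Not at h3
      have h4 := Nat.find_spec h3
      have h5 : ∀ j < Nat.find h3, a j = b j := fun j hj => by
        by_contra hne
        exact Nat.find_min h3 hj ⟨hj.le.trans h4.1, hne⟩
      refine Or.inr ⟨Nat.find h3, h4.1, h5, (h1 _).2 (lt_of_le_of_ne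
        (h2 _ h4.1 fun j hj => (h0 j).1 (h5 j hj)) fun h6 => h4.2 ((h0 _).2 h6.symm))⟩

/-- The polynomial arc with coefficients `a`, truncated at degree `K`. -/
noncomputable def arc (K : ℕ) (a : ∀ n, ℕ → X n → ℝ) (n : Fin N) (s : X n) : ℝ[X] :=
  ∑ i ∈ Finset.range (K + 1), C (a n i s) * (Polynomial.X : ℝ[X]) ^ i

/-- The gain of a game along an arc of profiles. -/
noncomputable def arcGain (G : Fin N → (∀ m, X m) → ℝ) (σ : Profile X) (f : ∀ n, X n → ℝ[X])
    (n : Fin N) (s : X n) : ℝ[X] :=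
  gain (fun n p => C (G n p)) (fun n s => C (σ n s)) f n s

theorem combine_eq (n : Fin N) (sn : X n) (so : ∀ m : {m : Fin N // m ≠ n}, X m.val) :
    combine n sn so = (Equiv.piSplitAt n X).symm (sn, so) := by
  funext m
  by_cases h : m = n
  · subst h
    simp [combine]
  · simp [combine, h]

theorem coeff_prod_arc {K : ℕ} (ϱ : ∀ n, Fin (K + 1) → X n → ℝ) (n : Fin N) (k : ℕ)
    (so : ∀ m : {m : Fin N // m ≠ n}, X m.val) :
    (∏ m : {m : Fin N // m ≠ n}, ∑ i : Fin (K + 1),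
      C (ϱ m.val i (so m)) * (Polynomial.X : ℝ[X]) ^ (i : ℕ)).coeff k = ubelief ϱ n k so := by
  rw [Finset.prod_univ_sum, Fintype.piFinset_univ, finsetSum_coeff, ubelief, Finset.sum_filter]
  refine Finset.sum_congr rfl fun kv _ => ?_
  rw [Finset.prod_mul_distrib, Finset.prod_pow_eq_pow_sum, ← map_prod, coeff_C_mul, coeff_X_pow]
  simp only [eq_comm (a := k), mul_ite, mul_one, mul_zero]

theorem coeff_arcGain {K : ℕ} (G : Fin N → (∀ m, X m) → ℝ) (σ : Profile X)
    (ϱ : ∀ n, Fin (K + 1) → X n → ℝ) (n : Fin N) (s : X n) (k : ℕ) :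
    (arcGain G σ (fun n s => ∑ i : Fin (K + 1),
      C (ϱ n i s) * (Polynomial.X : ℝ[X]) ^ (i : ℕ)) n s).coeff k =
    ∑ so : ∀ m : {m : Fin N // m ≠ n}, X m.val, ∑ sn : X n,
      ubelief ϱ n k so * (σ n sn - pureStrat s sn) * G n (combine n sn so) := by
  rw [arcGain, gain, ← (Equiv.piSplitAt n X).symm.sum_comp, Fintype.sum_prod_type,
    Finset.sum_comm, finsetSum_coeff]
  refine Finset.sum_congr rfl fun so _ => ?_
  rw [finsetSum_coeff]
  refine Finset.sum_congr rfl fun sn _ => ?_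
  rw [← combine_eq, Finset.prod_subtype (p := fun m => m ≠ n) (Finset.univ.erase n) (by simp),
    ← coeff_prod_arc]
  have e1 : combine n sn so n = sn := by simp [combine]
  have e2 : ∀ m : {m : Fin N // m ≠ n}, combine n sn so m.val = so m := fun m => by
    simp [combine, m.2]
  simp only [e1, e2]
  have e3 : (C (σ n sn) - if sn = s then 1 else 0 : ℝ[X]) = C (σ n sn - pureStrat s sn) := by
    rw [pureStrat, map_sub, apply_ite C, map_one, map_zero]
  rw [e3, coeff_mul_C, coeff_mul_C]

theorem lpsBestReply_iff {K : ℕ} (G : Fin N → (∀ m, X m) → ℝ) (σ : Profile X)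
    (ϱ : ∀ n, Fin (K + 1) → X n → ℝ) (hϱ : IsLPSProfile ϱ) (n : Fin N) :
    lpsBestReply G ϱ n (σ n) K ↔ ∀ s, LexNonneg K fun k => (arcGain G σ (fun n s =>
      ∑ i : Fin (K + 1), C (ϱ n i s) * (Polynomial.X : ℝ[X]) ^ (i : ℕ)) n s).coeff k := by
  refine forall_congr' fun s => lexGe_iff fun k => ?_
  have hu : ∀ so, 0 ≤ ubelief ϱ n k so := fun so =>
    Finset.sum_nonneg fun _ _ => Finset.prod_nonneg fun m _ => (hϱ m.val _).1 _
  have e1 : beliefPayoff G n (σ n) (belief ϱ n k) - beliefPayoff G n (pureStrat s) (belief ϱ n k) =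
      (∑ so', ubelief ϱ n k so')⁻¹ * ∑ so : ∀ m : {m : Fin N // m ≠ n}, X m.val, ∑ sn : X n,
      ubelief ϱ n k so * (σ n sn - pureStrat s sn) * G n (combine n sn so) := by
    simp only [beliefPayoff, belief, Finset.mul_sum, ← Finset.sum_sub_distrib]
    exact Finset.sum_congr rfl fun so _ => Finset.sum_congr rfl fun sn _ => by ring
  rw [coeff_arcGain, e1]
  rcases (Finset.sum_nonneg fun so _ => hu so : 0 ≤ ∑ so', ubelief ϱ n k so').eq_or_lt with h | h
  · have h0 : ∀ so, ubelief ϱ n k so = 0 := fun so =>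
      (Finset.sum_eq_zero_iff_of_nonneg fun so _ => hu so).1 h.symm so (Finset.mem_univ _)
    simp [h0]
  · rw [sign_mul, sign_pos (inv_pos.2 h), one_mul]

/-- The lexicographic characterization, phrased through the coefficients of the arc of `ϱ`. -/
structure LPSArc (ℓ K : ℕ) (G : Fin N → (∀ m, X m) → ℝ) (σ : Profile X)
    (a : ∀ n, ℕ → X n → ℝ) : Prop where
  zero_eq : ∀ n, a n 0 = σ n
  nonneg : ∀ n, ∀ i ≤ K, ∀ s, 0 ≤ a n i s
  sum_eq : ∀ n, ∀ i ≤ K, ∑ s, a n i s = 1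
  support : ∀ n s, ∃ i ≤ ℓ, a n i s ≠ 0
  lex : ∀ n s, LexNonneg K fun k => (arcGain G σ (arc K a) n s).coeff k

theorem lpsLevel_le_iff {K ℓ : ℕ} (ϱ : ∀ n, Fin (K + 1) → X n → ℝ) :
    (FullSupport ϱ ∧ lpsLevel ϱ ≤ ℓ) ↔ ∀ n s, ∃ i : Fin (K + 1), (i : ℕ) ≤ ℓ ∧ ϱ n i s ≠ 0 := by
  constructor
  · rintro ⟨h1, h2⟩ n
    have h3 : {k : ℕ | ∀ s : X n, ∃ i : Fin (K + 1), (i : ℕ) ≤ k ∧ ϱ n i s ≠ 0}.Nonempty :=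
      ⟨K, fun s => (h1 n s).imp fun i hi => ⟨Nat.lt_succ_iff.1 i.2, hi⟩⟩
    intro s
    obtain ⟨i, h4, h5⟩ := Nat.sInf_mem h3 s
    exact ⟨i, h4.trans ((Finset.le_sup (f := fun n => sInf {k : ℕ | ∀ s : X n,
      ∃ i : Fin (K + 1), (i : ℕ) ≤ k ∧ ϱ n i s ≠ 0}) (Finset.mem_univ n)).trans h2), h5⟩
  · intro h
    exact ⟨fun n s => (h n s).imp fun i hi => hi.2, Finset.sup_le fun n _ => Nat.sInf_le (h n)⟩

theorem exists_lps_iff {K ℓ : ℕ} (hℓ : ℓ ≤ K) (G : Fin N → (∀ m, X m) → ℝ) (σ : Profile X) :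
    (∃ ϱ : ∀ n, Fin (K + 1) → X n → ℝ, (IsLPSProfile ϱ ∧ FullSupport ϱ ∧ lpsLevel ϱ ≤ ℓ) ∧
      (∀ n, ϱ n 0 = σ n) ∧ (∀ n, lpsBestReply G ϱ n (σ n) K)) ↔ ∃ a, LPSArc ℓ K G σ a := by
  constructor
  · rintro ⟨ϱ, ⟨h1, h2⟩, h3, h4⟩
    rw [lpsLevel_le_iff] at h2
    let a : ∀ n, ℕ → X n → ℝ := fun n i => if h : i < K + 1 then ϱ n ⟨i, h⟩ else 0
    have ha : ∀ n (i : Fin (K + 1)), a n i = ϱ n i := fun n i => dif_pos i.2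
    have ha' : ∀ n, ∀ i, ∀ hi : i ≤ K, a n i = ϱ n ⟨i, Nat.lt_succ_iff.2 hi⟩ :=
      fun n i hi => dif_pos (Nat.lt_succ_iff.2 hi)
    have harc : arc K a = fun n s => ∑ i : Fin (K + 1),
        C (ϱ n i s) * (Polynomial.X : ℝ[X]) ^ (i : ℕ) := by
      funext n s
      rw [arc, Finset.sum_range]
      simp only [ha]
    refine ⟨a, fun n => (ha n 0).trans (h3 n), fun n i hi s => ?_, fun n i hi => ?_,
      fun n s => ?_, fun n s => ?_⟩
    · rw [ha' n i hi]; exact (h1 n _).1 s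
    · rw [ha' n i hi]; exact (h1 n _).2
    · obtain ⟨i, h5, h6⟩ := h2 n s
      exact ⟨i, h5, by rwa [ha]⟩
    · rw [harc]
      exact (lpsBestReply_iff G σ ϱ h1 n).1 (h4 n) s
  · rintro ⟨a, h1, h2, h3, h4, h5⟩
    have hϱ : IsLPSProfile fun n (i : Fin (K + 1)) => a n i := fun n i =>
      ⟨h2 n i (Nat.lt_succ_iff.1 i.2), h3 n i (Nat.lt_succ_iff.1 i.2)⟩
    refine ⟨fun n i => a n i, ⟨hϱ, (lpsLevel_le_iff _).2 fun n s => ?_⟩, h1, fun n => ?_⟩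
    · obtain ⟨i, h6, h7⟩ := h4 n s
      exact ⟨⟨i, by omega⟩, h6, h7⟩
    · refine (lpsBestReply_iff G σ _ hϱ n).2 fun s => ?_
      have := h5 n s
      have harc : arc K a = fun n s => ∑ i : Fin (K + 1),
          C (a n i s) * (Polynomial.X : ℝ[X]) ^ (i : ℕ) := by
        funext n s
        rw [arc, Finset.sum_range]
      rwa [harc] at this

end LexBestReply

section Transport

variable {N : ℕ} {X Y : Fin N → Type} [∀ n, Fintype (X n)] [∀ n, DecidableEq (X n)]
  [∀ n, Fintype (Y n)] [∀ n, DecidableEq (Y n)]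

theorem gain_equiv {B : Type*} [CommRing B] (e : ∀ n, X n ≃ Y n) (G : Fin N → (∀ m, Y m) → B)
    (σ τ : ∀ n, Y n → B) (n : Fin N) (s : X n) :
    gain (fun n p => G n fun m => e m (p m)) (fun n s => σ n (e n s)) (fun n s => τ n (e n s)) n s =
      gain G σ τ n (e n s) := by
  rw [gain, gain, ← (Equiv.piCongrRight e).sum_comp]
  simp
  rfl

theorem isPerfect_of_equiv (e : ∀ n, X n ≃ Y n) (G : Fin N → (∀ m, Y m) → ℝ) (σ : Profile Y)
    (h : IsPerfect G σ) : IsPerfect (S := X) (fun n p => G n fun m => e m (p m))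
      (fun n s => σ n (e n s)) := by
  rw [isPerfect_iff] at h ⊢
  intro δ hδ
  obtain ⟨τ, h1, h2, h3, h4, h5⟩ := h δ hδ
  refine ⟨fun n s => τ n (e n s), fun n s => h1 n _, fun n => ?_, fun n s => h3 n _,
    fun n s => h4 n _, fun n s => ?_⟩
  · rw [(e n).sum_comp (τ n), h2]
  · rw [gain_equiv]; exact h5 n _

theorem LPSArc.of_equiv (e : ∀ n, X n ≃ Y n) {ℓ K : ℕ} {G : Fin N → (∀ m, Y m) → ℝ}
    {σ : Profile Y} {a : ∀ n, ℕ → Y n → ℝ} (h : LPSArc ℓ K G σ a) :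
    LPSArc (X := X) ℓ K (fun n p => G n fun m => e m (p m)) (fun n s => σ n (e n s))
      (fun n i s => a n i (e n s)) := by
  obtain ⟨h1, h2, h3, h4, h5⟩ := h
  refine ⟨fun n => funext fun s => by rw [h1], fun n i hi s => h2 n i hi _,
    fun n i hi => ?_, fun n s => h4 n _, fun n s => ?_⟩
  · rw [(e n).sum_comp (a n i), h3 n i hi]
  · have := gain_equiv e (fun n p => Polynomial.C (G n p)) (fun n s => Polynomial.C (σ n s))
      (arc K a) n s
    have h6 := h5 n (e n s)
    rw [arcGain, ← this] at h6
    exact h6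

end Transport
section CoreArc

set_option linter.unusedSectionVars false

open Polynomial

variable {N : ℕ} {X : Fin N → Type} [∀ n, Fintype (X n)] [∀ n, DecidableEq (X n)]

/-- Coefficients up to order `K` of an arc issuing from `σ` whose coordinates are positive of
order at most `d`, and along which `σ` is a lexicographic best reply. -/
structure CoreArc (d K : ℕ) (G : Fin N → (∀ m, X m) → ℝ) (σ : Profile X)
    (a : ∀ n, ℕ → X n → ℝ) : Prop where
  zero_eq : ∀ n, a n 0 = σ n
  sum_eq_zero : ∀ n i, 1 ≤ i → i ≤ K → ∑ s, a n i s = 0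
  lead : ∀ n s, ∃ i ≤ d, 0 < a n i s ∧ ∀ j < i, a n j s = 0
  lex : ∀ n s, LexNonneg K fun k => (arcGain G σ (arc K a) n s).coeff k

theorem coeff_arc {K k : ℕ} (hk : k ≤ K) (a : ∀ n, ℕ → X n → ℝ) (n : Fin N) (s : X n) :
    (arc K a n s).coeff k = a n k s := by
  rw [arc, finsetSum_coeff]
  simp only [coeff_C_mul_X_pow]
  rw [Finset.sum_ite_eq, if_pos (Finset.mem_range.2 (Nat.lt_succ_iff.2 hk))]

theorem dvd_arcGain_sub {K : ℕ} (G : Fin N → (∀ m, X m) → ℝ) (σ : Profile X)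
    {f f' : ∀ n, X n → ℝ[X]} (h : ∀ n s, (Polynomial.X : ℝ[X]) ^ K ∣ f n s - f' n s)
    (n : Fin N) (s : X n) :
    (Polynomial.X : ℝ[X]) ^ K ∣ arcGain G σ f n s - arcGain G σ f' n s := by
  have key : ∀ p q : ℝ[X], Ideal.Quotient.mk (Ideal.span {(Polynomial.X : ℝ[X]) ^ K}) p =
      Ideal.Quotient.mk (Ideal.span {(Polynomial.X : ℝ[X]) ^ K}) q ↔
      (Polynomial.X : ℝ[X]) ^ K ∣ p - q := fun p q => by
    rw [Ideal.Quotient.eq, Ideal.mem_span_singleton]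
  rw [← key, arcGain, arcGain, map_gain, map_gain]
  simp only [(key _ _).2 (h _ _)]

theorem LexNonneg.mul {K : ℕ} {p : ℝ[X]} (h : LexNonneg K p.coeff) {g : ℝ[X]}
    (hg : g.coeff 0 = 1) : LexNonneg K (g * p).coeff := by
  intro i hi h0
  have h1 : (Polynomial.X : ℝ[X]) ^ i ∣ p := by
    refine prime_X.pow_dvd_of_dvd_mul_left i (fun h2 => ?_) (X_pow_dvd_iff.2 h0)
    rw [X_dvd_iff, hg] at h2
    exact one_ne_zero h2
  have h2 := h i hi (X_pow_dvd_iff.1 h1)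
  obtain ⟨q, rfl⟩ := h1
  have h3 := coeff_X_pow_mul q i 0
  have h4 := coeff_X_pow_mul (g * q) i 0
  rw [zero_add] at h3 h4
  rw [h3] at h2
  rwa [mul_left_comm, h4, mul_coeff_zero, hg, one_mul]

theorem LexNonneg.congr {K : ℕ} {f g : ℕ → ℝ} (h : LexNonneg K f) (hfg : ∀ k ≤ K, f k = g k) :
    LexNonneg K g := fun i hi h0 => by
  rw [← hfg i hi]
  exact h i hi fun j hj => by rw [hfg j (hj.le.trans hi), h0 j hj]

theorem LexNonneg.comp {K : ℕ} {p : ℝ[X]} (h : LexNonneg K p.coeff) {ε : ℝ} (hε : 0 < ε) :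
    LexNonneg K (p.comp (C ε * Polynomial.X)).coeff := by
  intro i hi h0
  simp only [comp_C_mul_X_coeff] at h0 ⊢
  refine mul_nonneg (h i hi fun j hj => ?_) (by positivity)
  exact (mul_eq_zero.1 (h0 j hj)).resolve_right (by positivity)

theorem eventually_sum_nonneg (f : ℕ → ℝ) (i : ℕ) (h0 : 0 < f i) (h1 : ∀ j < i, f j = 0) (k : ℕ) :
    ∀ᶠ ε : ℝ in nhdsWithin 0 (Set.Ioi 0), 0 ≤ ∑ j ∈ Finset.range (k + 1), ε ^ j * f j := by
  rcases lt_or_ge k i with h | h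
  · refine Filter.Eventually.of_forall fun ε => Finset.sum_nonneg fun j hj => ?_
    rw [h1 j (lt_of_lt_of_le (Finset.mem_range.1 hj) h), mul_zero]
  · obtain ⟨m, rfl⟩ := Nat.exists_eq_add_of_le h
    have hc : Filter.Tendsto (fun ε : ℝ => ∑ j ∈ Finset.range (m + 1), ε ^ j * f (i + j))
        (nhdsWithin 0 (Set.Ioi 0)) (nhds (f i)) := by
      have : Continuous fun ε : ℝ => ∑ j ∈ Finset.range (m + 1), ε ^ j * f (i + j) := by fun_prop
      have h2 := (this.tendsto 0).mono_left (nhdsWithin_le_nhds (s := Set.Ioi 0))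
      rw [Finset.sum_range_succ'] at h2
      simpa using h2
    filter_upwards [hc.eventually (lt_mem_nhds h0), self_mem_nhdsWithin] with ε h2 h3
    have h3 : 0 < ε := h3
    rw [add_assoc, Finset.sum_range_add, Finset.sum_eq_zero fun j hj => by
      rw [h1 j (Finset.mem_range.1 hj), mul_zero], zero_add]
    simp only [pow_add, mul_assoc]
    rw [← Finset.mul_sum]
    positivity

theorem CoreArc.exists_lpsArc {d K : ℕ} {G : Fin N → (∀ m, X m) → ℝ} {σ : Profile X}
    (hσ : IsMixed σ) {a : ∀ n, ℕ → X n → ℝ} (h : CoreArc d K G σ a) : ∃ a, LPSArc d K G σ a := by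
  have hev : ∀ᶠ ε : ℝ in nhdsWithin 0 (Set.Ioi 0), ∀ n s, ∀ k ∈ Finset.range (K + 1),
      0 ≤ ∑ j ∈ Finset.range (k + 1), ε ^ j * a n j s := by
    rw [Filter.eventually_all]; intro n
    rw [Filter.eventually_all]; intro s
    rw [Filter.eventually_all_finset]; intro k _
    obtain ⟨i, _, h1, h2⟩ := h.lead n s
    exact eventually_sum_nonneg (fun j => a n j s) i h1 h2 k
  obtain ⟨ε, hε, hε0⟩ := (hev.and self_mem_nhdsWithin).exists
  have hε0 : 0 < ε := hε0
  let b : ∀ n, ℕ → X n → ℝ := fun n k s => ∑ j ∈ Finset.range (k + 1), ε ^ j * a n j s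
  refine ⟨b, fun n => ?_, fun n i hi s => hε n s i (Finset.mem_range.2 (Nat.lt_succ_iff.2 hi)),
    fun n i hi => ?_, fun n s => ?_, fun n s => ?_⟩
  · funext s
    simp [b, h.zero_eq]
  · simp only [b]
    rw [Finset.sum_comm, Finset.sum_range_succ']
    simp only [← Finset.mul_sum, h.zero_eq, (hσ n).2, pow_zero, one_mul]
    rw [Finset.sum_eq_zero, zero_add]
    intro j hj
    rw [h.sum_eq_zero n (j + 1) (by omega) (by have := Finset.mem_range.1 hj; omega), mul_zero]
  · obtain ⟨i, hi, h1, h2⟩ := h.lead n s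
    refine ⟨i, hi, ?_⟩
    simp only [b]
    rw [Finset.sum_range_succ, Finset.sum_eq_zero fun j hj => by
      rw [h2 j (Finset.mem_range.1 hj), mul_zero], zero_add]
    positivity
  · let g : ℝ[X] := ∑ k ∈ Finset.range (K + 1), (Polynomial.X : ℝ[X]) ^ k
    have hgc : ∀ k ≤ K, g.coeff k = 1 := fun k hk => by
      simp only [g, finsetSum_coeff, coeff_X_pow]
      rw [Finset.sum_ite_eq, if_pos (Finset.mem_range.2 (Nat.lt_succ_iff.2 hk))]
    have h1 : ∀ n s, (Polynomial.X : ℝ[X]) ^ (K + 1) ∣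
        g * (arc K a n s).comp (C ε * Polynomial.X) - arc K b n s := by
      intro n s
      rw [X_pow_dvd_iff]
      intro k hk
      have hk := Nat.lt_succ_iff.1 hk
      rw [coeff_sub, coeff_arc hk, mul_comm, coeff_mul,
        Finset.Nat.sum_antidiagonal_eq_sum_range_succ
          (fun i j => ((arc K a n s).comp (C ε * Polynomial.X)).coeff i * g.coeff j)]
      refine sub_eq_zero.2 (Finset.sum_congr rfl fun j hj => ?_)
      have hj := Nat.lt_succ_iff.1 (Finset.mem_range.1 hj)
      rw [hgc _ (by omega), comp_C_mul_X_coeff, coeff_arc (hj.trans hk)]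
      ring
    have h2 : arcGain G σ (fun n s => g * (arc K a n s).comp (C ε * Polynomial.X)) n s =
        g ^ (N - 1) * (arcGain G σ (arc K a) n s).comp (C ε * Polynomial.X) := by
      rw [arcGain, gain_mul]
      have := map_gain (compRingHom (C ε * Polynomial.X)) (fun n p => C (G n p))
        (fun n s => C (σ n s)) (arc K a) n s
      simp only [coe_compRingHom_apply, C_comp] at this
      rw [arcGain, this]
    have h3 := ((h.lex n s).comp hε0).mul (g := g ^ (N - 1)) (by
      rw [coeff_zero_eq_eval_zero, eval_pow, ← coeff_zero_eq_eval_zero, hgc 0 (Nat.zero_le K),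
        one_pow])
    rw [← h2] at h3
    refine h3.congr fun k hk => sub_eq_zero.1 ?_
    rw [← coeff_sub]
    exact X_pow_dvd_iff.1 (dvd_arcGain_sub G σ h1 n s) k (Nat.lt_succ_iff.2 hk)

end CoreArc
section Residue

variable {F : Type} [Field F] [LinearOrder F] [IsStrictOrderedRing F]

/-- The elements bounded by a power of `ε⁻¹`. -/
def polyBounded {ε : F} (h0 : 0 < ε) (h1 : ε ≤ 2⁻¹) : ValuationSubring F where
  carrier := {x | ∃ m : ℕ, |x| * ε ^ m ≤ 1}
  mul_mem' := by
    rintro x y ⟨m, hm⟩ ⟨k, hk⟩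
    refine ⟨m + k, ?_⟩
    calc |x * y| * ε ^ (m + k) = (|x| * ε ^ m) * (|y| * ε ^ k) := by rw [abs_mul]; ring
      _ ≤ 1 := mul_le_one₀ hm (by positivity) hk
  one_mem' := ⟨0, by simp⟩
  zero_mem' := ⟨0, by simp⟩
  add_mem' := by
    rintro x y ⟨m, hm⟩ ⟨k, hk⟩
    have h2 : ε ≤ 1 := h1.trans (by norm_num)
    have hx : |x| * ε ^ (m + k) ≤ 1 := by
      rw [pow_add, ← mul_assoc]
      exact mul_le_one₀ hm (by positivity) (pow_le_one₀ h0.le h2)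
    have hy : |y| * ε ^ (m + k) ≤ 1 := by
      rw [add_comm, pow_add, ← mul_assoc]
      exact mul_le_one₀ hk (by positivity) (pow_le_one₀ h0.le h2)
    refine ⟨m + k + 1, ?_⟩
    calc |x + y| * ε ^ (m + k + 1) ≤ (|x| + |y|) * ε ^ (m + k + 1) :=
          mul_le_mul_of_nonneg_right (abs_add_le x y) (by positivity)
      _ = (|x| * ε ^ (m + k) + |y| * ε ^ (m + k)) * ε := by ring
      _ ≤ 2 * 2⁻¹ := mul_le_mul (by linarith) h1 h0.le (by norm_num)
      _ = 1 := by norm_num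
  neg_mem' := by
    rintro x ⟨m, hm⟩
    exact ⟨m, by rwa [abs_neg]⟩
  mem_or_inv_mem' := by
    intro x
    rcases le_total |x| 1 with h | h
    · exact Or.inl ⟨0, by simpa using h⟩
    · exact Or.inr ⟨0, by rw [abs_inv, pow_zero, mul_one]; exact inv_le_one_of_one_le₀ h⟩

theorem PolyIVT.exists_polyBounded_residue (hF : PolyIVT F) {ε : F} (h0 : 0 < ε) (h1 : ε ≤ 2⁻¹) :
    ∃ (κ : Type) (_ : Field κ) (_ : LinearOrder κ) (_ : IsStrictOrderedRing κ)
      (π : polyBounded h0 h1 →+* κ), PolyIVT κ ∧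
      (∀ x : polyBounded h0 h1, ε ≤ x → 0 < π x) ∧
      (∀ (x : polyBounded h0 h1) (m : ℕ), ε ^ m ≤ x → 0 < π x) ∧
      (∀ x : polyBounded h0 h1, (∀ m : ℕ, -ε ^ m ≤ x) → 0 ≤ π x) := by
  obtain ⟨κ, _, _, _, π, h2, -, h3, h4, h5⟩ := hF.exists_residue (polyBounded h0 h1) (by
    rintro x y hxy ⟨m, hm⟩
    exact ⟨m, (mul_le_mul_of_nonneg_right hxy (by positivity)).trans hm⟩)
  have h6 : ∀ (x : polyBounded h0 h1) (m : ℕ), ε ^ m ≤ x → 0 < π x := fun x m hx => by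
    have hx0 : (0 : F) < x := lt_of_lt_of_le (by positivity) hx
    refine lt_of_le_of_ne (h3 x hx0.le) (h4 x hx0.ne' ⟨m, ?_⟩).symm
    rw [abs_inv, abs_of_pos hx0, inv_mul_le_iff₀ hx0, mul_one]
    exact hx
  refine ⟨κ, inferInstance, inferInstance, inferInstance, π, h2, fun x hx => h6 x 1 (by rwa [pow_one]), h6, fun x hx => ?_⟩
  rcases le_or_gt 0 (x : F) with h | h
  · exact h3 x h
  · by_contra hne
    obtain ⟨-, m, hm⟩ := h5 x (by rintro h7; exact hne h7.ge)
    rw [abs_inv, abs_of_neg h, inv_mul_le_iff₀ (by linarith), mul_one] at hm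
    have h8 := hx (m + 1)
    have h9 : ε ^ (m + 1) < ε ^ m := by
      rw [pow_succ]
      exact mul_lt_of_lt_one_right (by positivity) (h1.trans_lt (by norm_num))
    linarith

end Residue

section RealArc

set_option linter.unusedSectionVars false

open Polynomial

theorem LexNonneg.eventually_eval {K : ℕ} {q : ℝ[X]} (h : LexNonneg K q.coeff) :
    ∀ᶠ ε : ℝ in nhdsWithin 0 (Set.Ioi 0), -ε ^ K ≤ q.eval ε := by
  have lim : ∀ r : ℝ[X], Filter.Tendsto (fun ε => r.eval ε) (nhdsWithin 0 (Set.Ioi 0))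
      (nhds (r.coeff 0)) := fun r => by
    rw [coeff_zero_eq_eval_zero]
    exact (r.continuous.tendsto 0).mono_left nhdsWithin_le_nhds
  have hpos : ∀ᶠ ε : ℝ in nhdsWithin 0 (Set.Ioi 0), 0 < ε := self_mem_nhdsWithin
  by_cases h1 : ∀ i < K + 1, q.coeff i = 0
  · obtain ⟨r, rfl⟩ := X_pow_dvd_iff.2 h1
    have h2 := lim (Polynomial.X * r)
    rw [mul_coeff_zero, coeff_X_zero, zero_mul] at h2
    filter_upwards [h2.eventually (lt_mem_nhds (show (-1 : ℝ) < 0 by norm_num)), hpos]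
      with ε h3 h4
    rw [eval_mul, eval_X] at h3
    rw [eval_mul, eval_pow, eval_X, pow_succ, mul_assoc]
    nlinarith [pow_pos h4 K]
  · classical
    push Not at h1
    obtain ⟨i, h2, h2', h3⟩ : ∃ i < K + 1, q.coeff i ≠ 0 ∧ ∀ j < i, q.coeff j = 0 :=
      ⟨Nat.find h1, (Nat.find_spec h1).1, (Nat.find_spec h1).2, fun j hj => by
        by_contra hne
        exact Nat.find_min h1 hj ⟨hj.trans (Nat.find_spec h1).1, hne⟩⟩
    have h4 := lt_of_le_of_ne (h _ (Nat.lt_succ_iff.1 h2) h3) h2'.symm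
    obtain ⟨r, rfl⟩ := X_pow_dvd_iff.2 h3
    have h5 := coeff_X_pow_mul r i 0
    rw [zero_add] at h5
    rw [h5] at h4
    filter_upwards [(lim r).eventually (lt_mem_nhds h4), hpos] with ε h6 h7
    rw [eval_mul, eval_pow, eval_X]
    have : 0 ≤ ε ^ K := by positivity
    have : 0 ≤ ε ^ i * eval ε r := by positivity
    linarith

variable {N : ℕ} {X : Fin N → Type} [∀ n, Fintype (X n)] [∀ n, DecidableEq (X n)]

/-- An `LPSArc` yields approximate solutions, up to an error of order `K`. -/
theorem LPSArc.eventually {ℓ K : ℕ} (hℓ : ℓ ≤ K) {G : Fin N → (∀ m, X m) → ℝ} {σ : Profile X}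
    {a : ∀ n, ℕ → X n → ℝ} (h : LPSArc ℓ K G σ a) {δ : ℝ} (hδ : 0 < δ) :
    ∀ᶠ ε : ℝ in nhdsWithin 0 (Set.Ioi 0), ∃ p : Profile X,
      (∀ n s, ε ^ (ℓ + 1) ≤ p n s) ∧ (∀ n, ∑ s, p n s = 1) ∧
      (∀ n s, ε ≤ p n s - σ n s + δ) ∧ (∀ n s, ε ≤ σ n s - p n s + δ) ∧
      (∀ n s, -ε ^ K ≤ gain G σ p n s) := by
  let D : ℝ → ℝ := fun ε => ∑ i ∈ Finset.range (K + 1), ε ^ i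
  let p : ℝ → Profile X := fun ε n s => (D ε)⁻¹ * (arc K a n s).eval ε
  have harc : ∀ ε n s, (arc K a n s).eval ε = ∑ i ∈ Finset.range (K + 1), a n i s * ε ^ i :=
    fun ε n s => by simp [arc, eval_finsetSum]
  have hpos : ∀ᶠ ε : ℝ in nhdsWithin 0 (Set.Ioi 0), 0 < ε := self_mem_nhdsWithin
  have hsmall : ∀ c : ℝ, 0 < c → ∀ᶠ ε : ℝ in nhdsWithin 0 (Set.Ioi 0), ε < c := fun c hc =>
    nhdsWithin_le_nhds (gt_mem_nhds hc)
  have hD0 : D 0 = 1 := by simp [D, Finset.sum_range_succ']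
  have hlim : ∀ n s, Filter.Tendsto (fun ε => p ε n s) (nhdsWithin 0 (Set.Ioi 0))
      (nhds (σ n s)) := by
    intro n s
    have hDc : Continuous D := by fun_prop
    have h1 := ((hDc.tendsto 0).inv₀ (by rw [hD0]; exact one_ne_zero)).mul
      ((arc K a n s).continuous.tendsto 0)
    rw [hD0, inv_one, one_mul, ← coeff_zero_eq_eval_zero, coeff_arc (Nat.zero_le K),
      h.zero_eq] at h1
    exact h1.mono_left nhdsWithin_le_nhds
  have e1 : ∀ᶠ ε : ℝ in nhdsWithin 0 (Set.Ioi 0), ∀ n s, ∃ i ≤ ℓ, ε < a n i s / (K + 1) := by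
    rw [Filter.eventually_all]; intro n
    rw [Filter.eventually_all]; intro s
    obtain ⟨i, hi, h1⟩ := h.support n s
    have h2 : 0 < a n i s := lt_of_le_of_ne (h.nonneg n i (hi.trans hℓ) s) h1.symm
    filter_upwards [hsmall (a n i s / (K + 1)) (by positivity)] with ε h3 using ⟨i, hi, h3⟩
  have e2 : ∀ᶠ ε : ℝ in nhdsWithin 0 (Set.Ioi 0), ∀ n s, |p ε n s - σ n s| < δ / 2 := by
    rw [Filter.eventually_all]; intro n
    rw [Filter.eventually_all]; intro s
    filter_upwards [Metric.tendsto_nhds.1 (hlim n s) (δ / 2) (by positivity)] with ε h1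
    rwa [Real.dist_eq] at h1
  have e3 : ∀ᶠ ε : ℝ in nhdsWithin 0 (Set.Ioi 0), ∀ n s,
      -ε ^ K ≤ (arcGain G σ (arc K a) n s).eval ε := by
    rw [Filter.eventually_all]; intro n
    rw [Filter.eventually_all]; intro s
    exact (h.lex n s).eventually_eval
  filter_upwards [e1, e2, e3, hpos, hsmall 1 one_pos, hsmall (δ / 2) (by positivity)]
    with ε h1 h2 h3 h4 h5 h6
  have hD1 : 1 ≤ D ε := by
    simp only [D]
    rw [Finset.sum_range_succ', pow_zero]
    have : 0 ≤ ∑ k ∈ Finset.range K, ε ^ (k + 1) := Finset.sum_nonneg fun _ _ => by positivity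
    linarith
  have hD2 : D ε ≤ K + 1 := by
    have : D ε ≤ ∑ i ∈ Finset.range (K + 1), (1 : ℝ) :=
      Finset.sum_le_sum fun i _ => pow_le_one₀ h4.le h5.le
    simpa using this
  have hD3 : 0 < D ε := by linarith
  refine ⟨p ε, fun n s => ?_, fun n => ?_, fun n s => ?_, fun n s => ?_, fun n s => ?_⟩
  · obtain ⟨i, hi, h7⟩ := h1 n s
    have h8 : a n i s * ε ^ i ≤ (arc K a n s).eval ε := by
      rw [harc]
      exact Finset.single_le_sum (f := fun i => a n i s * ε ^ i) (fun j hj => mul_nonneg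
        (h.nonneg n j (Nat.lt_succ_iff.1 (Finset.mem_range.1 hj)) s) (by positivity))
        (Finset.mem_range.2 (by omega))
    rw [lt_div_iff₀ (by positivity)] at h7
    simp only [p]
    rw [le_inv_mul_iff₀ hD3]
    refine le_trans ?_ h8
    have h9 : ε ^ ℓ ≤ ε ^ i := pow_le_pow_of_le_one h4.le h5.le hi
    calc D ε * ε ^ (ℓ + 1) ≤ (K + 1) * ε ^ (ℓ + 1) :=
          mul_le_mul_of_nonneg_right hD2 (by positivity)
      _ = (ε * (K + 1)) * ε ^ ℓ := by ring
      _ ≤ a n i s * ε ^ i := mul_le_mul h7.le h9 (by positivity) (by nlinarith)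
  · simp only [p, harc]
    rw [← Finset.mul_sum, Finset.sum_comm]
    simp only [← Finset.sum_mul]
    rw [Finset.sum_congr rfl fun i hi => by
      rw [h.sum_eq n i (Nat.lt_succ_iff.1 (Finset.mem_range.1 hi)), one_mul]]
    exact inv_mul_cancel₀ hD3.ne'
  · have := (abs_lt.1 (h2 n s)).1
    linarith
  · have := (abs_lt.1 (h2 n s)).2
    linarith
  · have h7 : gain G σ (p ε) n s = ((D ε)⁻¹) ^ (N - 1) * (arcGain G σ (arc K a) n s).eval ε := by
      have := map_gain (evalRingHom ε) (fun n p => C (G n p)) (fun n s => C (σ n s))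
        (arc K a) n s
      simp only [coe_evalRingHom, eval_C] at this
      rw [arcGain, this]
      exact gain_mul G σ (fun n s => (arc K a n s).eval ε) (D ε)⁻¹ n s
    rw [h7]
    have h8 : ((D ε)⁻¹) ^ (N - 1) ≤ 1 := pow_le_one₀ (by positivity) (inv_le_one_of_one_le₀ hD1)
    have h9 : 0 < ((D ε)⁻¹) ^ (N - 1) := by positivity
    have h10 : 0 < ε ^ K := by positivity
    nlinarith [h3 n s]

end RealArc
section SufficientOrder

set_option linter.unusedSectionVars false

variable {N : ℕ} {X : Fin N → Type} [∀ n, Fintype (X n)] [∀ n, DecidableEq (X n)]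

/-- Indices for the real data of a game, a profile and a tolerance. -/
abbrev Datum (X : Fin N → Type) := (Fin N × (∀ m, X m)) ⊕ (Σ n, X n) ⊕ Unit

/-- Evaluation of integer polynomials at a datum. -/
noncomputable def datumHom {B : Type} [CommRing B] (v : Datum X → B) :
    MvPolynomial (Datum X) ℤ →+* B :=
  MvPolynomial.eval₂Hom (Int.castRingHom B) v

theorem datumHom_X {B : Type} [CommRing B] (v : Datum X → B) (i : Datum X) :
    datumHom v (MvPolynomial.X i) = v i :=
  MvPolynomial.eval₂_X _ _ _

theorem map_datumHom {B B' : Type} [CommRing B] [CommRing B'] (f : B →+* B') (v : Datum X → B)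
    (q : MvPolynomial (Datum X) ℤ) : f (datumHom v q) = datumHom (fun i => f (v i)) q := by
  have : f.comp (datumHom v) = datumHom fun i => f (v i) := by
    refine MvPolynomial.ringHom_ext (fun r => ?_) fun i => ?_
    · simp [datumHom]
    · simp [datumHom]
  exact congrArg (fun g : MvPolynomial (Datum X) ℤ →+* B' => g q) this

theorem exists_scale {ℓ K : ℕ} (hℓ : ℓ ≤ K) {G : Fin N → (∀ m, X m) → ℝ} {σ : Profile X}
    {a : ∀ n, ℕ → X n → ℝ} (h : LPSArc ℓ K G σ a) {δ : ℝ} (hδ : 0 < δ) (v : Datum X → ℝ)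
    (𝒬 : Finset ℝ) :
    ∃ (ε : ℝ) (p : Profile X), (0 < ε ∧ ε ≤ 2⁻¹) ∧ (∀ i, |v i| * ε ≤ 1) ∧
      (∀ q ∈ 𝒬, q ≠ 0 → ε ≤ |q|) ∧
      (∀ n s, ε ^ (ℓ + 1) ≤ p n s) ∧ (∀ n, ∑ s, p n s = 1) ∧
      (∀ n s, ε ≤ p n s - σ n s + δ) ∧ (∀ n s, ε ≤ σ n s - p n s + δ) ∧
      (∀ n s, -ε ^ K ≤ gain G σ p n s) := by
  have hpos : ∀ᶠ ε : ℝ in nhdsWithin 0 (Set.Ioi 0), 0 < ε := self_mem_nhdsWithin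
  have hsmall : ∀ c : ℝ, 0 < c → ∀ᶠ ε : ℝ in nhdsWithin 0 (Set.Ioi 0), ε < c := fun c hc =>
    nhdsWithin_le_nhds (gt_mem_nhds hc)
  have e1 : ∀ᶠ ε : ℝ in nhdsWithin 0 (Set.Ioi 0), ∀ i, |v i| * ε ≤ 1 := by
    rw [Filter.eventually_all]; intro i
    filter_upwards [hpos, hsmall (|v i| + 1)⁻¹ (by positivity)] with ε h1 h2
    have h3 : 0 ≤ |v i| := abs_nonneg _
    rw [lt_inv_comm₀ h1 (by positivity), lt_inv_comm₀ (by positivity) h1,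
      ← one_div, lt_div_iff₀ (by positivity)] at h2
    nlinarith
  have e2 : ∀ᶠ ε : ℝ in nhdsWithin 0 (Set.Ioi 0), ∀ q ∈ 𝒬, q ≠ 0 → ε ≤ |q| := by
    rw [Filter.eventually_all_finset]; intro q _
    by_cases hq : q = 0
    · exact Filter.Eventually.of_forall fun ε h => absurd hq h
    · filter_upwards [hsmall |q| (abs_pos.2 hq)] with ε h1 _ using h1.le
  obtain ⟨ε, ⟨p, h3⟩, h1, h2, h4, h5⟩ := ((h.eventually hℓ hδ).and (e1.and (e2.and (hpos.and
    (hsmall 2⁻¹ (by norm_num)))))).exists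
  exact ⟨ε, p, ⟨h4, h5.le⟩, h1, h2, h3⟩

theorem exists_order_isPerfect (X : Fin N → Type) [∀ n, Fintype (X n)] [∀ n, DecidableEq (X n)]
    (ℓ : ℕ) : ∃ K, ℓ ≤ K ∧ ∀ (G : Fin N → (∀ m, X m) → ℝ) (σ : Profile X)
      (a : ∀ n, ℕ → X n → ℝ), LPSArc ℓ K G σ a → IsPerfect G σ := by
  classical
  let g : Fin N → (∀ m, X m) → MvPolynomial (Datum X) ℤ := fun n p => MvPolynomial.X (Sum.inl (n, p))
  let sg : ∀ n, X n → MvPolynomial (Datum X) ℤ := fun n s =>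
    MvPolynomial.X (Sum.inr (Sum.inl ⟨n, s⟩))
  let dl : MvPolynomial (Datum X) ℤ := MvPolynomial.X (Sum.inr (Sum.inr ()))
  obtain ⟨𝒬, h𝒬⟩ := exists_sol_transfer g sg dl
  by_contra hcon
  push Not at hcon
  have hstep : ∀ k : ℕ, ∃ (v : Datum X → ℝ) (ε : ℝ) (p : Profile X),
      (0 < ε ∧ ε ≤ 2⁻¹) ∧ (∀ i, |v i| * ε ≤ 1) ∧
      (∀ q ∈ 𝒬, datumHom v q ≠ 0 → ε ≤ |datumHom v q|) ∧
      (∀ n s, ε ^ (ℓ + 1) ≤ p n s) ∧ (∀ n, ∑ s, p n s = 1) ∧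
      (∀ n s, ε ≤ p n s - datumHom v (sg n s) + datumHom v dl) ∧
      (∀ n s, ε ≤ datumHom v (sg n s) - p n s + datumHom v dl) ∧
      (∀ n s, -ε ^ (k + ℓ) ≤ gain (fun n p => datumHom v (g n p))
        (fun n s => datumHom v (sg n s)) p n s) ∧
      ¬∃ τ, Sol (fun n p => datumHom v (g n p)) (fun n s => datumHom v (sg n s))
        (datumHom v dl) τ := by
    intro k
    obtain ⟨G, σ, a, h1, h2⟩ := hcon (k + ℓ) (by omega)
    rw [isPerfect_iff] at h2
    push Not at h2
    obtain ⟨δ, hδ, h2⟩ := h2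
    let v : Datum X → ℝ := Sum.elim (fun q => G q.1 q.2) (Sum.elim (fun q => σ q.1 q.2) fun _ => δ)
    obtain ⟨ε, p, h3, h4, h5, h6, h7, h8, h9, h10⟩ := exists_scale (by omega) h1 hδ v
      (𝒬.image (datumHom v))
    refine ⟨v, ε, p, h3, h4, fun q hq => h5 _ (Finset.mem_image_of_mem _ hq), h6, h7, ?_⟩
    simp only [g, sg, dl, datumHom_X]
    exact ⟨h8, h9, h10, fun ⟨τ, hτ⟩ => h2 τ hτ⟩
  choose v ε p hε hv hq hp1 hp2 hp3 hp4 hp5 hp6 using hstep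
  let 𝒰 : Ultrafilter ℕ := Filter.hyperfilter ℕ
  have hcof : ∀ m : ℕ, ∀ᶠ k in 𝒰, m ≤ k := fun m =>
    Filter.hyperfilter_le_cofinite (Nat.cofinite_eq_atTop ▸ Filter.eventually_ge_atTop m)
  let e : UPow 𝒰 ℝ := UPow.ofFun 𝒰 ℝ ε
  have he0 : 0 < e := UPow.ofFun_pos.2 (Filter.Eventually.of_forall fun k => (hε k).1)
  have he1 : e ≤ 2⁻¹ := by
    have h1 : UPow.ofFun 𝒰 ℝ (2 * ε) ≤ UPow.ofFun 𝒰 ℝ 1 :=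
      UPow.ofFun_le.2 (Filter.Eventually.of_forall fun k => by
        have := (hε k).2
        simp only [Pi.mul_apply, Pi.ofNat_apply]
        linarith)
    rw [map_mul, map_ofNat, map_one] at h1
    rw [← one_div, le_div_iff₀ two_pos, mul_comm]
    exact h1
  have habs : ∀ f : ℕ → ℝ, |UPow.ofFun 𝒰 ℝ f| = UPow.ofFun 𝒰 ℝ fun k => |f k| := fun f => by
    rcases le_total 0 (UPow.ofFun 𝒰 ℝ f) with h | h
    · rw [abs_of_nonneg h, UPow.ofFun_eq]
      rw [← map_zero (UPow.ofFun 𝒰 ℝ), UPow.ofFun_le] at h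
      exact h.mono fun k hk => (abs_of_nonneg hk).symm
    · rw [abs_of_nonpos h, ← map_neg, UPow.ofFun_eq]
      rw [← map_zero (UPow.ofFun 𝒰 ℝ), UPow.ofFun_le] at h
      exact h.mono fun k hk => (abs_of_nonpos hk).symm
  have hmem : ∀ f : ℕ → ℝ, (∀ k, |f k| * ε k ≤ 1) → UPow.ofFun 𝒰 ℝ f ∈ polyBounded he0 he1 := by
    intro f hf
    refine ⟨1, ?_⟩
    rw [pow_one, habs, ← map_mul, ← map_one (UPow.ofFun 𝒰 ℝ), UPow.ofFun_le]
    exact Filter.Eventually.of_forall hf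
  have hp1' : ∀ k n s, 0 ≤ p k n s := fun k n s =>
    (pow_pos (hε k).1 (ℓ + 1)).le.trans (hp1 k n s)
  obtain ⟨κ, _, _, _, π, hκ, hπ1, hπ2, hπ3⟩ := polyIVT_real.uPow.exists_polyBounded_residue he0 he1
  let w : Datum X → polyBounded he0 he1 := fun i => ⟨UPow.ofFun 𝒰 ℝ fun k => v k i,
    hmem _ fun k => hv k i⟩
  let pw : ∀ n, X n → polyBounded he0 he1 := fun n s => ⟨UPow.ofFun 𝒰 ℝ fun k => p k n s,
    hmem _ fun k => by
      have h1 : p k n s ≤ 1 := by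
        rw [← hp2 k n]
        exact Finset.single_le_sum (fun s _ => hp1' k n s) (Finset.mem_univ s)
      rw [abs_of_nonneg (hp1' k n s)]
      have := hε k
      nlinarith [hp1' k n s]⟩
  have hval : ∀ q, ((datumHom w q : polyBounded he0 he1) : UPow 𝒰 ℝ) =
      UPow.ofFun 𝒰 ℝ fun k => datumHom (v k) q := by
    intro q
    have h1 := map_datumHom (polyBounded he0 he1).subtype w q
    have h2 := map_datumHom (UPow.ofFun 𝒰 ℝ) (fun i k => v k i) q
    have h3 : (datumHom (fun i k => v k i) q : ℕ → ℝ) = fun k => datumHom (v k) q :=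
      funext fun k => map_datumHom (Pi.evalRingHom (fun _ => ℝ) k) (fun i k => v k i) q
    rw [h3] at h2
    rw [h2]
    exact h1
  have hsign : ∀ q ∈ 𝒬, ∀ᶠ k in 𝒰, SignType.sign ((π.comp (datumHom w)) q) =
      SignType.sign (datumHom (v k) q) := by
    intro q hq1
    rcases lt_trichotomy ((datumHom w q : polyBounded he0 he1) : UPow 𝒰 ℝ) 0 with h | h | h
    · rw [← neg_pos, hval, ← map_neg, UPow.ofFun_pos] at h
      have h1 : 0 < π (-datumHom w q) := hπ1 _ (by
        rw [NegMemClass.coe_neg, hval, ← map_neg, UPow.ofFun_le]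
        filter_upwards [h] with k hk
        have hk : 0 < -datumHom (v k) q := hk
        have := hq k q hq1 (by linarith)
        rwa [abs_of_neg (by linarith)] at this)
      rw [map_neg, neg_pos] at h1
      filter_upwards [h] with k hk
      have hk : 0 < -datumHom (v k) q := hk
      rw [RingHom.comp_apply, sign_neg h1, sign_neg (by linarith)]
    · have h1 : datumHom w q = 0 := Subtype.ext h
      rw [hval, ← map_zero (UPow.ofFun 𝒰 ℝ), UPow.ofFun_eq] at h
      filter_upwards [h] with k hk
      have hk : datumHom (v k) q = 0 := hk
      rw [RingHom.comp_apply, h1, hk, map_zero, sign_zero, sign_zero]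
    · rw [hval, UPow.ofFun_pos] at h
      have h1 : 0 < π (datumHom w q) := hπ1 _ (by
        rw [hval, UPow.ofFun_le]
        filter_upwards [h] with k hk
        have := hq k q hq1 hk.ne'
        rwa [abs_of_pos hk] at this)
      filter_upwards [h] with k hk
      rw [RingHom.comp_apply, sign_pos h1, sign_pos hk]
  have hsol : Sol (fun n p => (π.comp (datumHom w)) (g n p))
      (fun n s => (π.comp (datumHom w)) (sg n s)) ((π.comp (datumHom w)) dl)
      (fun n s => π (pw n s)) := by
    refine ⟨fun n s => ?_, fun n => ?_, fun n s => ?_, fun n s => ?_, fun n s => ?_⟩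
    · refine hπ2 _ (ℓ + 1) ?_
      rw [← map_pow, UPow.ofFun_le]
      exact Filter.Eventually.of_forall fun k => hp1 k n s
    · rw [← map_sum, ← map_one π]
      congr 1
      refine Subtype.ext ?_
      rw [AddSubmonoidClass.coe_finsetSum, OneMemClass.coe_one, ← map_one (UPow.ofFun 𝒰 ℝ)]
      simp only [pw]
      rw [← map_sum, UPow.ofFun_eq]
      refine Filter.Eventually.of_forall fun k => ?_
      rw [Finset.sum_apply, hp2]
      rfl
    · rw [RingHom.comp_apply, RingHom.comp_apply, ← map_sub, ← map_add]
      refine hπ1 _ ?_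
      rw [AddMemClass.coe_add, AddSubgroupClass.coe_sub, hval, hval, ← map_sub, ← map_add,
        UPow.ofFun_le]
      exact Filter.Eventually.of_forall fun k => hp3 k n s
    · rw [RingHom.comp_apply, RingHom.comp_apply, ← map_sub, ← map_add]
      refine hπ1 _ ?_
      rw [AddMemClass.coe_add, AddSubgroupClass.coe_sub, hval, hval, ← map_sub, ← map_add,
        UPow.ofFun_le]
      exact Filter.Eventually.of_forall fun k => hp4 k n s
    · have h1 := map_gain π (fun n p => datumHom w (g n p)) (fun n s => datumHom w (sg n s)) pw n s
      simp only [RingHom.comp_apply]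
      rw [← h1]
      refine hπ3 _ fun m => ?_
      have h2 := map_gain (polyBounded he0 he1).subtype (fun n p => datumHom w (g n p))
        (fun n s => datumHom w (sg n s)) pw n s
      have h3 := map_gain (UPow.ofFun 𝒰 ℝ) (fun n p k => datumHom (v k) (g n p))
        (fun n s k => datumHom (v k) (sg n s)) (fun n s k => p k n s) n s
      change ((gain _ _ _ n s : polyBounded he0 he1) : UPow 𝒰 ℝ) = gain
        (fun n p => ((datumHom w (g n p) : polyBounded he0 he1) : UPow 𝒰 ℝ))
        (fun n s => ((datumHom w (sg n s) : polyBounded he0 he1) : UPow 𝒰 ℝ)) _ n s at h2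
      simp only [hval] at h2
      rw [h2]
      refine le_of_le_of_eq ?_ h3
      rw [← map_pow, ← map_neg, UPow.ofFun_le]
      filter_upwards [hcof m] with k hk
      have h4 := map_gain (Pi.evalRingHom (fun _ => ℝ) k) (fun n p k => datumHom (v k) (g n p))
        (fun n s k => datumHom (v k) (sg n s)) (fun n s k => p k n s) n s
      refine le_of_le_of_eq ?_ h4.symm
      refine le_trans ?_ (hp5 k n s)
      refine neg_le_neg (pow_le_pow_of_le_one (hε k).1.le ((hε k).2.trans (by norm_num)) ?_)
      omega
  obtain ⟨k, hk⟩ := ((Filter.eventually_all_finset 𝒬).2 hsign).exists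
  exact hp6 k (h𝒬 hκ polyIVT_real (π.comp (datumHom w)) (datumHom (v k)) hk _ hsol)

end SufficientOrder
section AlgebraicElements

open Polynomial

variable {F : Type} [Field F] (R : Type) [CommRing R] [IsDomain R] [Algebra R F]

/-- The subfield of elements algebraic over `R`. -/
def algebraicSubfield : Subfield F where
  toSubring := (Subalgebra.algebraicClosure R F).toSubring
  inv_mem' := fun _ hx => IsAlgebraic.inv (K := F) hx

theorem mem_algebraicSubfield {x : F} : x ∈ algebraicSubfield R ↔ IsAlgebraic R x := Iff.rfl

theorem algebraicSubfield_root (p : (algebraicSubfield R : Subfield F)[X]) (c : F) (hp : p ≠ 0)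
    (hc : (p.map (algebraicSubfield R : Subfield F).subtype).eval c = 0) :
    c ∈ (algebraicSubfield R : Subfield F) := by
  let j : (algebraicSubfield R : Subfield F) →+* Subalgebra.algebraicClosure R F :=
    { toFun := fun x => ⟨x.1, x.2⟩
      map_one' := rfl
      map_zero' := rfl
      map_add' := fun _ _ => rfl
      map_mul' := fun _ _ => rfl }
  have hj : Function.Injective j := fun x y h =>
    Subtype.ext (congrArg (fun z : Subalgebra.algebraicClosure R F => (z : F)) h)
  have h1 : IsAlgebraic (Subalgebra.algebraicClosure R F) c := by
    refine ⟨p.map j, fun h => hp (map_injective j hj (by rw [h, Polynomial.map_zero])), ?_⟩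
    rw [aeval_def, eval₂_map]
    rw [eval_map] at hc
    exact hc
  exact (mem_algebraicSubfield R).2 (h1.restrictScalars R)

end AlgebraicElements

section AlgSol

set_option linter.unusedSectionVars false

open Polynomial

variable {N : ℕ} {X : Fin N → Type} [∀ n, Fintype (X n)] [∀ n, DecidableEq (X n)]

/-- There are solutions for arbitrarily small tolerances whose coordinates are algebraic of degree
at most `D` in the tolerance. -/
def AlgSol {R : Type} [CommRing R] [LinearOrder R] (D : ℕ) (G : Fin N → (∀ m, X m) → R)
    (σ : ∀ n, X n → R) : Prop :=
  ∃ q : ∀ n, X n → ℕ → ℕ → R, (∀ n s, ∃ i ≤ D, ∃ j ≤ D, q n s i j ≠ 0) ∧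
    ∀ δ₀ > 0, ∃ δ τ, (0 < δ ∧ δ < δ₀) ∧ Sol G σ δ τ ∧ ∀ n s,
      ∑ i ∈ Finset.range (D + 1), ∑ j ∈ Finset.range (D + 1), q n s i j * δ ^ i * τ n s ^ j = 0

theorem AlgSol.mono {R : Type} [CommRing R] [LinearOrder R] {D D' : ℕ} (hD : D ≤ D')
    {G : Fin N → (∀ m, X m) → R} {σ : ∀ n, X n → R} (h : AlgSol D G σ) : AlgSol D' G σ := by
  obtain ⟨q, h1, h2⟩ := h
  obtain ⟨r, hr1, hr2⟩ : ∃ r : ∀ n, X n → ℕ → ℕ → R,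
      (∀ n s i j, i ≤ D → j ≤ D → r n s i j = q n s i j) ∧
      ∀ n s i j, ¬(i ≤ D ∧ j ≤ D) → r n s i j = 0 :=
    ⟨fun n s i j => if i ≤ D ∧ j ≤ D then q n s i j else 0,
      fun _ _ _ _ hi hj => if_pos ⟨hi, hj⟩, fun _ _ _ _ h => if_neg h⟩
  refine ⟨r, fun n s => ?_, fun δ₀ hδ₀ => ?_⟩
  · obtain ⟨i, hi, j, hj, h3⟩ := h1 n s
    exact ⟨i, hi.trans hD, j, hj.trans hD, by rwa [hr1 _ _ _ _ hi hj]⟩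
  · obtain ⟨δ, τ, h3, h4, h5⟩ := h2 δ₀ hδ₀
    refine ⟨δ, τ, h3, h4, fun n s => Eq.trans ?_ (h5 n s)⟩
    have hsub : Finset.range (D + 1) ⊆ Finset.range (D' + 1) :=
      Finset.range_subset_range.2 (by omega)
    rw [← Finset.sum_subset hsub]
    · refine Finset.sum_congr rfl fun i hi => ?_
      rw [← Finset.sum_subset hsub]
      · refine Finset.sum_congr rfl fun j hj => ?_
        rw [hr1 _ _ _ _ (Nat.lt_succ_iff.1 (Finset.mem_range.1 hi))
          (Nat.lt_succ_iff.1 (Finset.mem_range.1 hj))]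
      · intro j _ hj
        rw [hr2 _ _ _ _ fun h => hj (Finset.mem_range.2 (Nat.lt_succ_iff.2 h.2)), zero_mul,
          zero_mul]
    · intro i _ hi
      refine Finset.sum_eq_zero fun j _ => ?_
      rw [hr2 _ _ _ _ fun h => hi (Finset.mem_range.2 (Nat.lt_succ_iff.2 h.1)), zero_mul, zero_mul]

theorem exists_algSol {R : Type} [Field R] [LinearOrder R] [IsStrictOrderedRing R]
    (hR : PolyIVT R) (G : Fin N → (∀ m, X m) → R) (σ : ∀ n, X n → R)
    (h : ∀ δ > 0, ∃ τ, Sol G σ δ τ) : ∃ D, AlgSol D G σ := by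
  classical
  let 𝒲 : Ultrafilter R := Ultrafilter.of Filter.atTop
  have hge : ∀ x : R, ∀ᶠ y in 𝒲, x < y := fun x =>
    Ultrafilter.of_le Filter.atTop (Filter.eventually_gt_atTop x)
  have h' : ∀ δ : R, ∃ τ : ∀ n, X n → R, 0 < δ → Sol G σ δ τ := fun δ => by
    by_cases hδ : 0 < δ
    · exact (h δ hδ).imp fun τ hτ _ => hτ
    · exact ⟨0, fun h => absurd h hδ⟩
  choose f hf using h'
  let F' := UPow 𝒲 R
  let t : F' := UPow.ofFun 𝒲 R fun x => x⁻¹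
  let c : R →+* F' := (UPow.ofFun 𝒲 R).comp (Pi.constRingHom R R)
  let A : R[X] →+* F' := eval₂RingHom c t
  have hA : ∀ P : R[X], A P = UPow.ofFun 𝒲 R fun x => P.eval x⁻¹ := by
    intro P
    have h1 : A = (UPow.ofFun 𝒲 R).comp (RingHom.pi fun x => evalRingHom x⁻¹) := by
      refine Polynomial.ringHom_ext (fun a => ?_) ?_
      · simp only [A, c, coe_eval₂RingHom, eval₂_C, RingHom.comp_apply]
        congr 1
        funext x
        exact eval_C.symm
      · simp only [A, t, coe_eval₂RingHom, eval₂_X, RingHom.comp_apply]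
        congr 1
        funext x
        exact eval_X.symm
    rw [h1]
    rfl
  have hAinj : Function.Injective A := by
    rw [injective_iff_map_eq_zero]
    intro P hP
    by_contra hne
    rw [hA, ← map_zero (UPow.ofFun 𝒲 R), UPow.ofFun_eq] at hP
    obtain ⟨b, hb⟩ := P.roots.toFinset.image (fun x => x⁻¹) |>.bddAbove
    obtain ⟨x, hx1, hx2⟩ := (hP.and (hge b)).exists
    refine absurd (hb (Finset.mem_coe.2 (Finset.mem_image.2 ⟨x⁻¹, ?_, inv_inv x⟩))) (not_le.2 hx2)
    rw [Multiset.mem_toFinset, mem_roots hne]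
    exact hx1
  let : Algebra R[X] F' := A.toAlgebra
  let k : Subfield F' := algebraicSubfield R[X]
  have hk : PolyIVT k := hR.uPow.subfield k (algebraicSubfield_root R[X])
  have hck : ∀ a, c a ∈ k := fun a => by
    have := isAlgebraic_algebraMap (R := R[X]) (A := F') (C a)
    have e : algebraMap R[X] F' (C a) = c a := eval₂_C c t
    rwa [e] at this
  have htk : t ∈ k := by
    have := isAlgebraic_algebraMap (R := R[X]) (A := F') (Polynomial.X : R[X])
    have e : algebraMap R[X] F' (Polynomial.X : R[X]) = t := eval₂_X c t
    rwa [e] at this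
  obtain ⟨𝒬, h𝒬⟩ := exists_sol_transfer (A := k) (fun n p => (⟨c (G n p), hck _⟩ : k))
    (fun n s => ⟨c (σ n s), hck _⟩) ⟨t, htk⟩
  have hS : Sol (fun n p => k.subtype ⟨c (G n p), hck _⟩) (fun n s => k.subtype ⟨c (σ n s), hck _⟩)
      (k.subtype ⟨t, htk⟩) (fun n s => UPow.ofFun 𝒲 R fun x => f x⁻¹ n s) := by
    refine (sol_uPow (𝒰 := 𝒲) (fun n p _ => G n p) (fun n s _ => σ n s)
      (fun n s x => f x⁻¹ n s) fun x => x⁻¹).2 ?_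
    filter_upwards [hge 0] with x hx using hf _ (inv_pos.2 hx)
  have hsg : ∀ q ∈ 𝒬, SignType.sign (k.subtype q) = SignType.sign (RingHom.id k q) := fun q _ => rfl
  obtain ⟨τ, hτ⟩ := h𝒬 hR.uPow hk k.subtype (RingHom.id k) hsg _ hS
  choose ρ hρ using fun n s => UPow.ofFun_surjective (𝒰 := 𝒲) (R := R) ((τ n s : k) : F')
  have hS2 : ∀ᶠ x in 𝒲, Sol G σ x⁻¹ fun n s => ρ n s x := by
    refine (sol_uPow (𝒰 := 𝒲) (fun n p _ => G n p) (fun n s _ => σ n s) ρ fun x => x⁻¹).1 ?_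
    simp only [hρ]
    refine ⟨fun n s => hτ.pos n s, fun n => ?_, fun n s => hτ.lower n s, fun n s => hτ.upper n s,
      fun n s => ?_⟩
    · have := congrArg k.subtype (hτ.sum_eq n)
      rwa [map_sum] at this
    · have h1 := map_gain k.subtype (fun n p => (⟨c (G n p), hck _⟩ : k))
        (fun n s => ⟨c (σ n s), hck _⟩) τ n s
      exact le_of_le_of_eq (show (0 : F') ≤ ((gain _ _ τ n s : k) : F') from hτ.gain_nonneg n s) h1
  choose P hP0 hP using fun n s => (show IsAlgebraic R[X] ((τ n s : k) : F') from (τ n s).2)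
  obtain ⟨D, hD⟩ : ∃ D : ℕ, ∀ n s, (P n s).natDegree ≤ D ∧
      ∀ j, ((P n s).coeff j).natDegree ≤ D := by
    refine ⟨Finset.univ.sup fun q : Σ n, X n => max (P q.1 q.2).natDegree
      ((Finset.range ((P q.1 q.2).natDegree + 1)).sup fun j => ((P q.1 q.2).coeff j).natDegree),
      fun n s => ?_⟩
    have h1 := Finset.le_sup (f := fun q : Σ n, X n => max (P q.1 q.2).natDegree
      ((Finset.range ((P q.1 q.2).natDegree + 1)).sup fun j => ((P q.1 q.2).coeff j).natDegree))
      (Finset.mem_univ ⟨n, s⟩)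
    refine ⟨(le_max_left _ _).trans h1, fun j => ?_⟩
    by_cases hj : j ≤ (P n s).natDegree
    · exact ((Finset.le_sup (f := fun j => ((P n s).coeff j).natDegree)
        (Finset.mem_range.2 (Nat.lt_succ_iff.2 hj))).trans (le_max_right _ _)).trans h1
    · rw [coeff_eq_zero_of_natDegree_lt (not_le.1 hj), natDegree_zero]
      exact Nat.zero_le _
  have hvan : ∀ n s, ∀ᶠ x in 𝒲, ∑ i ∈ Finset.range (D + 1), ∑ j ∈ Finset.range (D + 1),
      ((P n s).coeff j).coeff i * (x⁻¹) ^ i * ρ n s x ^ j = 0 := by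
    intro n s
    have h1 := hP n s
    rw [aeval_def, eval₂_eq_sum_range' _ (Nat.lt_succ_iff.2 (hD n s).1)] at h1
    have h2 : ∑ j ∈ Finset.range (D + 1), A ((P n s).coeff j) * ((τ n s : k) : F') ^ j = 0 := h1
    simp only [hA, ← hρ, ← map_pow, ← map_mul, ← map_sum] at h2
    rw [← map_zero (UPow.ofFun 𝒲 R), UPow.ofFun_eq] at h2
    filter_upwards [h2] with x hx
    rw [Finset.sum_comm]
    rw [Finset.sum_apply] at hx
    refine Eq.trans (Finset.sum_congr rfl fun j _ => ?_) hx
    rw [Pi.mul_apply, Pi.pow_apply, eval_eq_sum_range' (Nat.lt_succ_iff.2 ((hD n s).2 j)),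
      Finset.sum_mul]
  refine ⟨D, fun n s i j => ((P n s).coeff j).coeff i, fun n s => ?_, fun δ₀ hδ₀ => ?_⟩
  · have h1 : (P n s).leadingCoeff ≠ 0 := leadingCoeff_ne_zero.2 (hP0 n s)
    exact ⟨_, (hD n s).2 (P n s).natDegree, _, (hD n s).1, leadingCoeff_ne_zero.2 h1⟩
  · have hvan' : ∀ᶠ x in 𝒲, ∀ n s, ∑ i ∈ Finset.range (D + 1), ∑ j ∈ Finset.range (D + 1),
        ((P n s).coeff j).coeff i * (x⁻¹) ^ i * ρ n s x ^ j = 0 :=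
      Filter.eventually_all.2 fun n => Filter.eventually_all.2 fun s => hvan n s
    obtain ⟨x, h1, h2, h3, h4⟩ := (hvan'.and (hS2.and ((hge 0).and (hge δ₀⁻¹)))).exists
    exact ⟨x⁻¹, fun n s => ρ n s x, ⟨inv_pos.2 h3, inv_lt_of_inv_lt₀ hδ₀ h4⟩, h2, h1⟩

theorem exists_uniform_algSol (X : Fin N → Type) [∀ n, Fintype (X n)] [∀ n, DecidableEq (X n)] :
    ∃ D, ∀ (G : Fin N → (∀ m, X m) → ℝ) (σ : Profile X), (∀ δ > 0, ∃ τ, Sol G σ δ τ) →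
      AlgSol D G σ := by
  by_contra hcon
  push Not at hcon
  choose G σ h1 h2 using hcon
  have h1' : ∀ k : ℕ, ∀ δ : ℝ, ∃ τ : ∀ n, X n → ℝ, 0 < δ → Sol (G k) (σ k) δ τ := fun k δ => by
    by_cases hδ : 0 < δ
    · exact (h1 k δ hδ).imp fun τ hτ _ => hτ
    · exact ⟨0, fun h => absurd h hδ⟩
  choose f hf using h1'
  let 𝒰 : Ultrafilter ℕ := Filter.hyperfilter ℕ
  have hcof : ∀ m : ℕ, ∀ᶠ k in 𝒰, m ≤ k := fun m =>
    Filter.hyperfilter_le_cofinite (Nat.cofinite_eq_atTop ▸ Filter.eventually_ge_atTop m)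
  obtain ⟨D, q, hq, h3⟩ := exists_algSol (polyIVT_real.uPow (𝒰 := 𝒰))
    (fun n p => UPow.ofFun 𝒰 ℝ fun k => G k n p) (fun n s => UPow.ofFun 𝒰 ℝ fun k => σ k n s) (by
      intro δ hδ
      obtain ⟨δ, rfl⟩ := UPow.ofFun_surjective δ
      rw [gt_iff_lt, UPow.ofFun_pos] at hδ
      refine ⟨fun n s => UPow.ofFun 𝒰 ℝ fun k => f k (δ k) n s, (sol_uPow _ _ _ _).2 ?_⟩
      filter_upwards [hδ] with k hk using hf k (δ k) hk)
  choose r hr using fun n s i j => UPow.ofFun_surjective (q n s i j)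
  have hr0 : ∀ᶠ k in 𝒰, ∀ n s, ∃ i ≤ D, ∃ j ≤ D, r n s i j k ≠ 0 := by
    rw [Filter.eventually_all]; intro n
    rw [Filter.eventually_all]; intro s
    obtain ⟨i, hi, j, hj, h4⟩ := hq n s
    rw [← hr, ← map_zero (UPow.ofFun 𝒰 ℝ), Ne, UPow.ofFun_eq, ← Ultrafilter.eventually_not] at h4
    filter_upwards [h4] with k hk using ⟨i, hi, j, hj, hk⟩
  have hbad : ∀ k, ∃ δ₀ : ℝ, 0 < δ₀ ∧ (D ≤ k → (∀ n s, ∃ i ≤ D, ∃ j ≤ D, r n s i j k ≠ 0) →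
      ∀ δ τ, (0 < δ ∧ δ < δ₀) → Sol (G k) (σ k) δ τ → ¬∀ n s, ∑ i ∈ Finset.range (D + 1),
        ∑ j ∈ Finset.range (D + 1), r n s i j k * δ ^ i * τ n s ^ j = 0) := by
    intro k
    by_cases h4 : D ≤ k ∧ ∀ n s, ∃ i ≤ D, ∃ j ≤ D, r n s i j k ≠ 0
    · by_contra h5
      push Not at h5
      refine h2 k (AlgSol.mono h4.1 ⟨fun n s i j => r n s i j k, h4.2, fun δ₀ hδ₀ => ?_⟩)
      obtain ⟨-, -, δ, τ, h6, h7, h8⟩ := h5 δ₀ hδ₀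
      exact ⟨δ, τ, h6, h7, h8⟩
    · exact ⟨1, one_pos, fun h5 h6 => absurd ⟨h5, h6⟩ h4⟩
  choose δ₀ hδ₀ hbad using hbad
  obtain ⟨δ, τ, ⟨h4, h5⟩, h6, h7⟩ := h3 (UPow.ofFun 𝒰 ℝ δ₀)
    (UPow.ofFun_pos.2 (Filter.Eventually.of_forall hδ₀))
  obtain ⟨δ, rfl⟩ := UPow.ofFun_surjective δ
  choose ρ hρ using fun n s => UPow.ofFun_surjective (τ n s)
  obtain rfl : (fun n s => UPow.ofFun 𝒰 ℝ (ρ n s)) = τ := by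
    funext n s; exact hρ n s
  rw [UPow.ofFun_pos] at h4
  rw [UPow.ofFun_lt] at h5
  have h6 := (sol_uPow _ _ _ _).1 h6
  have h7 : ∀ᶠ k in 𝒰, ∀ n s, ∑ i ∈ Finset.range (D + 1),
        ∑ j ∈ Finset.range (D + 1), r n s i j k * δ k ^ i * ρ n s k ^ j = 0 := by
    rw [Filter.eventually_all]; intro n
    rw [Filter.eventually_all]; intro s
    have h8 := h7 n s
    simp only [← hr, ← map_pow, ← map_mul, ← map_sum] at h8
    rw [← map_zero (UPow.ofFun 𝒰 ℝ), UPow.ofFun_eq] at h8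
    filter_upwards [h8] with k hk
    simpa only [Finset.sum_apply, Pi.mul_apply, Pi.pow_apply, Pi.zero_apply] using hk
  obtain ⟨k, ⟨h8, h9⟩, h10, h11, h12, h13⟩ :=
    ((h4.and h5).and (h6.and (h7.and (hr0.and (hcof D))))).exists
  exact hbad k h13 h12 (δ k) _ ⟨h8, h9⟩ h10 h11

end AlgSol
section ArchimedeanOrder

set_option linter.unusedSectionVars false

open Polynomial ArchimedeanClass

variable {F : Type} [Field F] [LinearOrder F] [IsStrictOrderedRing F]

theorem mk_pow_lt_mk_pow {x y : F} {n : ℕ} (hn : n ≠ 0) (h : mk x < mk y) :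
    mk (x ^ n) < mk (y ^ n) := by
  rw [mk_lt_mk] at h ⊢
  intro k
  have h1 := pow_lt_pow_left₀ (h (k + 1)) (by positivity) hn
  rw [abs_pow, abs_pow]
  refine lt_of_le_of_lt ?_ h1
  rw [nsmul_eq_mul, nsmul_eq_mul, mul_pow]
  refine mul_le_mul_of_nonneg_right ?_ (by positivity)
  have h2 : (1 : F) ≤ ((k + 1 : ℕ) : F) := by exact_mod_cast Nat.succ_le_succ (Nat.zero_le k)
  exact (Nat.cast_le.2 (Nat.le_succ k)).trans (le_self_pow₀ h2 hn)

theorem mk_eq_mk_of_pow {x y : F} {n : ℕ} (hn : n ≠ 0) (h : mk (x ^ n) = mk (y ^ n)) :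
    mk x = mk y := by
  rcases lt_trichotomy (mk x) (mk y) with h1 | h1 | h1
  · exact absurd h (mk_pow_lt_mk_pow hn h1).ne
  · exact h1
  · exact absurd h (mk_pow_lt_mk_pow hn h1).ne'

theorem mk_mul_congr {a a' b b' : F} (h : mk a = mk a') (h' : mk b = mk b') :
    mk (a * b) = mk (a' * b') := by
  rw [mk_mul, mk_mul, h, h']

theorem mk_lt_mk_mul {x t : F} (hx : x ≠ 0) (ht : 0 < mk t) : mk x < mk (x * t) := by
  rw [← mk_one, mk_lt_mk] at ht
  rw [mk_lt_mk]
  intro n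
  have h1 := mul_lt_mul_of_pos_left (ht n) (abs_pos.2 hx)
  rwa [abs_one, mul_one, mul_smul_comm, ← abs_mul] at h1

theorem mk_zpow_strictMono {t : F} (h0 : t ≠ 0) (ht : 0 < mk t) :
    StrictMono fun w : ℤ => mk (t ^ w) := by
  refine strictMono_int_of_lt_succ fun w => ?_
  rw [zpow_add_one₀ h0]
  exact mk_lt_mk_mul (zpow_ne_zero w h0) ht

theorem exists_mk_eq_of_sum_eq_zero (s : Finset ℕ) (f : ℕ → F) (hs : ∑ j ∈ s, f j = 0)
    (hne : ∃ j ∈ s, f j ≠ 0) : ∃ i ∈ s, ∃ j ∈ s, i < j ∧ f i ≠ 0 ∧ f j ≠ 0 ∧ mk (f i) = mk (f j) := by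
  classical
  by_contra hcon
  push Not at hcon
  obtain ⟨j₀, hj₀, hmin⟩ := Finset.exists_min_image (s.filter fun j => f j ≠ 0) (fun j => mk (f j))
    (by obtain ⟨j, hj, h⟩ := hne; exact ⟨j, Finset.mem_filter.2 ⟨hj, h⟩⟩)
  rw [Finset.mem_filter] at hj₀
  have h1 : mk (f j₀) < mk (∑ j ∈ s.erase j₀, f j) := by
    refine (addValuation F).map_lt_sum (fun h => hj₀.2 (mk_eq_top_iff.1 h)) fun j hj => ?_
    have hjs := Finset.mem_of_mem_erase hj
    change mk (f j₀) < mk (f j)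
    by_cases h2 : f j = 0
    · rw [h2, mk_zero]
      exact lt_top_iff_ne_top.2 fun h => hj₀.2 (mk_eq_top_iff.1 h)
    · refine lt_of_le_of_ne (hmin j (Finset.mem_filter.2 ⟨hjs, h2⟩)) ?_
      rcases lt_or_gt_of_ne (Finset.ne_of_mem_erase hj) with h3 | h3
      · exact (hcon j hjs j₀ hj₀.1 h3 h2 hj₀.2).symm
      · exact hcon j₀ hj₀.1 j hjs h3 hj₀.2 h2
  have h2 := mk_add_eq_mk_left h1
  rw [Finset.add_sum_erase _ _ hj₀.1, hs, mk_zero] at h2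
  exact hj₀.2 (mk_eq_top_iff.1 h2.symm)

variable (F) in
/-- The subring of finite elements of an ordered field. -/
def finiteSubring : Subring F where
  carrier := {x | 0 ≤ mk x}
  mul_mem' := fun ha hb => by
    rw [Set.mem_ofPred_eq] at ha hb ⊢
    rw [mk_mul]
    exact add_nonneg ha hb
  one_mem' := mk_one.ge
  add_mem' := fun ha hb => by
    rw [Set.mem_ofPred_eq] at ha hb ⊢
    exact (le_min ha hb).trans (min_le_mk_add _ _)
  zero_mem' := by rw [Set.mem_ofPred_eq, mk_zero]; exact le_top
  neg_mem' := fun ha => by rwa [Set.mem_ofPred_eq, mk_neg]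

theorem mem_finiteSubring {x : F} : x ∈ finiteSubring F ↔ 0 ≤ mk x := by
  rw [finiteSubring, Subring.mem_mk, Subsemiring.mem_mk, Submonoid.mem_mk, Subsemigroup.mem_mk,
    Set.mem_ofPred_eq]

theorem eval₂_mem_finiteSubring (f : ℝ →+*o F) {t : F} (ht : 0 ≤ mk t) (P : ℝ[X]) :
    P.eval₂ (f : ℝ →+* F) t ∈ finiteSubring F := by
  rw [eval₂_eq_sum_range]
  exact sum_mem fun i _ => mul_mem (mem_finiteSubring.2 (mk_map_nonneg_of_archimedean f _))
    (pow_mem (mem_finiteSubring.2 ht) i)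

theorem exists_mk_eval₂ (f : ℝ →+*o F) {t : F} (ht : 0 < mk t) (D : ℕ) (P : ℝ[X]) (hP : P ≠ 0)
    (hD : P.natDegree ≤ D) : ∃ m ≤ D, mk (P.eval₂ (f : ℝ →+* F) t) = mk (t ^ m) := by
  have key : ∀ P : ℝ[X], P.coeff 0 ≠ 0 → mk (P.eval₂ (f : ℝ →+* F) t) = mk (t ^ 0) := by
    intro P hP
    have h0 : mk (f (P.coeff 0)) = 0 := mk_map_of_archimedean' f hP
    have h1 : 0 < mk (P.divX.eval₂ (f : ℝ →+* F) t * t) := by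
      rw [mk_mul]
      exact ht.trans_le (le_add_of_nonneg_left
        (mem_finiteSubring.1 (eval₂_mem_finiteSubring f ht.le _)))
    rw [pow_zero, mk_one]
    conv_lhs => rw [← divX_mul_X_add P, eval₂_add, eval₂_mul, eval₂_X, eval₂_C]
    exact (mk_add_eq_mk_right (h0.trans_lt h1)).trans h0
  induction D generalizing P with
  | zero =>
    refine ⟨0, le_rfl, key P fun h => hP ?_⟩
    rw [eq_C_of_natDegree_le_zero hD, h, C_0]
  | succ D ih =>
    by_cases h0 : P.coeff 0 = 0
    · have h1 := divX_mul_X_add P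
      rw [h0, C_0, add_zero] at h1
      obtain ⟨m, hm, h2⟩ := ih P.divX (fun h => hP (by rw [← h1, h, zero_mul]))
        (by rw [natDegree_divX_eq_natDegree_tsub_one]; omega)
      refine ⟨m + 1, by omega, ?_⟩
      rw [← h1, eval₂_mul, eval₂_X, pow_succ]
      exact mk_mul_congr h2 rfl
    · exact ⟨0, Nat.zero_le _, key P h0⟩

/-- If `c₀ xⁱ` and `c₁ xʲ` have the same order and so do the `c`'s and powers of `t`, then the
order of a power of `x` is that of a power of `t`. -/
theorem mk_pow_sub {x t c₀ c₁ : F} {i j : ℕ} {a b : ℤ} (hx : x ≠ 0) (ht : t ≠ 0) (hij : i ≤ j)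
    (h : mk (c₀ * x ^ i) = mk (c₁ * x ^ j)) (h₀ : mk c₀ = mk (t ^ a)) (h₁ : mk c₁ = mk (t ^ b)) :
    mk (x ^ (j - i)) = mk (t ^ (a - b)) := by
  have h2 : mk (t ^ a * x ^ i) = mk (t ^ b * x ^ j) :=
    ((mk_mul_congr h₀ rfl).symm.trans h).trans (mk_mul_congr h₁ rfl)
  have h3 := mk_mul_congr h2 (rfl : mk ((t ^ b * x ^ i)⁻¹) = mk ((t ^ b * x ^ i)⁻¹))
  have hti := zpow_ne_zero b ht
  have hxi := pow_ne_zero i hx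
  have e1 : t ^ a * x ^ i * (t ^ b * x ^ i)⁻¹ = t ^ (a - b) := by
    rw [zpow_sub₀ ht]; field_simp
  have e2 : t ^ b * x ^ j * (t ^ b * x ^ i)⁻¹ = x ^ (j - i) := by
    rw [pow_sub₀ x hx hij]; field_simp
  rw [e1, e2] at h3
  exact h3.symm

theorem mk_le_mk_pow_of_algebraic (f : ℝ →+*o F) {t x : F} (h0 : t ≠ 0) (ht : 0 < mk t)
    (hx : 0 ≤ mk x) (hx0 : x ≠ 0) (D : ℕ) (P : ℕ → ℝ[X]) (hP : ∀ j, (P j).natDegree ≤ D)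
    (hne : ∃ j ∈ Finset.range (D + 1), P j ≠ 0)
    (h : ∑ j ∈ Finset.range (D + 1), (P j).eval₂ (f : ℝ →+* F) t * x ^ j = 0) :
    mk x ≤ mk (t ^ D) := by
  have hP0 : ∀ j, P j ≠ 0 → (P j).eval₂ (f : ℝ →+* F) t ≠ 0 := fun j hj h1 => by
    obtain ⟨m, -, hm⟩ := exists_mk_eval₂ f ht _ (P j) hj le_rfl
    rw [h1, mk_zero, eq_comm, mk_eq_top_iff] at hm
    exact pow_ne_zero m h0 hm
  obtain ⟨i, -, j, hj, hij, hi1, hj1, h1⟩ := exists_mk_eq_of_sum_eq_zero _ _ h (by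
    obtain ⟨j, hj, h1⟩ := hne
    exact ⟨j, hj, mul_ne_zero (hP0 j h1) (pow_ne_zero j hx0)⟩)
  have hc : ∀ l, (P l).eval₂ (f : ℝ →+* F) t * x ^ l ≠ 0 →
      ∃ m ≤ D, mk ((P l).eval₂ (f : ℝ →+* F) t) = mk (t ^ (m : ℤ)) := fun l hl => by
    simp only [zpow_natCast]
    refine exists_mk_eval₂ f ht D (P l) (fun h2 => hl ?_) (hP l)
    rw [h2, eval₂_zero, zero_mul]
  obtain ⟨a, ha, h2⟩ := hc i hi1
  obtain ⟨b, hb, h3⟩ := hc j hj1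
  have h4 := mk_pow_sub hx0 h0 hij.le h1 h2 h3
  have h5 : mk x ≤ mk (x ^ (j - i)) := by
    obtain ⟨k, hk⟩ : ∃ k, j - i = k + 1 := ⟨j - i - 1, by omega⟩
    rw [hk, pow_succ, mk_mul]
    exact le_add_of_nonneg_left (mem_finiteSubring.1 (pow_mem (mem_finiteSubring.2 hx) k))
  refine h5.trans (h4.le.trans ?_)
  rw [← zpow_natCast t D]
  exact (mk_zpow_strictMono h0 ht).monotone (by omega)

end ArchimedeanOrder
section Uniformizer

set_option linter.unusedSectionVars false

open Polynomial ArchimedeanClass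
open IntermediateField hiding mk

variable {F : Type} [Field F] [LinearOrder F] [IsStrictOrderedRing F]

theorem exists_generator (L : Subfield F) {t : F} (h0 : t ≠ 0) (ht : 0 < mk t) (htL : t ∈ L)
    {B : ℕ} (hB : B ≠ 0) (h : ∀ x ∈ L, x ≠ 0 → ∃ w : ℤ, mk (x ^ B) = mk (t ^ w)) :
    ∃ u ∈ L, 0 < u ∧ 0 < mk u ∧ (∃ e ≤ B, mk t = mk (u ^ e)) ∧
      ∀ x ∈ L, x ≠ 0 → ∃ q : ℤ, mk x = mk (u ^ q) := by
  have hmono := mk_zpow_strictMono h0 ht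
  let W : AddSubgroup ℤ :=
    { carrier := {w | ∃ x ∈ L, x ≠ 0 ∧ mk (x ^ B) = mk (t ^ w)}
      zero_mem' := by
        rw [Set.mem_ofPred_eq]
        exact ⟨1, one_mem L, one_ne_zero, by rw [one_pow, zpow_zero]⟩
      add_mem' := fun ha hb => by
        rw [Set.mem_ofPred_eq] at ha hb ⊢
        obtain ⟨x, hx, hx0, h1⟩ := ha
        obtain ⟨y, hy, hy0, h2⟩ := hb
        refine ⟨x * y, mul_mem hx hy, mul_ne_zero hx0 hy0, ?_⟩
        rw [mul_pow, zpow_add₀ h0]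
        exact mk_mul_congr h1 h2
      neg_mem' := fun ha => by
        rw [Set.mem_ofPred_eq] at ha ⊢
        obtain ⟨x, hx, hx0, h1⟩ := ha
        refine ⟨x⁻¹, inv_mem hx, inv_ne_zero hx0, ?_⟩
        rw [inv_pow, zpow_neg, mk_inv, mk_inv, h1] }
  have hW : ∀ w, w ∈ W ↔ ∃ x ∈ L, x ≠ 0 ∧ mk (x ^ B) = mk (t ^ w) := fun w => by
    rw [← AddSubgroup.mem_carrier]
    exact Iff.of_eq (Set.mem_ofPred_eq ..)
  obtain ⟨g, hg⟩ := Int.subgroup_cyclic W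
  have hmem : ∀ w, w ∈ W → ∃ q : ℤ, w = q * |g| := fun w hw => by
    rw [hg, AddSubgroup.mem_closure_singleton] at hw
    obtain ⟨n, rfl⟩ := hw
    rcases abs_choice g with h1 | h1
    · exact ⟨n, by rw [h1, smul_eq_mul]⟩
    · exact ⟨-n, by rw [h1, smul_eq_mul]; ring⟩
  have hgW : |g| ∈ W := by
    have h1 : g ∈ W := by rw [hg]; exact AddSubgroup.subset_closure (Set.mem_singleton g)
    rcases abs_choice g with h2 | h2
    · rwa [h2]
    · rw [h2]; exact neg_mem h1
  obtain ⟨e, he⟩ := hmem B ((hW B).2 ⟨t, htL, h0, by rw [zpow_natCast]⟩)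
  have hB' : (0 : ℤ) < B := by omega
  have hg0 : 0 < |g| := by
    refine lt_of_le_of_ne (abs_nonneg g) fun h1 => ?_
    rw [← h1, mul_zero] at he
    omega
  have he0 : 0 < e := by
    rw [he] at hB'
    exact pos_of_mul_pos_left hB' hg0.le
  obtain ⟨x, hxL, hx0, hx⟩ := (hW _).1 hgW
  have hgen : ∀ y ∈ L, y ≠ 0 → ∀ q : ℤ, mk (y ^ B) = mk (t ^ (q * |g|)) → mk y = mk (|x| ^ q) := by
    intro y _ _ q hq
    refine mk_eq_mk_of_pow hB (hq.trans ?_)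
    rw [mul_comm, zpow_mul, mk_zpow, ← hx, ← mk_zpow, ← zpow_natCast, ← zpow_natCast, zpow_comm,
      mk_zpow, mk_zpow, mk_zpow, mk_zpow, mk_abs]
  have ht' := hgen t htL h0 e (by rw [← he, zpow_natCast])
  lift e to ℕ using he0.le
  rw [zpow_natCast] at ht'
  refine ⟨|x|, ?_, abs_pos.2 hx0, ?_, ⟨e, ?_, ht'⟩, fun y hy hy0 => ?_⟩
  · rcases abs_choice x with h1 | h1
    · rwa [h1]
    · rw [h1]; exact neg_mem hxL
  · by_contra h1
    have hi : 0 ≤ mk |x|⁻¹ := by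
      rw [← mk_one, ← mul_inv_cancel₀ (abs_pos.2 hx0).ne', mk_mul]
      exact add_le_of_nonpos_left (not_lt.1 h1)
    have h2 := pow_mem (mem_finiteSubring.2 hi) e
    rw [mem_finiteSubring, inv_pow] at h2
    have h3 : mk (1 : F) < mk (1 : F) := by
      calc mk (1 : F) = 0 := mk_one
        _ ≤ mk (|x| ^ e)⁻¹ := h2
        _ < mk ((|x| ^ e)⁻¹ * t) := mk_lt_mk_mul (inv_ne_zero (pow_ne_zero e (abs_pos.2 hx0).ne')) ht
        _ = mk ((|x| ^ e)⁻¹ * |x| ^ e) := mk_mul_congr rfl ht'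
        _ = mk 1 := by rw [inv_mul_cancel₀ (pow_ne_zero e (abs_pos.2 hx0).ne')]
    exact lt_irrefl _ h3
  · have : (e : ℤ) ≤ B := by rw [he]; exact le_mul_of_one_le_right (by omega) (by omega)
    exact_mod_cast this
  · obtain ⟨w, hw⟩ := h y hy hy0
    obtain ⟨q, rfl⟩ := hmem w ((hW w).2 ⟨y, hy, hy0, hw⟩)
    exact ⟨q, hgen y hy hy0 q hw⟩

theorem finiteDimensional_adjoin_le {k : Type} [Field k] [Algebra k F] {ι : Type} [DecidableEq ι]
    (τ : ι → F) (D : ℕ) (h : ∀ i, ∃ p : k[X], p ≠ 0 ∧ p.natDegree ≤ D ∧ aeval (τ i) p = 0)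
    (s : Finset ι) :
    FiniteDimensional k (adjoin k (τ '' s)) ∧ Module.finrank k (adjoin k (τ '' s)) ≤ D ^ s.card := by
  induction s using Finset.induction_on with
  | empty =>
    rw [Finset.coe_empty, Set.image_empty, adjoin_empty, Finset.card_empty, pow_zero]
    exact ⟨inferInstance, IntermediateField.finrank_bot.le⟩
  | insert i s hi ih =>
    obtain ⟨p, hp, hpD, hp0⟩ := h i
    have hint : IsIntegral k (τ i) := IsAlgebraic.isIntegral ⟨p, hp, hp0⟩
    have h1 : FiniteDimensional k k⟮τ i⟯ := adjoin.finiteDimensional hint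
    have h2 := ih.1
    rw [Finset.coe_insert, Set.image_insert_eq, Set.insert_eq, adjoin_union,
      Finset.card_insert_of_notMem hi, pow_succ']
    refine ⟨inferInstance, (IntermediateField.finrank_sup_le _ _).trans (Nat.mul_le_mul ?_ ih.2)⟩
    rw [adjoin.finrank hint]
    exact (natDegree_le_natDegree (minpoly.degree_le_of_ne_zero k _ hp hp0)).trans hpD

theorem exists_mk_pow_eq {k : Type} [Field k] [Algebra k F] {t : F} (h0 : t ≠ 0)
    (hk : ∀ c : k, c ≠ 0 → ∃ w : ℤ, mk (algebraMap k F c) = mk (t ^ w))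
    {L : IntermediateField k F} [FiniteDimensional k L] {B : ℕ} (hB : Module.finrank k L ≤ B)
    (x : F) (hx : x ∈ L) (hx0 : x ≠ 0) : ∃ w : ℤ, mk (x ^ B.factorial) = mk (t ^ w) := by
  let p := minpoly k (⟨x, hx⟩ : L)
  have hpi : IsIntegral k (⟨x, hx⟩ : L) := IsIntegral.of_finite k _
  have hpd : p.natDegree ≤ B := (minpoly.natDegree_le _).trans hB
  have h3 : ∑ j ∈ Finset.range (p.natDegree + 1), algebraMap k F (p.coeff j) * x ^ j = 0 := by
    have h4 := congrArg (algebraMap L F) (minpoly.aeval k (⟨x, hx⟩ : L))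
    rw [aeval_eq_sum_range, map_sum, map_zero] at h4
    refine Eq.trans (Finset.sum_congr rfl fun j _ => ?_) h4
    rw [Algebra.smul_def, map_mul, map_pow, ← IsScalarTower.algebraMap_apply]
    rfl
  obtain ⟨i, -, j, hj, hij, hi0, hj0, h4⟩ := exists_mk_eq_of_sum_eq_zero _ _ h3
    ⟨p.natDegree, Finset.self_mem_range_succ _, mul_ne_zero (fun h => minpoly.ne_zero hpi
      (leadingCoeff_eq_zero.1 ((map_eq_zero _).1 h))) (pow_ne_zero _ hx0)⟩
  obtain ⟨a, ha⟩ := hk (p.coeff i) fun h => hi0 (by rw [h, map_zero, zero_mul])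
  obtain ⟨b, hb⟩ := hk (p.coeff j) fun h => hj0 (by rw [h, map_zero, zero_mul])
  have h5 := mk_pow_sub hx0 h0 hij.le h4 ha hb
  rw [Finset.mem_range] at hj
  obtain ⟨c, hc⟩ := Nat.dvd_factorial (show 0 < j - i by omega) (show j - i ≤ B by omega)
  refine ⟨(a - b) * c, ?_⟩
  rw [hc, pow_mul, zpow_mul, zpow_natCast, mk_pow, h5, mk_pow]

theorem exists_uniformizer (f : ℝ →+*o F) {t : F} (h0 : t ≠ 0) (ht : 0 < mk t) {ι : Type}
    [Fintype ι] [DecidableEq ι] (τ : ι → F) (D : ℕ) (P : ι → ℕ → ℝ[X])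
    (hne : ∀ i, ∃ j ∈ Finset.range (D + 1), P i j ≠ 0)
    (h : ∀ i, ∑ j ∈ Finset.range (D + 1), (P i j).eval₂ (f : ℝ →+* F) t * τ i ^ j = 0) :
    ∃ L : Subfield F, (∀ a, f a ∈ L) ∧ (∀ i, τ i ∈ L) ∧ ∃ u ∈ L, 0 < u ∧ 0 < mk u ∧
      (∃ e ≤ (D ^ Fintype.card ι).factorial, mk t = mk (u ^ e)) ∧
      ∀ x ∈ L, x ≠ 0 → ∃ q : ℤ, mk x = mk (u ^ q) := by
  let _ : Algebra ℝ F := (f : ℝ →+* F).toAlgebra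
  let k := ℝ⟮t⟯
  have hk : ∀ c : k, c ≠ 0 → ∃ w : ℤ, mk (c : F) = mk (t ^ w) := by
    intro c hc
    obtain ⟨r, s, hrs⟩ := (mem_adjoin_simple_iff ℝ (c : F)).1 c.2
    have hc' : (c : F) ≠ 0 := fun h => hc (Subtype.ext h)
    have hr : r ≠ 0 := fun h => hc' (by rw [hrs, h, map_zero, zero_div])
    have hs : s ≠ 0 := fun h => hc' (by rw [hrs, h, map_zero, div_zero])
    obtain ⟨a, -, ha⟩ := exists_mk_eval₂ f ht _ r hr le_rfl
    obtain ⟨b, -, hb⟩ := exists_mk_eval₂ f ht _ s hs le_rfl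
    refine ⟨a - b, ?_⟩
    rw [hrs, zpow_sub₀ h0, zpow_natCast, zpow_natCast, mk_div, mk_div, ← ha, ← hb]
    rfl
  have hP0 : ∀ Q : ℝ[X], Q ≠ 0 → Q.eval₂ (f : ℝ →+* F) t ≠ 0 := fun Q hQ h1 => by
    obtain ⟨m, -, hm⟩ := exists_mk_eval₂ f ht _ Q hQ le_rfl
    rw [h1, mk_zero, eq_comm, mk_eq_top_iff] at hm
    exact pow_ne_zero m h0 hm
  have halg : ∀ i, ∃ p : k[X], p ≠ 0 ∧ p.natDegree ≤ D ∧ aeval (τ i) p = 0 := by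
    intro i
    have hm : ∀ Q : ℝ[X], Q.eval₂ (f : ℝ →+* F) t ∈ k := fun Q =>
      (mem_adjoin_simple_iff ℝ _).2 ⟨Q, 1, by rw [map_one, div_one]; rfl⟩
    refine ⟨∑ j ∈ Finset.range (D + 1), C (⟨_, hm (P i j)⟩ : k) * Polynomial.X ^ j, fun h1 => ?_,
      ?_, ?_⟩
    · obtain ⟨j, hj, h2⟩ := hne i
      have h3 := congrArg (fun p => p.coeff j) h1
      simp only [finsetSum_coeff, coeff_C_mul_X_pow, coeff_zero] at h3
      rw [Finset.sum_ite_eq, if_pos hj] at h3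
      exact hP0 _ h2 (congrArg Subtype.val h3)
    · refine natDegree_sum_le_of_forall_le _ _ fun j hj => (natDegree_C_mul_X_pow_le _ _).trans ?_
      exact Nat.lt_succ_iff.1 (Finset.mem_range.1 hj)
    · rw [map_sum]
      refine Eq.trans (Finset.sum_congr rfl fun j _ => ?_) (h i)
      rw [map_mul, map_pow, aeval_X, aeval_C]
      rfl
  obtain ⟨h1, h2⟩ := finiteDimensional_adjoin_le τ D halg Finset.univ
  let L := adjoin k (τ '' ((Finset.univ : Finset ι) : Set ι))
  have hval : ∀ x ∈ L, x ≠ 0 →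
      ∃ w : ℤ, mk (x ^ (D ^ Fintype.card ι).factorial) = mk (t ^ w) :=
    fun x hx hx0 => exists_mk_pow_eq h0 hk h2 x hx hx0
  refine ⟨L.toSubfield, fun a => ?_, fun i => ?_, exists_generator L.toSubfield h0 ht ?_
    (Nat.factorial_ne_zero _) hval⟩
  · exact L.algebraMap_mem (algebraMap ℝ k a)
  · exact subset_adjoin k _ ⟨i, Finset.mem_coe.2 (Finset.mem_univ i), rfl⟩
  · exact L.algebraMap_mem (⟨t, mem_adjoin_simple_self ℝ t⟩ : k)

end Uniformizer
section Expansion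

set_option linter.unusedSectionVars false

open Polynomial ArchimedeanClass

variable {F : Type} [Field F] [LinearOrder F] [IsStrictOrderedRing F]

theorem exists_expansion (f : ℝ →+*o F) (L : Subfield F) (hf : ∀ a, f a ∈ L) {u : F} (huL : u ∈ L)
    (hu0 : u ≠ 0) (hu : 0 < mk u) (hgen : ∀ x ∈ L, x ≠ 0 → ∃ q : ℤ, mk x = mk (u ^ q)) (K : ℕ)
    (x : F) (hx : x ∈ L) (hx0 : 0 ≤ mk x) :
    ∃ a : ℕ → ℝ, ∃ y : F, 0 ≤ mk y ∧ x = ∑ i ∈ Finset.range K, f (a i) * u ^ i + u ^ K * y := by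
  induction K generalizing x with
  | zero => exact ⟨0, x, hx0, by simp⟩
  | succ K ih =>
    have h1 := mk_sub_stdPart_pos f hx0
    obtain ⟨y, hyL, hy0, hy⟩ : ∃ y ∈ L, 0 ≤ mk y ∧ x = f (stdPart x) + u * y := by
      refine ⟨(x - f (stdPart x)) / u, div_mem (sub_mem hx (hf _)) huL, ?_, ?_⟩
      · by_cases h2 : x - f (stdPart x) = 0
        · rw [h2, zero_div, mk_zero]
          exact le_top
        · obtain ⟨q, hq⟩ := hgen _ (sub_mem hx (hf _)) h2
          have hm := mk_zpow_strictMono hu0 hu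
          have hq0 : 0 < q := by
            rw [hq, ← mk_one, ← zpow_zero u] at h1
            exact hm.lt_iff_lt.1 h1
          rw [mk_div, hq, ← mk_div, div_eq_mul_inv, ← zpow_sub_one₀ hu0, ← mk_one, ← zpow_zero u]
          exact hm.monotone (by omega)
      · rw [mul_div_cancel₀ _ hu0]
        ring
    obtain ⟨a, z, hz, h2⟩ := ih y hyL hy0
    generalize stdPart x = r at hy
    refine ⟨fun i => Nat.casesOn i r a, z, hz, ?_⟩
    have h3 : ∀ i, u * (f (a i) * u ^ i) = f (a i) * u ^ (i + 1) := fun i => by ring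
    rw [Finset.sum_range_succ', hy, h2, mul_add, Finset.mul_sum, pow_succ]
    simp only [h3, pow_zero, mul_one]
    change _ = ∑ i ∈ Finset.range K, f (a i) * u ^ (i + 1) + f r + u ^ K * u * z
    ring

theorem lexNonneg_of_nonneg (f : ℝ →+*o F) {u : F} (hu0 : 0 < u) (hu : 0 < mk u) {K : ℕ} (p : ℝ[X])
    {y : F} (hy : 0 ≤ mk y) (h : 0 ≤ p.eval₂ (f : ℝ →+* F) u + u ^ (K + 1) * y) :
    LexNonneg K p.coeff := by
  intro i hi h0
  obtain ⟨q, rfl⟩ := X_pow_dvd_iff.2 h0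
  have h1 := coeff_X_pow_mul q i 0
  rw [zero_add] at h1
  rw [h1]
  by_contra hneg
  rw [not_le] at hneg
  have hz : u * (q.divX.eval₂ (f : ℝ →+* F) u + u ^ (K - i) * y) < f (-q.coeff 0) := by
    refine lt_of_pos_of_archimedean f (hu.trans_le ?_) (neg_pos.2 hneg)
    rw [mk_mul]
    exact le_add_of_nonneg_right (mem_finiteSubring.1 (add_mem (eval₂_mem_finiteSubring f hu.le _)
      (mul_mem (pow_mem (mem_finiteSubring.2 hu.le) _) (mem_finiteSubring.2 hy))))
  have h2 : (Polynomial.X ^ i * q).eval₂ (f : ℝ →+* F) u + u ^ (K + 1) * y =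
      u ^ i * (u * (q.divX.eval₂ (f : ℝ →+* F) u + u ^ (K - i) * y) + f (q.coeff 0)) := by
    conv_lhs => rw [← divX_mul_X_add q]
    rw [eval₂_mul, eval₂_X_pow, eval₂_add, eval₂_mul, eval₂_X, eval₂_C,
      show K + 1 = i + (1 + (K - i)) by omega, pow_add, pow_add, pow_one]
    change _ * (_ + f (q.coeff 0)) + _ = _
    ring
  rw [h2] at h
  have h3 := nonneg_of_mul_nonneg_right h (pow_pos hu0 i)
  rw [map_neg] at hz
  linarith

theorem LexNonneg.eq_zero {K : ℕ} {p : ℝ[X]} (h : LexNonneg K p.coeff)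
    (h' : LexNonneg K (-p).coeff) : ∀ k ≤ K, p.coeff k = 0 := by
  intro k
  induction k using Nat.strong_induction_on with
  | _ k ih =>
    intro hk
    have h1 : ∀ j < k, p.coeff j = 0 := fun j hj => ih j hj (hj.le.trans hk)
    refine le_antisymm ?_ (h k hk h1)
    have := h' k hk fun j hj => by rw [coeff_neg, h1 j hj, neg_zero]
    rwa [coeff_neg, Left.nonneg_neg_iff] at this

end Expansion

section InfinitesimalSolution

set_option linter.unusedSectionVars false

open Polynomial ArchimedeanClass

variable {F : Type} [Field F] [LinearOrder F] [IsStrictOrderedRing F]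
variable {N : ℕ} {X : Fin N → Type} [∀ n, Fintype (X n)] [∀ n, DecidableEq (X n)]

theorem dvd_gain_sub {B : Type} [CommRing B] (G : Fin N → (∀ m, X m) → B) (σ : ∀ n, X n → B)
    {τ τ' : ∀ n, X n → B} {w : B} (h : ∀ n s, w ∣ τ n s - τ' n s) (n : Fin N) (s : X n) :
    w ∣ gain G σ τ n s - gain G σ τ' n s := by
  have key : ∀ p q : B, Ideal.Quotient.mk (Ideal.span {w}) p = Ideal.Quotient.mk (Ideal.span {w}) q ↔
      w ∣ p - q := fun p q => by
    rw [Ideal.Quotient.eq, Ideal.mem_span_singleton]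
  rw [← key, map_gain, map_gain]
  simp only [(key _ _).2 (h _ _)]

theorem exists_gain_eq (O : Subring F) {G : Fin N → (∀ m, X m) → F} {σ τ τ' y : ∀ n, X n → F}
    {w : F} (hw : w ∈ O) (hG : ∀ n p, G n p ∈ O) (hσ : ∀ n s, σ n s ∈ O) (hτ' : ∀ n s, τ' n s ∈ O)
    (hy : ∀ n s, y n s ∈ O) (h : ∀ n s, τ n s = τ' n s + w * y n s) (n : Fin N) (s : X n) :
    ∃ z ∈ O, gain G σ τ n s = gain G σ τ' n s + w * z := by
  have h1 := dvd_gain_sub (B := O) (fun n p => ⟨G n p, hG n p⟩) (fun n s => ⟨σ n s, hσ n s⟩)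
    (τ := fun n s => ⟨τ' n s, hτ' n s⟩ + ⟨w, hw⟩ * ⟨y n s, hy n s⟩)
    (τ' := fun n s => ⟨τ' n s, hτ' n s⟩) (w := ⟨w, hw⟩)
    (fun n s => ⟨⟨y n s, hy n s⟩, add_sub_cancel_left _ _⟩) n s
  obtain ⟨z, hz⟩ := h1
  refine ⟨z, z.2, ?_⟩
  have h2 := congrArg O.subtype hz
  rw [map_sub, map_gain, map_gain, sub_eq_iff_eq_add'] at h2
  rw [show τ = fun n s => τ' n s + w * y n s from funext fun n => funext fun s => h n s]
  exact h2

theorem exists_coreArc_of_sol (f : ℝ →+*o F) {t : F} (ht0 : 0 < t) (ht : 0 < mk t)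
    {G : Fin N → (∀ m, X m) → ℝ} {σ : Profile X} {τ : ∀ n, X n → F}
    (hS : Sol (fun n p => f (G n p)) (fun n s => f (σ n s)) t τ) {D : ℕ}
    {q : ∀ n, X n → ℕ → ℕ → ℝ} (hq : ∀ n s, ∃ i ≤ D, ∃ j ≤ D, q n s i j ≠ 0)
    (h : ∀ n s, ∑ i ∈ Finset.range (D + 1), ∑ j ∈ Finset.range (D + 1),
      f (q n s i j) * t ^ i * τ n s ^ j = 0) {d K : ℕ}
    (hd : d = D * (D ^ Fintype.card (Σ n, X n)).factorial) (hK : d ≤ K) :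
    ∃ a, CoreArc d K G σ a := by
  let P : (Σ n, X n) → ℕ → ℝ[X] := fun r j =>
    ∑ i ∈ Finset.range (D + 1), C (q r.1 r.2 i j) * Polynomial.X ^ i
  have hPdeg : ∀ r j, (P r j).natDegree ≤ D := fun r j =>
    natDegree_sum_le_of_forall_le _ _ fun i hi => (natDegree_C_mul_X_pow_le _ _).trans
      (Nat.lt_succ_iff.1 (Finset.mem_range.1 hi))
  have hPne : ∀ r, ∃ j ∈ Finset.range (D + 1), P r j ≠ 0 := by
    rintro ⟨n, s⟩
    obtain ⟨i, hi, j, hj, h1⟩ := hq n s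
    refine ⟨j, Finset.mem_range.2 (Nat.lt_succ_iff.2 hj), fun h2 => h1 ?_⟩
    have h3 := congrArg (fun p => p.coeff i) h2
    simp only [P, finsetSum_coeff, coeff_C_mul_X_pow, coeff_zero] at h3
    rwa [Finset.sum_ite_eq, if_pos (Finset.mem_range.2 (Nat.lt_succ_iff.2 hi))] at h3
  have hP : ∀ r : Σ n, X n, ∑ j ∈ Finset.range (D + 1),
      (P r j).eval₂ (f : ℝ →+* F) t * τ r.1 r.2 ^ j = 0 := by
    rintro ⟨n, s⟩
    refine Eq.trans ?_ (h n s)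
    rw [Finset.sum_comm]
    refine Finset.sum_congr rfl fun j _ => ?_
    simp only [P, eval₂_finsetSum, eval₂_mul, eval₂_C, eval₂_X_pow, Finset.sum_mul]
    rfl
  have hfO : ∀ a, f a ∈ finiteSubring F := fun a =>
    mem_finiteSubring.2 (mk_map_nonneg_of_archimedean f a)
  have hclose : ∀ n s, 0 < mk (τ n s - f (σ n s)) := fun n s => by
    refine ht.trans_le (mk_le_mk_of_abs ?_)
    rw [abs_of_pos ht0, abs_le]
    exact ⟨by linarith [hS.lower n s], by linarith [hS.upper n s]⟩
  have hτO : ∀ n s, τ n s ∈ finiteSubring F := fun n s => by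
    have := add_mem (mem_finiteSubring.2 (hclose n s).le) (hfO (σ n s))
    rwa [sub_add_cancel] at this
  obtain ⟨L, hfL, hτL, u, huL, hu0, hu, ⟨e, he, hte⟩, hgen⟩ :=
    exists_uniformizer f ht0.ne' ht (fun r : Σ n, X n => τ r.1 r.2) D P hPne hP
  have hord : ∀ n s, mk (τ n s) ≤ mk (u ^ d) := fun n s => by
    refine (mk_le_mk_pow_of_algebraic f ht0.ne' ht (mem_finiteSubring.1 (hτO n s))
      (hS.pos n s).ne' D (P ⟨n, s⟩) (hPdeg _) (hPne _) (hP ⟨n, s⟩)).trans ?_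
    rw [mk_pow, hte, ← mk_pow, ← pow_mul, ← zpow_natCast, ← zpow_natCast]
    refine (mk_zpow_strictMono hu0.ne' hu).monotone ?_
    rw [hd, mul_comm D]
    exact_mod_cast Nat.mul_le_mul_right D he
  choose b y hy hb using fun n s => exists_expansion f L hfL huL hu0.ne' hu hgen (K + 1) (τ n s)
    (hτL ⟨n, s⟩) (mem_finiteSubring.1 (hτO n s))
  let a : ∀ n, ℕ → X n → ℝ := fun n i s => b n s i
  have harc : ∀ n s, τ n s = (arc K a n s).eval₂ (f : ℝ →+* F) u + u ^ (K + 1) * y n s := by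
    intro n s
    rw [arc, eval₂_finsetSum]
    simp only [eval₂_mul, eval₂_C, eval₂_X_pow]
    exact hb n s
  have hlexa : ∀ n s, LexNonneg K (arc K a n s).coeff := fun n s =>
    lexNonneg_of_nonneg f hu0 hu _ (hy n s) ((hS.pos n s).le.trans_eq (harc n s))
  have huO : ∀ k, u ^ k ∈ finiteSubring F := fun k => pow_mem (mem_finiteSubring.2 hu.le) k
  refine ⟨a, ⟨fun n => ?_, fun n i hi1 hiK => ?_, fun n s => ?_, fun n s => ?_⟩⟩
  · funext s
    have h1 : 0 < mk (τ n s - f (a n 0 s)) := by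
      have h2 : τ n s - f (a n 0 s) =
          u * ((arc K a n s).divX.eval₂ (f : ℝ →+* F) u + u ^ K * y n s) := by
        rw [harc]
        conv_lhs => rw [← divX_mul_X_add (arc K a n s)]
        rw [eval₂_add, eval₂_mul, eval₂_X, eval₂_C, coeff_arc (Nat.zero_le K), pow_succ]
        change _ + f (a n 0 s) + _ - _ = _
        ring
      rw [h2, mk_mul]
      exact hu.trans_le (le_add_of_nonneg_right (mem_finiteSubring.1 (add_mem
        (eval₂_mem_finiteSubring f hu.le _) (mul_mem (huO K) (mem_finiteSubring.2 (hy n s))))))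
    rw [mk_sub_pos_iff f (mem_finiteSubring.1 (hτO n s))] at h1
    have h3 := hclose n s
    rw [mk_sub_pos_iff f (mem_finiteSubring.1 (hτO n s))] at h3
    exact h1.symm.trans h3
  · have h1 : (∑ s, arc K a n s - 1).eval₂ (f : ℝ →+* F) u + u ^ (K + 1) * ∑ s, y n s = 0 := by
      rw [eval₂_sub, eval₂_one, eval₂_finsetSum, Finset.mul_sum, sub_add_eq_add_sub,
        ← Finset.sum_add_distrib, ← hS.sum_eq n, sub_eq_zero]
      exact Finset.sum_congr rfl fun s _ => (harc n s).symm
    have hY : ∑ s, y n s ∈ finiteSubring F := sum_mem fun s _ => mem_finiteSubring.2 (hy n s)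
    have h2 := lexNonneg_of_nonneg f hu0 hu _ (mem_finiteSubring.1 hY) h1.ge
    have h3 := lexNonneg_of_nonneg (K := K) f hu0 hu (-(∑ s, arc K a n s - 1))
      (mem_finiteSubring.1 (neg_mem hY)) (by rw [eval₂_neg, mul_neg, ← neg_add, h1, neg_zero])
    have h4 := h2.eq_zero h3 i hiK
    rw [coeff_sub, finsetSum_coeff, coeff_one, if_neg (by omega), sub_zero] at h4
    simpa only [coeff_arc hiK] using h4
  · have h1 : ∃ i ≤ d, a n i s ≠ 0 := by
      by_contra hcon
      push Not at hcon
      obtain ⟨r, hr⟩ : (Polynomial.X : ℝ[X]) ^ (d + 1) ∣ arc K a n s :=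
        X_pow_dvd_iff.2 fun j hj => by rw [coeff_arc (by omega), hcon j (by omega)]
      have h2 : τ n s = u ^ (d + 1) * (r.eval₂ (f : ℝ →+* F) u + u ^ (K - d) * y n s) := by
        rw [harc, hr, eval₂_mul, eval₂_X_pow, show K + 1 = d + 1 + (K - d) by omega, pow_add]
        ring
      have h3 : mk (u ^ (d + 1)) ≤ mk (τ n s) := by
        rw [h2, mk_mul]
        exact le_add_of_nonneg_right (mem_finiteSubring.1 (add_mem
          (eval₂_mem_finiteSubring f hu.le _) (mul_mem (huO _) (mem_finiteSubring.2 (hy n s)))))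
      have h4 := mk_lt_mk_mul (pow_ne_zero d hu0.ne') hu
      rw [← pow_succ] at h4
      exact absurd (h3.trans (hord n s)) (not_le.2 h4)
    classical
    let i := Nat.find h1
    have hi := Nat.find_spec h1
    have hmin : ∀ j < i, a n j s = 0 := fun j hj => by
      by_contra h2
      exact Nat.find_min h1 hj ⟨hj.le.trans hi.1, h2⟩
    refine ⟨i, hi.1, lt_of_le_of_ne ?_ hi.2.symm, hmin⟩
    have h2 := hlexa n s i (hi.1.trans hK) fun j hj => by
      rw [coeff_arc (hj.le.trans (hi.1.trans hK)), hmin j hj]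
    rwa [coeff_arc (hi.1.trans hK)] at h2
  · obtain ⟨z, hz, h1⟩ := exists_gain_eq (finiteSubring F) (huO (K + 1)) (fun n p => hfO (G n p))
      (fun n s => hfO (σ n s)) (fun n s => eval₂_mem_finiteSubring f hu.le (arc K a n s))
      (fun n s => mem_finiteSubring.2 (hy n s)) harc n s
    refine lexNonneg_of_nonneg f hu0 hu (arcGain G σ (arc K a) n s) (mem_finiteSubring.1 hz) ?_
    refine (hS.gain_nonneg n s).trans_eq (h1.trans ?_)
    congr 1
    have h2 := map_gain (eval₂RingHom (f : ℝ →+* F) u) (fun n p => C (G n p)) (fun n s => C (σ n s))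
      (arc K a) n s
    simp only [coe_eval₂RingHom, eval₂_C] at h2
    exact h2.symm

theorem AlgSol.exists_coreArc {D : ℕ} {G : Fin N → (∀ m, X m) → ℝ} {σ : Profile X}
    (h : AlgSol D G σ) {d K : ℕ} (hd : d = D * (D ^ Fintype.card (Σ n, X n)).factorial)
    (hK : d ≤ K) : ∃ a, CoreArc d K G σ a := by
  obtain ⟨q, hq, h1⟩ := h
  choose δ τ hδ hS hrel using fun j : ℕ => h1 (1 / ((j : ℝ) + 1)) (by positivity)
  let 𝒰 : Ultrafilter ℕ := Filter.hyperfilter ℕ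
  let f : ℝ →+*o UPow 𝒰 ℝ :=
    { toRingHom := (UPow.ofFun 𝒰 ℝ).comp (Pi.constRingHom ℕ ℝ)
      monotone' := fun _ _ hab => UPow.ofFun_le.2 (Filter.Eventually.of_forall fun _ => hab) }
  have ht0 : 0 < UPow.ofFun 𝒰 ℝ δ := UPow.ofFun_pos.2 (Filter.Eventually.of_forall fun j => (hδ j).1)
  refine exists_coreArc_of_sol f (t := UPow.ofFun 𝒰 ℝ δ) ht0 ?_
    ((sol_uPow (𝒰 := 𝒰) (fun n p _ => G n p) (fun n s _ => σ n s) (fun n s j => τ j n s) δ).2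
      (Filter.Eventually.of_forall hS)) hq (fun n s => ?_) hd hK
  · rw [← mk_one, mk_lt_mk]
    intro m
    rw [abs_of_pos ht0, abs_one, nsmul_eq_mul, ← map_natCast (UPow.ofFun 𝒰 ℝ), ← map_mul,
      ← map_one (UPow.ofFun 𝒰 ℝ), UPow.ofFun_lt]
    have hcof : ∀ᶠ j in 𝒰, m ≤ j :=
      Filter.hyperfilter_le_cofinite (Nat.cofinite_eq_atTop ▸ Filter.eventually_ge_atTop m)
    filter_upwards [hcof] with j hj
    have h2 := (hδ j).2
    rw [lt_div_iff₀ (by positivity)] at h2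
    have h3 : (m : ℝ) ≤ j := Nat.cast_le.2 hj
    change (m : ℝ) * δ j < 1
    nlinarith [(hδ j).1]
  · have h2 : UPow.ofFun 𝒰 ℝ (∑ i ∈ Finset.range (D + 1), ∑ k ∈ Finset.range (D + 1),
        (fun _ => q n s i k) * δ ^ i * (fun j => τ j n s) ^ k) = 0 := by
      rw [← map_zero (UPow.ofFun 𝒰 ℝ)]
      congr 1
      funext j
      simpa only [Finset.sum_apply, Pi.mul_apply, Pi.pow_apply, Pi.zero_apply] using hrel j n s
    simp only [map_sum, map_mul, map_pow] at h2
    exact h2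

end InfinitesimalSolution
theorem IsMixed.of_equiv {N : ℕ} {X Y : Fin N → Type} [∀ n, Fintype (X n)] [∀ n, Fintype (Y n)] (e : ∀ n, X n ≃ Y n)
    {σ : Profile Y} (hσ : IsMixed σ) : IsMixed fun n s => σ n (e n s) := fun n =>
  ⟨fun _ => (hσ n).1 _, ((e n).sum_comp (σ n)).trans (hσ n).2⟩

theorem exists_uniform_orders {N : ℕ} (X : Fin N → Type) [∀ n, Fintype (X n)] [∀ n, DecidableEq (X n)] :
    ∃ ℓ K : ℕ, ℓ ≤ K ∧ ∀ (G : Fin N → (∀ m, X m) → ℝ) (σ : Profile X), IsMixed σ →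
      (IsPerfect G σ ↔ ∃ a, LPSArc ℓ K G σ a) := by
  obtain ⟨D, hD⟩ := exists_uniform_algSol X
  obtain ⟨K, hK, h⟩ :=
    exists_order_isPerfect X (D * (D ^ Fintype.card (Σ n, X n)).factorial)
  refine ⟨_, K, hK, fun G σ hσ => ⟨fun hp => ?_, fun ⟨a, ha⟩ => h G σ a ha⟩⟩
  obtain ⟨a, ha⟩ := (hD G σ ((isPerfect_iff G σ).1 hp)).exists_coreArc rfl hK
  exact ha.exists_lpsArc hσ

/-- existence of bounds ℓ ≤ K, depending only on N and the cardinalities of the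
pure-strategy sets, such that perfection is characterized by LPS profiles of order K. -/
theorem stmt0 (N : ℕ) (card : Fin N → ℕ) :
    ∃ ℓ K : ℕ, ℓ ≤ K ∧
      ∀ (S : Fin N → Type) [∀ n, Fintype (S n)] [∀ n, DecidableEq (S n)]
        [∀ n, Nonempty (S n)],
        (∀ n, Fintype.card (S n) = card n) →
        ∀ (G : Fin N → (∀ m, S m) → ℝ) (σ : Profile S), IsMixed σ →
          (IsPerfect G σ ↔
            ∃ ϱ : ∀ n, Fin (K+1) → S n → ℝ,
              (IsLPSProfile ϱ ∧ FullSupport ϱ ∧ lpsLevel ϱ ≤ ℓ) ∧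
              (∀ n, ϱ n 0 = σ n) ∧
              (∀ n, lpsBestReply G ϱ n (σ n) K)) := by
  obtain ⟨ℓ, K, hℓ, h⟩ := exists_uniform_orders fun n => Fin (card n)
  refine ⟨ℓ, K, hℓ, fun S _ _ _ hS G σ hσ => ?_⟩
  rw [exists_lps_iff hℓ G σ]
  let e : ∀ n, Fin (card n) ≃ S n := fun n => (Fintype.equivFinOfCardEq (hS n)).symm
  have key := h (fun n p => G n fun m => e m (p m)) (fun n s => σ n (e n s)) (hσ.of_equiv e)
  constructor
  · intro hp
    obtain ⟨a, ha⟩ := key.1 (isPerfect_of_equiv e G σ hp)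
    have := ha.of_equiv fun n => (e n).symm
    simp only [Equiv.apply_symm_apply] at this
    exact ⟨_, this⟩
  · rintro ⟨a, ha⟩
    have := isPerfect_of_equiv (fun n => (e n).symm) _ _ (key.2 ⟨_, ha.of_equiv e⟩)
    simpa only [Equiv.apply_symm_apply] using this

end GamePE
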